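/- Differential inequalities for the auxiliary functions: assume there exists ρ₀ ∈ (0,R) with limsup_{t→T*} (u(t,ρ₀) + v(t,ρ₀)) = ∞, and set ρ₁ = ρ₀/4, ρ₂ = ρ₀/2 and c(ρ) = sin²(π(ρ−ρ₁)/(ρ₂−ρ₁)). Then there exist γ, γ̄ > 1, κ > 0 and T₁ ∈ (0,T*) such that for every ε ∈ (0,1], the functions J(t,ρ) = u_ρ + ε c(ρ) u^γ and J̄(t,ρ) = v_ρ + ε κ c(ρ) v^{γ̄} satisfy, almost everywhere on [T₁,T*) × (ρ₁,ρ₂): J_t − δJ_ρρ − δ((n−1)/ρ)J_ρ + δ((n−1)/ρ²)J ≤ F_v(u,v)·J̄ + [F_u(u,v) − 2εδγ c'(ρ) u^{γ−1}]·J, and J̄_t − J̄_ρρ − ((n−1)/ρ)J̄_ρ + ((n−1)/ρ²)J̄ ≤ G_u(u,v)·J + [G_v(u,v) − 2εγ̄ κ c'(ρ) v^{γ̄−1}]·J̄. -/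

import Mathlib

open Set Filter MeasureTheory

section
open Topology in
theorem aux_deriv2_nonpos {f : ℝ → ℝ} {x : ℝ} (h : IsLocalMax f x) (hc : ContinuousAt f x) :
    deriv (deriv f) x ≤ 0 := by
  by_contra hlt
  push Not at hlt
  have h0 : deriv f x = 0 := h.deriv_eq_zero
  have hm : IsLocalMin f x := isLocalMin_of_deriv_deriv_pos hlt h0 hc
  have heq : f =ᶠ[𝓝 x] fun _ => f x := by
    filter_upwards [h, hm] with y h1 h2
    exact le_antisymm h1 h2
  have h1 : deriv f =ᶠ[𝓝 x] deriv (fun _ => f x) := heq.deriv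
  have h2 := h1.deriv_eq
  simp at h2
  linarith

theorem aux_left_deriv_nonneg {f : ℝ → ℝ} {d t t₁ : ℝ} (ht : t₁ < t) (hd : HasDerivAt f d t)
    (h : ∀ s, t₁ < s → s < t → f s ≤ f t) : 0 ≤ d := by
  have h1 : HasDerivWithinAt f d (Iio t) t := hd.hasDerivWithinAt
  rw [hasDerivWithinAt_iff_tendsto_slope' (by simp)] at h1
  refine ge_of_tendsto h1 ?_
  filter_upwards [Ioo_mem_nhdsLT ht] with s hs
  rw [slope_def_field]
  exact div_nonneg_of_nonpos (by linarith [h s hs.1 hs.2]) (by linarith [hs.2])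

open Topology in
theorem aux_mp_sys {t₁ t₂ a b : ℝ} (w1 w2 : ℝ → ℝ → ℝ)
    (hc1 : ContinuousOn (Function.uncurry w1) (Icc t₁ t₂ ×ˢ Icc a b))
    (hc2 : ContinuousOn (Function.uncurry w2) (Icc t₁ t₂ ×ˢ Icc a b))
    (hinit : ∀ x ∈ Icc a b, w1 t₁ x < 0 ∧ w2 t₁ x < 0)
    (hbd : ∀ t ∈ Icc t₁ t₂, (w1 t a < 0 ∧ w2 t a < 0) ∧ (w1 t b < 0 ∧ w2 t b < 0))
    (h1 : ∀ t ∈ Ioc t₁ t₂, ∀ x ∈ Ioo a b, w1 t x = 0 → w2 t x ≤ 0 → deriv (w1 t) x = 0 →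
      deriv (deriv (w1 t)) x ≤ 0 → ∃ d < 0, HasDerivAt (fun s => w1 s x) d t)
    (h2 : ∀ t ∈ Ioc t₁ t₂, ∀ x ∈ Ioo a b, w2 t x = 0 → w1 t x ≤ 0 → deriv (w2 t) x = 0 →
      deriv (deriv (w2 t)) x ≤ 0 → ∃ d < 0, HasDerivAt (fun s => w2 s x) d t) :
    ∀ t ∈ Icc t₁ t₂, ∀ x ∈ Icc a b, w1 t x < 0 ∧ w2 t x < 0 := by
  set K : Set (ℝ × ℝ) := Icc t₁ t₂ ×ˢ Icc a b with hK
  have hKc : IsCompact K := isCompact_Icc.prod isCompact_Icc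
  set W : ℝ × ℝ → ℝ := fun p => max (w1 p.1 p.2) (w2 p.1 p.2) with hW
  have hWc : ContinuousOn W K := by
    have := hc1.sup hc2
    exact this
  set B : Set (ℝ × ℝ) := K ∩ W ⁻¹' (Ici 0) with hB
  have hBc : IsCompact B := by
    have : IsClosed B := hWc.preimage_isClosed_of_isClosed hKc.isClosed isClosed_Ici
    exact hKc.of_isClosed_subset this inter_subset_left
  by_cases hne : B.Nonempty
  swap
  · rw [Set.not_nonempty_iff_eq_empty] at hne
    intro t ht x hx
    have hp : ((t, x) : ℝ × ℝ) ∉ B := by rw [hne]; simp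
    have : ¬ (0 ≤ W (t, x)) := fun h => hp ⟨⟨ht, hx⟩, h⟩
    simp only [hW, not_le, max_lt_iff] at this
    exact this
  exfalso
  obtain ⟨⟨t, x⟩, ⟨⟨ht, hx⟩, hpos⟩, hmin⟩ := hBc.exists_isMinOn hne continuous_fst.continuousOn
  simp only at ht hx
  have hneg : ∀ s, t₁ ≤ s → s < t → ∀ y ∈ Icc a b, W (s, y) < 0 := by
    intro s hs1 hs2 y hy
    by_contra hcon
    push Not at hcon
    have : ((s, y) : ℝ × ℝ) ∈ B := ⟨⟨⟨hs1, hs2.le.trans ht.2⟩, hy⟩, hcon⟩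
    have := hmin this
    simp only [mem_setOf_eq] at this
    linarith
  have hpos' : 0 ≤ W (t, x) := hpos
  have ht1 : t₁ < t := by
    rcases lt_or_eq_of_le ht.1 with h | h
    · exact h
    · exfalso
      have := hinit x hx
      rw [h] at this
      have h3 : W (t, x) < 0 := max_lt this.1 this.2
      linarith
  have hxa : a < x := by
    rcases lt_or_eq_of_le hx.1 with h | h
    · exact h
    · exfalso
      have := (hbd t ht).1
      rw [h] at this
      have h3 : W (t, x) < 0 := max_lt this.1 this.2
      linarith
  have hxb : x < b := by
    rcases lt_or_eq_of_le hx.2 with h | h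
    · exact h
    · exfalso
      have := (hbd t ht).2
      rw [← h] at this
      have h3 : W (t, x) < 0 := max_lt this.1 this.2
      linarith
  have hle : ∀ y ∈ Icc a b, W (t, y) ≤ 0 := by
    intro y hy
    have hcw : ContinuousWithinAt W K (t, y) := hWc _ ⟨ht, hy⟩
    have hmap : Tendsto (fun s : ℝ => (s, y)) (𝓝[<] t) (𝓝[K] (t, y)) := by
      refine tendsto_nhdsWithin_iff.2 ⟨?_, ?_⟩
      · have : Continuous (fun s : ℝ => (s, y)) := by fun_prop
        exact (this.tendsto t).mono_left nhdsWithin_le_nhds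
      · filter_upwards [Ioo_mem_nhdsLT ht1] with s hs
        exact ⟨⟨hs.1.le, hs.2.le.trans ht.2⟩, hy⟩
    refine le_of_tendsto (hcw.tendsto.comp hmap) ?_
    filter_upwards [Ioo_mem_nhdsLT ht1] with s hs
    exact (hneg s hs.1.le hs.2 y hy).le
  have hnb : Icc a b ∈ 𝓝 x := Icc_mem_nhds hxa hxb
  have key : ∀ w : ℝ → ℝ → ℝ, ContinuousOn (Function.uncurry w) K → w t x = 0 →
      (∀ y ∈ Icc a b, w t y ≤ 0) → (∀ s, t₁ < s → s < t → w s x ≤ 0) →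
      (deriv (w t) x = 0 → deriv (deriv (w t)) x ≤ 0 →
        ∃ d < 0, HasDerivAt (fun s => w s x) d t) → False := by
    intro w hwc hw0 hwle hws hd
    have hloc : IsLocalMax (w t) x := by
      filter_upwards [hnb] with y hy
      rw [hw0]; exact hwle y hy
    have hcx : ContinuousAt (w t) x := by
      have : ContinuousOn (w t) (Icc a b) := by
        have := hwc.comp (f := fun y : ℝ => (t, y)) (s := Icc a b) (by fun_prop)
          (fun y hy => ⟨ht, hy⟩)
        exact this
      exact this.continuousAt hnb
    obtain ⟨d, hd0, hd⟩ := hd hloc.deriv_eq_zero (aux_deriv2_nonpos hloc hcx)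
    have := aux_left_deriv_nonneg ht1 hd (fun s hs1 hs2 => by
      simp only [hw0]; exact hws s hs1 hs2)
    linarith
  have hWx := hle x hx
  have hW0 : W (t, x) = 0 := le_antisymm hWx hpos'
  have hw1 : ∀ y ∈ Icc a b, w1 t y ≤ 0 := fun y hy => (le_max_left _ _).trans (hle y hy)
  have hw2 : ∀ y ∈ Icc a b, w2 t y ≤ 0 := fun y hy => (le_max_right _ _).trans (hle y hy)
  have hs1 : ∀ s, t₁ < s → s < t → w1 s x ≤ 0 := fun s h h' =>
    (le_max_left _ _).trans (hneg s h.le h' x hx).le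
  have hs2 : ∀ s, t₁ < s → s < t → w2 s x ≤ 0 := fun s h h' =>
    (le_max_right _ _).trans (hneg s h.le h' x hx).le
  rcases max_choice (w1 t x) (w2 t x) with h | h
  · have h0 : w1 t x = 0 := by rw [← h]; exact hW0
    exact key w1 hc1 h0 hw1 hs1 (h1 t ⟨ht1, ht.2⟩ x ⟨hxa, hxb⟩ h0 (hw2 x hx))
  · have h0 : w2 t x = 0 := by rw [← h]; exact hW0
    exact key w2 hc2 h0 hw2 hs2 (h2 t ⟨ht1, ht.2⟩ x ⟨hxa, hxb⟩ h0 (hw1 x hx))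

theorem aux_mp {t₁ t₂ a b : ℝ} (w : ℝ → ℝ → ℝ)
    (hc : ContinuousOn (Function.uncurry w) (Icc t₁ t₂ ×ˢ Icc a b))
    (hinit : ∀ x ∈ Icc a b, w t₁ x < 0)
    (hbd : ∀ t ∈ Icc t₁ t₂, w t a < 0 ∧ w t b < 0)
    (h1 : ∀ t ∈ Ioc t₁ t₂, ∀ x ∈ Ioo a b, w t x = 0 → deriv (w t) x = 0 →
      deriv (deriv (w t)) x ≤ 0 → ∃ d < 0, HasDerivAt (fun s => w s x) d t) :
    ∀ t ∈ Icc t₁ t₂, ∀ x ∈ Icc a b, w t x < 0 := by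
  intro t ht x hx
  refine (aux_mp_sys w w hc hc (fun x hx => ⟨hinit x hx, hinit x hx⟩)
    (fun t ht => ⟨⟨(hbd t ht).1, (hbd t ht).1⟩, ⟨(hbd t ht).2, (hbd t ht).2⟩⟩) ?_ ?_ t ht x hx).1
  · intro t ht x hx a b c d
    exact h1 t ht x hx a c d
  · intro t ht x hx a b c d
    exact h1 t ht x hx a c d

open Topology in
/-- first and second derivative of a difference -/
theorem aux_deriv_sub {f g f1 g1 : ℝ → ℝ} {f2 g2 x : ℝ}
    (hf : ∀ᶠ y in 𝓝 x, HasDerivAt f (f1 y) y) (hf2 : HasDerivAt f1 f2 x)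
    (hg : ∀ᶠ y in 𝓝 x, HasDerivAt g (g1 y) y) (hg2 : HasDerivAt g1 g2 x) :
    deriv (fun y => f y - g y) x = f1 x - g1 x ∧
      deriv (deriv (fun y => f y - g y)) x = f2 - g2 := by
  have h1 : deriv (fun y => f y - g y) =ᶠ[𝓝 x] fun y => f1 y - g1 y := by
    filter_upwards [hf, hg] with y h1 h2
    exact (h1.sub h2).deriv
  refine ⟨h1.eq_of_nhds, ?_⟩
  rw [h1.deriv_eq]
  exact (hf2.sub hg2).deriv

end

section
structure AuxSol (δ : ℝ) (z f : ℝ → ℝ → ℝ) (Ω : Set (ℝ × ℝ)) : Prop where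
  cont : ContinuousOn (Function.uncurry z) Ω
  dx : ∀ t x, (t, x) ∈ Ω → DifferentiableAt ℝ (z t) x
  dxx : ∀ t x, (t, x) ∈ Ω → DifferentiableAt ℝ (deriv (z t)) x
  dt : ∀ t x, (t, x) ∈ Ω →
    HasDerivAt (fun s => z s x) (δ * deriv (deriv (z t)) x + f t x) t

open Topology

theorem aux_slice_nhds {Ω : Set (ℝ × ℝ)} (hΩ : IsOpen Ω) {t x : ℝ} (h : (t, x) ∈ Ω) :
    ∀ᶠ y in 𝓝 x, (t, y) ∈ Ω := by
  have : Continuous (fun y : ℝ => (t, y)) := by fun_prop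
  exact this.continuousAt.preimage_mem_nhds (hΩ.mem_nhds h)

theorem aux_slice_nhds' {Ω : Set (ℝ × ℝ)} (hΩ : IsOpen Ω) {t x : ℝ} (h : (t, x) ∈ Ω) :
    ∀ᶠ s in 𝓝 t, (s, x) ∈ Ω := by
  have : Continuous (fun y : ℝ => (y, x)) := by fun_prop
  exact this.continuousAt.preimage_mem_nhds (hΩ.mem_nhds h)

theorem AuxSol.mono {δ : ℝ} {z f : ℝ → ℝ → ℝ} {Ω Ω' : Set (ℝ × ℝ)} (h : AuxSol δ z f Ω)
    (hs : Ω' ⊆ Ω) : AuxSol δ z f Ω' :=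
  ⟨h.cont.mono hs, fun t x hx => h.dx t x (hs hx), fun t x hx => h.dxx t x (hs hx),
    fun t x hx => h.dt t x (hs hx)⟩

theorem AuxSol.sub {δ : ℝ} {z f z' f' : ℝ → ℝ → ℝ} {Ω : Set (ℝ × ℝ)} (hΩ : IsOpen Ω)
    (h : AuxSol δ z f Ω) (h' : AuxSol δ z' f' Ω) :
    AuxSol δ (fun t x => z t x - z' t x) (fun t x => f t x - f' t x) Ω ∧
    (∀ t x, (t, x) ∈ Ω → deriv (fun y => z t y - z' t y) x = deriv (z t) x - deriv (z' t) x ∧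
      deriv (deriv (fun y => z t y - z' t y)) x
        = deriv (deriv (z t)) x - deriv (deriv (z' t)) x) := by
  have key : ∀ t x, (t, x) ∈ Ω → deriv (fun y => z t y - z' t y) =ᶠ[𝓝 x]
      fun y => deriv (z t) y - deriv (z' t) y := by
    intro t x hx
    filter_upwards [aux_slice_nhds hΩ hx] with y hy
    exact ((h.dx t y hy).hasDerivAt.sub (h'.dx t y hy).hasDerivAt).deriv
  have key2 : ∀ t x, (t, x) ∈ Ω → HasDerivAt (deriv (fun y => z t y - z' t y))
      (deriv (deriv (z t)) x - deriv (deriv (z' t)) x) x := by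
    intro t x hx
    exact ((h.dxx t x hx).hasDerivAt.sub (h'.dxx t x hx).hasDerivAt).congr_of_eventuallyEq
      (key t x hx)
  refine ⟨⟨h.cont.sub h'.cont, fun t x hx => (h.dx t x hx).sub (h'.dx t x hx),
    fun t x hx => (key2 t x hx).differentiableAt, ?_⟩,
    fun t x hx => ⟨(key t x hx).eq_of_nhds, (key2 t x hx).deriv⟩⟩
  intro t x hx
  rw [(key2 t x hx).deriv]
  have := (h.dt t x hx).sub (h'.dt t x hx)
  exact this.congr_deriv (by ring)

theorem AuxSol.const_mul {δ : ℝ} {z f : ℝ → ℝ → ℝ} {Ω : Set (ℝ × ℝ)} (c : ℝ)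
    (h : AuxSol δ z f Ω) :
    AuxSol δ (fun t x => c * z t x) (fun t x => c * f t x) Ω := by
  have key : ∀ t, deriv (fun y => c * z t y) = fun y => c * deriv (z t) y := by
    intro t; ext y
    exact deriv_const_mul_field c
  have key2 : ∀ t, deriv (deriv (fun y => c * z t y)) = fun y => c * deriv (deriv (z t)) y := by
    intro t; rw [key]; ext y
    exact deriv_const_mul_field c
  refine ⟨continuousOn_const.mul h.cont, fun t x hx => (h.dx t x hx).const_mul c, ?_, ?_⟩
  · intro t x hx
    rw [key]
    exact (h.dxx t x hx).const_mul c
  · intro t x hx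
    rw [key2]
    have := (h.dt t x hx).const_mul c
    exact this.congr_deriv (by ring)

theorem AuxSol.shift {δ : ℝ} {z f : ℝ → ℝ → ℝ} {Ω : Set (ℝ × ℝ)} (a b : ℝ)
    (h : AuxSol δ z f Ω) :
    AuxSol δ (fun t x => z (t + a) (x + b)) (fun t x => f (t + a) (x + b))
      ((fun p : ℝ × ℝ => (p.1 + a, p.2 + b)) ⁻¹' Ω) := by
  have key : ∀ t, deriv (fun y => z t (y + b)) = fun y => deriv (z t) (y + b) := by
    intro t; ext y
    exact deriv_comp_add_const (z t) b y
  have key2 : ∀ t, deriv (deriv (fun y => z t (y + b))) = fun y => deriv (deriv (z t)) (y + b) := by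
    intro t; rw [key]; ext y
    exact deriv_comp_add_const (deriv (z t)) b y
  refine ⟨?_, ?_, ?_, ?_⟩
  · exact h.cont.comp (f := fun p : ℝ × ℝ => (p.1 + a, p.2 + b)) (by fun_prop) (fun p hp => hp)
  · intro t x hx
    have := h.dx (t + a) (x + b) hx
    exact (this.hasDerivAt.comp_add_const x b).differentiableAt
  · intro t x hx
    simp only [key]
    have := h.dxx (t + a) (x + b) hx
    exact (this.hasDerivAt.comp_add_const x b).differentiableAt
  · intro t x hx
    simp only [key2]
    exact (h.dt (t + a) (x + b) hx).comp_add_const t a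

theorem aux_grad_upper {δ : ℝ} (hδ : 0 < δ) {z f : ℝ → ℝ → ℝ} {Ω : Set (ℝ × ℝ)} (hΩ : IsOpen Ω)
    (h : AuxSol δ z f Ω) {l t₀ x₀ M N : ℝ} (hl : 0 < l)
    (hbox : ∀ t ∈ Icc (t₀ - l ^ 2) t₀, ∀ x ∈ Icc (x₀ - l) (x₀ + l), (t, x) ∈ Ω)
    (hM : ∀ t ∈ Icc (t₀ - l ^ 2) t₀, ∀ x ∈ Icc (x₀ - l) (x₀ + l), |z t x| ≤ M)
    (hN : ∀ t ∈ Icc (t₀ - l ^ 2) t₀, ∀ x ∈ Icc (x₀ - l) (x₀ + l), |f t x| ≤ N) :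
    deriv (z t₀) x₀ ≤ (2 * M + (l ^ 2 * N + M) / δ) / l := by
  have hl2 : 0 < l ^ 2 := by positivity
  have hM0 : 0 ≤ M := (abs_nonneg _).trans
    (hM t₀ ⟨by linarith, le_rfl⟩ x₀ ⟨by linarith, by linarith⟩)
  have hN0 : 0 ≤ N := (abs_nonneg _).trans
    (hN t₀ ⟨by linarith, le_rfl⟩ x₀ ⟨by linarith, by linarith⟩)
  set A := 2 * M + (l ^ 2 * N + M) / δ with hA
  have hA2 : 2 * M ≤ A := by
    have : 0 ≤ (l ^ 2 * N + M) / δ := by positivity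
    linarith
  have hA0 : 0 ≤ A := by linarith
  have hδA : l ^ 2 * N + M ≤ δ * A := by
    have : δ * A = δ * (2 * M) + (l ^ 2 * N + M) := by rw [hA]; field_simp
    rw [this]
    have : 0 ≤ δ * (2 * M) := by positivity
    linarith
  set t₁ := t₀ - l ^ 2 with ht₁
  have hmain : ∀ ε > 0, ∀ r ∈ Icc 0 l,
      l ^ 2 * (z t₀ (x₀ + r) - z t₀ (x₀ - r)) - (A * (2 * l * r - r ^ 2) + ε * (1 + l ^ 2)) < 0 := by
    intro ε hε r hr
    have := aux_mp (t₁ := t₁) (t₂ := t₀) (a := 0) (b := l)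
      (fun t r => (t - t₁) * (z t (x₀ + r) - z t (x₀ - r))
        - (A * (2 * l * r - r ^ 2) + ε * (1 + (t - t₁)))) ?_ ?_ ?_ ?_ t₀ ⟨by linarith, le_rfl⟩ r hr
    · have e : t₀ - t₁ = l ^ 2 := by rw [ht₁]; ring
      simp only [e] at this
      exact this
    · have c1 : ContinuousOn (fun p : ℝ × ℝ => z p.1 (x₀ + p.2)) (Icc t₁ t₀ ×ˢ Icc 0 l) :=
        h.cont.comp (f := fun p : ℝ × ℝ => (p.1, x₀ + p.2)) (by fun_prop) (fun p hp =>
          hbox _ hp.1 _ ⟨by linarith [hp.2.1], by linarith [hp.2.2]⟩)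
      have c2 : ContinuousOn (fun p : ℝ × ℝ => z p.1 (x₀ - p.2)) (Icc t₁ t₀ ×ˢ Icc 0 l) :=
        h.cont.comp (f := fun p : ℝ × ℝ => (p.1, x₀ - p.2)) (by fun_prop) (fun p hp =>
          hbox _ hp.1 _ ⟨by linarith [hp.2.2], by linarith [hp.2.1]⟩)
      have c3 : ContinuousOn (fun p : ℝ × ℝ => p.1 - t₁) (Icc t₁ t₀ ×ˢ Icc 0 l) := by fun_prop
      have c4 : ContinuousOn (fun p : ℝ × ℝ => (A * (2 * l * p.2 - p.2 ^ 2) + ε * (1 + (p.1 - t₁))))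
        (Icc t₁ t₀ ×ˢ Icc 0 l) := by fun_prop
      exact (c3.mul (c1.sub c2)).sub c4
    · intro x hx
      have : 0 ≤ A * (2 * l * x - x ^ 2) := mul_nonneg hA0 (by nlinarith [hx.1, hx.2])
      simp only [sub_self, zero_mul, add_zero, mul_one]
      linarith
    · intro t ht
      have h1 : 0 ≤ t - t₁ := by linarith [ht.1]
      have h2 : t - t₁ ≤ l ^ 2 := by linarith [ht.2]
      have h3 : 0 ≤ ε * (t - t₁) := by positivity
      constructor
      · simp only [add_zero, sub_zero, sub_self, mul_zero]
        nlinarith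
      · have a1 := abs_le.1 (hM t ht (x₀ + l) ⟨by linarith, by linarith⟩)
        have a2 := abs_le.1 (hM t ht (x₀ - l) ⟨by linarith, by linarith⟩)
        have h4 : (t - t₁) * (z t (x₀ + l) - z t (x₀ - l)) ≤ l ^ 2 * (2 * M) :=
          (mul_le_mul_of_nonneg_left (by linarith) h1).trans
            (mul_le_mul_of_nonneg_right h2 (by linarith))
        have h5 : l ^ 2 * (2 * M) ≤ l ^ 2 * A := mul_le_mul_of_nonneg_left hA2 hl2.le
        nlinarith
    · intro t ht r hr _ _ hdd
      have htm : t ∈ Icc t₁ t₀ := ⟨ht.1.le, ht.2⟩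
      have hp1 : (t, x₀ + r) ∈ Ω := hbox t htm _ ⟨by linarith [hr.1], by linarith [hr.2]⟩
      have hp2 : (t, x₀ - r) ∈ Ω := hbox t htm _ ⟨by linarith [hr.2], by linarith [hr.1]⟩
      have hd := aux_deriv_sub (x := r)
        (f := fun r => (t - t₁) * (z t (x₀ + r) - z t (x₀ - r)))
        (f1 := fun r => (t - t₁) * (deriv (z t) (x₀ + r) + deriv (z t) (x₀ - r)))
        (f2 := (t - t₁) * (deriv (deriv (z t)) (x₀ + r) - deriv (deriv (z t)) (x₀ - r)))
        (g := fun r => (A * (2 * l * r - r ^ 2) + ε * (1 + (t - t₁))))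
        (g1 := fun r => A * (2 * l - 2 * r)) (g2 := A * (-2)) ?_ ?_ ?_ ?_
      · rw [hd.2] at hdd
        have d1 := h.dt t _ hp1
        have d2 := h.dt t _ hp2
        have d3 := (((hasDerivAt_id t).sub_const t₁).mul (d1.sub d2)).sub
          (((((hasDerivAt_id t).sub_const t₁).const_add 1).const_mul ε).const_add
            (A * (2 * l * r - r ^ 2)))
        refine ⟨_, ?_, d3⟩
        simp only [id]
        have a1 := abs_le.1 (hM t htm (x₀ + r) ⟨by linarith [hr.1], by linarith [hr.2]⟩)
        have a2 := abs_le.1 (hM t htm (x₀ - r) ⟨by linarith [hr.2], by linarith [hr.1]⟩)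
        have b1 := abs_le.1 (hN t htm (x₀ + r) ⟨by linarith [hr.1], by linarith [hr.2]⟩)
        have b2 := abs_le.1 (hN t htm (x₀ - r) ⟨by linarith [hr.2], by linarith [hr.1]⟩)
        have h1 : 0 ≤ t - t₁ := by linarith [ht.1]
        have h2 : t - t₁ ≤ l ^ 2 := by linarith [ht.2]
        have h4 : (t - t₁) * (f t (x₀ + r) - f t (x₀ - r)) ≤ l ^ 2 * (2 * N) :=
          (mul_le_mul_of_nonneg_left (by linarith) h1).trans
            (mul_le_mul_of_nonneg_right h2 (by linarith))
        have h5 : δ * ((t - t₁) * (deriv (deriv (z t)) (x₀ + r) - deriv (deriv (z t)) (x₀ - r)))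
          ≤ δ * (A * (-2)) := mul_le_mul_of_nonneg_left (by linarith) hδ.le
        simp only [Pi.sub_apply]
        nlinarith
      · filter_upwards [Ioo_mem_nhds hr.1 hr.2] with y hy
        have q1 : (t, x₀ + y) ∈ Ω := hbox t htm _ ⟨by linarith [hy.1], by linarith [hy.2]⟩
        have q2 : (t, x₀ - y) ∈ Ω := hbox t htm _ ⟨by linarith [hy.2], by linarith [hy.1]⟩
        have e1 := (h.dx t _ q1).hasDerivAt.comp_const_add x₀ y
        have e2 := (h.dx t _ q2).hasDerivAt.comp_const_sub x₀ y
        exact ((e1.sub e2).const_mul (t - t₁)).congr_deriv (by ring)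
      · have e1 := (h.dxx t _ hp1).hasDerivAt.comp_const_add x₀ r
        have e2 := (h.dxx t _ hp2).hasDerivAt.comp_const_sub x₀ r
        exact ((e1.add e2).const_mul (t - t₁)).congr_deriv (by ring)
      · refine Eventually.of_forall fun y => ?_
        have := ((((hasDerivAt_id y).const_mul (2 * l)).sub ((hasDerivAt_id y).pow 2)).const_mul
          A).add_const (ε * (1 + (t - t₁)))
        exact this.congr_deriv (by simp)
      · have := (((hasDerivAt_id r).const_mul 2).const_sub (2 * l)).const_mul A
        exact this.congr_deriv (by simp)
  have hmain2 : ∀ r ∈ Icc 0 l, l ^ 2 * (z t₀ (x₀ + r) - z t₀ (x₀ - r)) ≤ 2 * A * l * r := by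
    intro r hr
    have h1 : l ^ 2 * (z t₀ (x₀ + r) - z t₀ (x₀ - r)) ≤ A * (2 * l * r - r ^ 2) := by
      refine le_of_forall_pos_le_add fun η hη => ?_
      have := hmain (η / (1 + l ^ 2)) (by positivity) r hr
      have e : η / (1 + l ^ 2) * (1 + l ^ 2) = η := by field_simp
      rw [e] at this
      linarith
    have : 0 ≤ A * r ^ 2 := by positivity
    nlinarith
  have hx0 : (t₀, x₀) ∈ Ω := hbox t₀ ⟨by linarith, le_rfl⟩ x₀ ⟨by linarith, by linarith⟩
  have hE : HasDerivAt (fun r => z t₀ (x₀ + r) - z t₀ (x₀ - r)) (2 * deriv (z t₀) x₀) 0 := by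
    have e0 : HasDerivAt (z t₀) (deriv (z t₀) x₀) (x₀ + 0) := by
      simpa using (h.dx t₀ x₀ hx0).hasDerivAt
    have e0' : HasDerivAt (z t₀) (deriv (z t₀) x₀) (x₀ - 0) := by
      simpa using (h.dx t₀ x₀ hx0).hasDerivAt
    exact ((e0.comp_const_add x₀ 0).sub (e0'.comp_const_sub x₀ 0)).congr_deriv (by ring)
  have h1 : HasDerivWithinAt (fun r => z t₀ (x₀ + r) - z t₀ (x₀ - r)) (2 * deriv (z t₀) x₀) (Ioi 0) 0 :=
    hE.hasDerivWithinAt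
  rw [hasDerivWithinAt_iff_tendsto_slope' (by simp)] at h1
  have h2 : 2 * deriv (z t₀) x₀ ≤ 2 * A / l := by
    refine le_of_tendsto h1 ?_
    filter_upwards [Ioo_mem_nhdsGT hl] with s hs
    rw [slope_def_field]
    simp only [add_zero, sub_zero, sub_self]
    have := hmain2 s ⟨hs.1.le, hs.2.le⟩
    rw [div_le_div_iff₀ hs.1 hl]
    have h3 : l * ((z t₀ (x₀ + s) - z t₀ (x₀ - s)) * l) ≤ l * (2 * A * s) := by nlinarith
    exact le_of_mul_le_mul_left h3 hl
  have : 2 * A / l = 2 * (A / l) := by ring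
  linarith

theorem aux_grad {δ : ℝ} (hδ : 0 < δ) {z f : ℝ → ℝ → ℝ} {Ω : Set (ℝ × ℝ)} (hΩ : IsOpen Ω)
    (h : AuxSol δ z f Ω) {l t₀ x₀ M N : ℝ} (hl : 0 < l)
    (hbox : ∀ t ∈ Icc (t₀ - l ^ 2) t₀, ∀ x ∈ Icc (x₀ - l) (x₀ + l), (t, x) ∈ Ω)
    (hM : ∀ t ∈ Icc (t₀ - l ^ 2) t₀, ∀ x ∈ Icc (x₀ - l) (x₀ + l), |z t x| ≤ M)
    (hN : ∀ t ∈ Icc (t₀ - l ^ 2) t₀, ∀ x ∈ Icc (x₀ - l) (x₀ + l), |f t x| ≤ N) :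
    |deriv (z t₀) x₀| ≤ (2 * M + (l ^ 2 * N + M) / δ) / l := by
  rw [abs_le]
  refine ⟨?_, aux_grad_upper hδ hΩ h hl hbox hM hN⟩
  have h' := h.const_mul (-1)
  have := aux_grad_upper hδ hΩ h' hl hbox (M := M) (N := N)
    (fun t ht x hx => by simpa using hM t ht x hx) (fun t ht x hx => by simpa using hN t ht x hx)
  have e : deriv (fun y => -1 * z t₀ y) x₀ = -1 * deriv (z t₀) x₀ := deriv_const_mul_field _
  rw [e] at this
  linarith

end

section
open Topology

theorem aux_thick {Ω K : Set (ℝ × ℝ)} (hΩ : IsOpen Ω) (hK : IsCompact K) (hKΩ : K ⊆ Ω) :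
    ∃ l > 0, l ≤ 1 ∧ ∃ K', IsCompact K' ∧ K' ⊆ Ω ∧
      ∀ p ∈ K, ∀ a b : ℝ, |a| ≤ l → |b| ≤ l → (p.1 + a, p.2 + b) ∈ K' := by
  obtain ⟨l, hl, h⟩ := hK.exists_cthickening_subset_open hΩ hKΩ
  refine ⟨min l 1, by positivity, min_le_right _ _, _, hK.cthickening, h, ?_⟩
  intro p hp a b ha hb
  refine Metric.mem_cthickening_of_dist_le _ p _ _ hp ?_
  rw [Prod.dist_eq]
  simp only [Real.dist_eq, add_sub_cancel_left]
  exact max_le (ha.trans (min_le_left _ _)) (hb.trans (min_le_left _ _))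

theorem aux_grad_unif {δ : ℝ} (hδ : 0 < δ) {Ω K : Set (ℝ × ℝ)} (hΩ : IsOpen Ω) (hK : IsCompact K)
    (hKΩ : K ⊆ Ω) : ∃ K', IsCompact K' ∧ K' ⊆ Ω ∧ K ⊆ K' ∧ ∃ B > 0, ∀ z f Ω', IsOpen Ω' → K' ⊆ Ω' →
      AuxSol δ z f Ω' → ∀ m, (∀ t x, (t, x) ∈ K' → |z t x| ≤ m) →
      (∀ t x, (t, x) ∈ K' → |f t x| ≤ m) → ∀ t x, (t, x) ∈ K → |deriv (z t) x| ≤ B * m := by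
  obtain ⟨l, hl, hl1, K', hK', hK'Ω, hb⟩ := aux_thick hΩ hK hKΩ
  refine ⟨K', hK', hK'Ω, fun p hp => by
    simpa using hb p hp 0 0 (by simpa using hl.le) (by simpa using hl.le), (2 + (l ^ 2 + 1) / δ) / l, by positivity, ?_⟩
  intro z f Ω' hΩ' hK'' h m hz hf t x htx
  have hbox : ∀ t' ∈ Icc (t - l ^ 2) t, ∀ x' ∈ Icc (x - l) (x + l), (t', x') ∈ K' := by
    intro t' ht' x' hx'
    have := hb _ htx (t' - t) (x' - x) (abs_le.2 ⟨by nlinarith [ht'.1], by linarith [ht'.2]⟩)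
      (abs_le.2 ⟨by linarith [hx'.1], by linarith [hx'.2]⟩)
    simpa using this
  have := aux_grad hδ hΩ' h hl (fun t' ht' x' hx' => hK'' (hbox t' ht' x' hx'))
    (fun t' ht' x' hx' => hz _ _ (hbox t' ht' x' hx'))
    (fun t' ht' x' hx' => hf _ _ (hbox t' ht' x' hx'))
  refine this.trans (le_of_eq ?_)
  field_simp

theorem aux_uc {φ : ℝ → ℝ → ℝ} {Ω K : Set (ℝ × ℝ)} (hΩ : IsOpen Ω) (hK : IsCompact K)
    (hKΩ : K ⊆ Ω) (hφ : ContinuousOn (Function.uncurry φ) Ω) {ε : ℝ} (hε : 0 < ε) :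
    ∃ d > 0, ∀ t x, (t, x) ∈ K → ∀ a b, |a| < d → |b| < d →
      (t + a, x + b) ∈ Ω ∧ |φ (t + a) (x + b) - φ t x| ≤ ε := by
  obtain ⟨l, hl, hl1, K', hK', hK'Ω, hb⟩ := aux_thick hΩ hK hKΩ
  have huc := hK'.uniformContinuousOn_of_continuous (hφ.mono hK'Ω)
  obtain ⟨d, hd, h⟩ := Metric.uniformContinuousOn_iff.1 huc ε hε
  refine ⟨min d l, by positivity, ?_⟩
  intro t x htx a b ha hb'
  have h1 := hb _ htx a b (ha.le.trans (min_le_right _ _)) (hb'.le.trans (min_le_right _ _))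
  have h0 := hb _ htx 0 0 (by simpa using hl.le) (by simpa using hl.le)
  refine ⟨hK'Ω h1, ?_⟩
  have := h _ h1 _ h0 (by
    rw [Prod.dist_eq]
    simp only [Real.dist_eq, add_sub_cancel_left, add_zero]
    exact max_lt (ha.trans_le (min_le_left _ _)) (hb'.trans_le (min_le_left _ _)))
  simp only [Function.uncurry, Real.dist_eq, add_zero] at this
  exact this.le

theorem aux_cont_dx {δ : ℝ} (hδ : 0 < δ) {z f : ℝ → ℝ → ℝ} {Ω : Set (ℝ × ℝ)} (hΩ : IsOpen Ω)
    (h : AuxSol δ z f Ω) (hf : ContinuousOn (Function.uncurry f) Ω) :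
    ContinuousOn (Function.uncurry (fun t x => deriv (z t) x)) Ω := by
  intro p hp
  refine ContinuousAt.continuousWithinAt ?_
  obtain ⟨K', hK', hK'Ω, hKK', B, hB, H⟩ := aux_grad_unif hδ hΩ (isCompact_singleton (x := p))
    (by simpa using hp)
  rw [Metric.continuousAt_iff]
  intro ε hε
  have hε' : 0 < ε / (2 * B) := by positivity
  obtain ⟨d1, hd1, h1⟩ := aux_uc hΩ hK' hK'Ω h.cont hε'
  obtain ⟨d2, hd2, h2⟩ := aux_uc hΩ hK' hK'Ω hf hε'
  refine ⟨min d1 d2, by positivity, ?_⟩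
  intro p' hp'
  rw [Prod.dist_eq, max_lt_iff, Real.dist_eq, Real.dist_eq] at hp'
  set a := p'.1 - p.1
  set b := p'.2 - p.2
  have hs := (h.shift a b).mono
    (inter_subset_left : ((fun q : ℝ × ℝ => (q.1 + a, q.2 + b)) ⁻¹' Ω) ∩ Ω ⊆ _)
  have hc : Continuous (fun q : ℝ × ℝ => (q.1 + a, q.2 + b)) := by fun_prop
  have hop : IsOpen (((fun q : ℝ × ℝ => (q.1 + a, q.2 + b)) ⁻¹' Ω) ∩ Ω) :=
    (hΩ.preimage hc).inter hΩ
  have hsub := hs.sub hop (h.mono inter_subset_right)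
  have ha1 := hp'.1.trans_le (min_le_left _ _)
  have ha2 := hp'.1.trans_le (min_le_right _ _)
  have hb1 := hp'.2.trans_le (min_le_left _ _)
  have hb2 := hp'.2.trans_le (min_le_right _ _)
  have hin : K' ⊆ ((fun q : ℝ × ℝ => (q.1 + a, q.2 + b)) ⁻¹' Ω) ∩ Ω := by
    intro q hq
    exact ⟨(h1 q.1 q.2 hq a b ha1 hb1).1, hK'Ω hq⟩
  have := H _ _ _ hop hin hsub.1 (ε / (2 * B))
    (fun t x htx => (h1 t x htx a b ha1 hb1).2) (fun t x htx => (h2 t x htx a b ha2 hb2).2)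
    p.1 p.2 rfl
  have hpin : (p.1, p.2) ∈ ((fun q : ℝ × ℝ => (q.1 + a, q.2 + b)) ⁻¹' Ω) ∩ Ω :=
    hin (hKK' rfl)
  rw [(hsub.2 p.1 p.2 hpin).1, deriv_comp_add_const] at this
  simp only [a, b, add_sub_cancel] at this
  simp only [Function.uncurry, Real.dist_eq]
  refine this.trans_lt ?_
  field_simp
  norm_num

noncomputable def auxDq (h : ℝ) (z : ℝ → ℝ → ℝ) : ℝ → ℝ → ℝ := fun t x => h⁻¹ * (z t (x + h) - z t x)

def auxSh (h : ℝ) (Ω : Set (ℝ × ℝ)) : Set (ℝ × ℝ) := ((fun q : ℝ × ℝ => (q.1 + 0, q.2 + h)) ⁻¹' Ω) ∩ Ω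

theorem auxSh_open {h : ℝ} {Ω : Set (ℝ × ℝ)} (hΩ : IsOpen Ω) : IsOpen (auxSh h Ω) := by
  have hc : Continuous (fun q : ℝ × ℝ => (q.1 + 0, q.2 + h)) := by fun_prop
  exact (hΩ.preimage hc).inter hΩ

theorem auxSh_mem {h t x : ℝ} {Ω : Set (ℝ × ℝ)} (hx : (t, x) ∈ auxSh h Ω) :
    (t, x + h) ∈ Ω ∧ (t, x) ∈ Ω := by
  have := hx.1
  simp only [mem_preimage, add_zero] at this
  exact ⟨this, hx.2⟩

theorem aux_dq_sol {δ h : ℝ} {z f : ℝ → ℝ → ℝ} {Ω : Set (ℝ × ℝ)} (hΩ : IsOpen Ω)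
    (hs : AuxSol δ z f Ω) :
    AuxSol δ (auxDq h z) (auxDq h f) (auxSh h Ω) ∧
    ∀ t x, (t, x) ∈ auxSh h Ω → deriv (auxDq h z t) x = auxDq h (fun t x => deriv (z t) x) t x := by
  have h1 := (hs.shift 0 h).mono (inter_subset_left : auxSh h Ω ⊆ _)
  have h2 := h1.sub (auxSh_open hΩ) (hs.mono inter_subset_right)
  have h3 := h2.1.const_mul h⁻¹
  simp only [add_zero] at h3 h2
  refine ⟨h3, ?_⟩
  intro t x htx
  have e : deriv (auxDq h z t) x = h⁻¹ * deriv (fun x => z t (x + h) - z t x) x :=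
    deriv_const_mul_field _
  rw [e, (h2.2 t x htx).1, deriv_comp_add_const]
  rfl

theorem aux_dq_conv {φ ψ : ℝ → ℝ → ℝ} {Ω K : Set (ℝ × ℝ)} (hΩ : IsOpen Ω) (hK : IsCompact K)
    (hKΩ : K ⊆ Ω) (hd : ∀ t x, (t, x) ∈ Ω → HasDerivAt (φ t) (ψ t x) x)
    (hψ : ContinuousOn (Function.uncurry ψ) Ω) {ε : ℝ} (hε : 0 < ε) :
    ∃ d > 0, ∀ h, h ≠ 0 → |h| < d → K ⊆ auxSh h Ω ∧ ∀ t x, (t, x) ∈ K →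
      |auxDq h φ t x - ψ t x| ≤ ε := by
  obtain ⟨d, hd', H⟩ := aux_uc hΩ hK hKΩ hψ hε
  refine ⟨d, hd', ?_⟩
  intro h h0 hh
  refine ⟨fun q hq => ⟨(H q.1 q.2 hq 0 h (by simpa using hd') hh).1, hKΩ hq⟩, ?_⟩
  intro t x htx
  have H' : ∀ b, |b| < d → (t, x + b) ∈ Ω ∧ |ψ t (x + b) - ψ t x| ≤ ε := by
    intro b hb
    simpa using H t x htx 0 b (by simpa using hd') hb
  have key : ‖(φ t (x + h) - ψ t x * (x + h)) - (φ t x - ψ t x * x)‖ ≤ ε * ‖x + h - x‖ := by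
    refine Convex.norm_image_sub_le_of_norm_hasDerivWithin_le (s := uIcc x (x + h))
      (f := fun y => φ t y - ψ t x * y) (f' := fun y => ψ t y - ψ t x) ?_ ?_ (convex_uIcc _ _)
      left_mem_uIcc right_mem_uIcc
    · intro y hy
      have hy' : |y - x| < d := by
        have := abs_sub_left_of_mem_uIcc hy
        simp only [add_sub_cancel_left] at this
        exact this.trans_lt hh
      have := (H' _ hy').1
      simp only [add_sub_cancel] at this
      have e := (hd t y this).sub ((hasDerivAt_id y).const_mul (ψ t x))
      exact (e.congr_deriv (by simp)).hasDerivWithinAt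
    · intro y hy
      have hy' : |y - x| < d := by
        have := abs_sub_left_of_mem_uIcc hy
        simp only [add_sub_cancel_left] at this
        exact this.trans_lt hh
      have := (H' _ hy').2
      simp only [add_sub_cancel] at this
      exact this
  simp only [add_sub_cancel_left, Real.norm_eq_abs] at key
  have e : auxDq h φ t x - ψ t x
      = h⁻¹ * ((φ t (x + h) - ψ t x * (x + h)) - (φ t x - ψ t x * x)) := by
    unfold auxDq
    field_simp
    ring
  rw [e, abs_mul, abs_inv]
  have h1 : 0 < |h| := abs_pos.2 h0
  calc |h|⁻¹ * _ ≤ |h|⁻¹ * (ε * |h|) := by gcongr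
    _ = ε := by field_simp

theorem aux_dq_cauchy {δ : ℝ} (hδ : 0 < δ) {z f g : ℝ → ℝ → ℝ} {Ω K : Set (ℝ × ℝ)} (hΩ : IsOpen Ω)
    (h : AuxSol δ z f Ω) (hf : ContinuousOn (Function.uncurry f) Ω)
    (hfd : ∀ t x, (t, x) ∈ Ω → HasDerivAt (f t) (g t x) x)
    (hg : ContinuousOn (Function.uncurry g) Ω) (hK : IsCompact K)
    (hKΩ : K ⊆ Ω) {ε : ℝ} (hε : 0 < ε) :
    ∃ d > 0, ∀ a, a ≠ 0 → |a| < d → K ⊆ auxSh a Ω ∧ ∀ t x, (t, x) ∈ K →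
      |auxDq a (fun t x => deriv (z t) x) t x - deriv (deriv (z t)) x| ≤ ε := by
  obtain ⟨K', hK', hK'Ω, hKK', B, hB, H⟩ := aux_grad_unif hδ hΩ hK hKΩ
  have hε' : 0 < ε / (2 * B) := by positivity
  obtain ⟨d1, hd1, h1⟩ := aux_dq_conv hΩ hK' hK'Ω (fun t x hx => (h.dx t x hx).hasDerivAt)
    (aux_cont_dx hδ hΩ h hf) hε'
  obtain ⟨d2, hd2, h2⟩ := aux_dq_conv hΩ hK' hK'Ω hfd hg hε'
  refine ⟨min d1 d2, by positivity, ?_⟩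
  have key : ∀ a b, a ≠ 0 → |a| < min d1 d2 → b ≠ 0 → |b| < min d1 d2 → ∀ t x, (t, x) ∈ K →
      |auxDq a (fun t x => deriv (z t) x) t x - auxDq b (fun t x => deriv (z t) x) t x| ≤ ε := by
    intro a b ha ha' hb hb' t x htx
    have sa := aux_dq_sol (h := a) hΩ h
    have sb := aux_dq_sol (h := b) hΩ h
    have hop : IsOpen (auxSh a Ω ∩ auxSh b Ω) := (auxSh_open hΩ).inter (auxSh_open hΩ)
    have ss := (sa.1.mono inter_subset_left).sub hop (sb.1.mono inter_subset_right)
    have a1 := h1 a ha (ha'.trans_le (min_le_left _ _))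
    have a2 := h2 a ha (ha'.trans_le (min_le_right _ _))
    have b1 := h1 b hb (hb'.trans_le (min_le_left _ _))
    have b2 := h2 b hb (hb'.trans_le (min_le_right _ _))
    have hsub : K' ⊆ auxSh a Ω ∩ auxSh b Ω := fun q hq => ⟨a1.1 hq, b1.1 hq⟩
    have := H _ _ _ hop hsub ss.1 (ε / B)
      (fun t x hx => by
        have e1 := abs_le.1 (a1.2 t x hx)
        have e2 := abs_le.1 (b1.2 t x hx)
        have e3 : ε / B = 2 * (ε / (2 * B)) := by field_simp
        exact abs_le.2 ⟨by linarith, by linarith⟩)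
      (fun t x hx => by
        have e1 := abs_le.1 (a2.2 t x hx)
        have e2 := abs_le.1 (b2.2 t x hx)
        have e3 : ε / B = 2 * (ε / (2 * B)) := by field_simp
        exact abs_le.2 ⟨by linarith, by linarith⟩) t x htx
    have hin := hsub (hKK' htx)
    rw [(ss.2 t x hin).1, sa.2 t x hin.1, sb.2 t x hin.2] at this
    exact this.trans (le_of_eq (by field_simp))
  intro a ha ha'
  refine ⟨hKK'.trans (h1 a ha (ha'.trans_le (min_le_left _ _))).1, ?_⟩
  intro t x htx
  have hlim : Tendsto (fun b => auxDq b (fun t x => deriv (z t) x) t x) (𝓝[≠] 0)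
      (𝓝 (deriv (deriv (z t)) x)) := by
    have := (h.dxx t x (hKΩ htx)).hasDerivAt.tendsto_slope_zero
    exact this
  have h3 := (tendsto_const_nhds (x := auxDq a (fun t x => deriv (z t) x) t x)).sub hlim
  refine le_of_tendsto h3.abs ?_
  have : {b : ℝ | |b| < min d1 d2} ∈ 𝓝 (0:ℝ) := by
    have := Metric.ball_mem_nhds (0:ℝ) (lt_min hd1 hd2)
    refine mem_of_superset this fun y hy => ?_
    simpa [Real.dist_eq] using hy
  filter_upwards [self_mem_nhdsWithin, mem_nhdsWithin_of_mem_nhds this] with b hb hb'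
  exact key a b ha ha' hb hb' t x htx

theorem aux_cont_comp {φ : ℝ → ℝ → ℝ} {h : ℝ} {Ω : Set (ℝ × ℝ)}
    (hφ : ContinuousOn (Function.uncurry φ) Ω) :
    ContinuousOn (Function.uncurry (auxDq h φ)) (auxSh h Ω) := by
  have c1 : ContinuousOn (fun p : ℝ × ℝ => φ p.1 (p.2 + h)) (auxSh h Ω) :=
    hφ.comp (f := fun p : ℝ × ℝ => (p.1, p.2 + h)) (by fun_prop) (fun p hp => (auxSh_mem hp).1)
  exact continuousOn_const.mul (c1.sub (hφ.mono inter_subset_right))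

theorem aux_cont_dxx {δ : ℝ} (hδ : 0 < δ) {z f g : ℝ → ℝ → ℝ} {Ω : Set (ℝ × ℝ)} (hΩ : IsOpen Ω)
    (h : AuxSol δ z f Ω) (hf : ContinuousOn (Function.uncurry f) Ω)
    (hfd : ∀ t x, (t, x) ∈ Ω → HasDerivAt (f t) (g t x) x)
    (hg : ContinuousOn (Function.uncurry g) Ω) :
    ContinuousOn (Function.uncurry (fun t x => deriv (deriv (z t)) x)) Ω := by
  intro p hp
  refine ContinuousAt.continuousWithinAt ?_
  obtain ⟨r, hr, hball⟩ := Metric.nhds_basis_closedBall.mem_iff.1 (hΩ.mem_nhds hp)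
  have hKc : IsCompact (Metric.closedBall p r) := isCompact_closedBall p r
  refine ContinuousOn.continuousAt ?_ (Metric.closedBall_mem_nhds p hr)
  refine continuousOn_of_uniform_approx_of_continuousOn ?_
  intro U hU
  obtain ⟨ε, hε, hεU⟩ := Metric.mem_uniformity_dist.1 hU
  obtain ⟨d, hd, H⟩ := aux_dq_cauchy hδ hΩ h hf hfd hg hKc hball (half_pos hε)
  have := H (d / 2) (by positivity) (by rw [abs_of_pos (by positivity)]; linarith)
  refine ⟨_, (aux_cont_comp (h := d / 2) (aux_cont_dx hδ hΩ h hf)).mono this.1, ?_⟩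
  intro y hy
  apply hεU
  rw [dist_comm, Real.dist_eq]
  exact (this.2 y.1 y.2 hy).trans_lt (by linarith)

end

section
open Topology

noncomputable def auxClamp (t₁ t₂ x₁ x₂ : ℝ) (k : ℝ → ℝ → ℝ) : ℝ → ℝ → ℝ :=
  fun t x => k (max t₁ (min t₂ t)) (max x₁ (min x₂ x))

theorem auxClamp_cont {t₁ t₂ x₁ x₂ : ℝ} {k : ℝ → ℝ → ℝ} (ht : t₁ ≤ t₂) (hx : x₁ ≤ x₂)
    (hk : ContinuousOn (Function.uncurry k) (Icc t₁ t₂ ×ˢ Icc x₁ x₂)) :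
    Continuous (Function.uncurry (auxClamp t₁ t₂ x₁ x₂ k)) := by
  have := hk.comp_continuous (f := fun p : ℝ × ℝ => (max t₁ (min t₂ p.1), max x₁ (min x₂ p.2)))
    (by fun_prop) (fun p => ⟨⟨le_max_left _ _, max_le ht (min_le_left _ _)⟩,
      ⟨le_max_left _ _, max_le hx (min_le_left _ _)⟩⟩)
  exact this

theorem auxClamp_eq {t₁ t₂ x₁ x₂ : ℝ} {k : ℝ → ℝ → ℝ} {t x : ℝ} (ht : t ∈ Icc t₁ t₂)
    (hx : x ∈ Icc x₁ x₂) : auxClamp t₁ t₂ x₁ x₂ k t x = k t x := by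
  unfold auxClamp
  rw [min_eq_right ht.2, max_eq_right ht.1, min_eq_right hx.2, max_eq_right hx.1]

theorem aux_param_cont {t₁ t₂ x₁ x₂ : ℝ} {k : ℝ → ℝ → ℝ} (ht : t₁ ≤ t₂) (hx : x₁ ≤ x₂)
    (hk : ContinuousOn (Function.uncurry k) (Icc t₁ t₂ ×ˢ Icc x₁ x₂)) :
    ContinuousOn (fun t => ∫ x in x₁..x₂, k t x) (Icc t₁ t₂) := by
  have h := intervalIntegral.continuous_parametric_intervalIntegral_of_continuous'
    (μ := volume) (auxClamp_cont ht hx hk) x₁ x₂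
  refine h.continuousOn.congr ?_
  intro t ht'
  refine intervalIntegral.integral_congr fun x hx' => ?_
  rw [uIcc_of_le hx] at hx'
  exact (auxClamp_eq ht' hx').symm

theorem aux_slice_cont {k : ℝ → ℝ → ℝ} {Ω : Set (ℝ × ℝ)} {t x₁ x₂ : ℝ}
    (hk : ContinuousOn (Function.uncurry k) Ω) (h : ∀ x ∈ Icc x₁ x₂, (t, x) ∈ Ω) :
    ContinuousOn (k t) (Icc x₁ x₂) :=
  hk.comp (f := fun x : ℝ => (t, x)) (by fun_prop) h

theorem aux_energy_deriv {t₁ t₂ x₁ x₂ : ℝ} (hx : x₁ ≤ x₂)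
    {D D1 D2 E : ℝ → ℝ → ℝ} {Ω : Set (ℝ × ℝ)} (hΩ : IsOpen Ω)
    (hQ : Icc t₁ t₂ ×ˢ Icc x₁ x₂ ⊆ Ω)
    (c0 : ContinuousOn (Function.uncurry D) Ω)
    (c1 : ContinuousOn (Function.uncurry D1) Ω) (c2 : ContinuousOn (Function.uncurry D2) Ω)
    (cE : ContinuousOn (Function.uncurry E) Ω)
    (h0 : ∀ t x, (t, x) ∈ Ω → HasDerivAt (D t) (D1 t x) x)
    (h1 : ∀ t x, (t, x) ∈ Ω → HasDerivAt (D1 t) (D2 t x) x)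
    (hE : ∀ t x, (t, x) ∈ Ω → HasDerivAt (fun s => D s x) (E t x) t)
    (t : ℝ) (ht : t ∈ Icc t₁ t₂) :
    HasDerivAt (fun t => ∫ x in x₁..x₂, ((x - x₁) * (x₂ - x)) ^ 2 * D1 t x ^ 2)
      (∫ x in x₁..x₂, -2 * (2 * ((x - x₁) * (x₂ - x)) * (x₁ + x₂ - 2 * x) * D1 t x
        + ((x - x₁) * (x₂ - x)) ^ 2 * D2 t x) * E t x) t := by
  have pη : Continuous (fun x : ℝ => (x - x₁) * (x₂ - x)) := by fun_prop
  have pη' : Continuous (fun x : ℝ => x₁ + x₂ - 2 * x) := by fun_prop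
  have hK : IsCompact ({t} ×ˢ Icc x₁ x₂ : Set (ℝ × ℝ)) := isCompact_singleton.prod isCompact_Icc
  obtain ⟨l, hl, hl1, K', hK', hK'Ω, hb⟩ := aux_thick hΩ hK
    (fun p hp => hQ ⟨by rw [hp.1]; exact ht, hp.2⟩)
  have hin : ∀ s, |s - t| ≤ l → ∀ x ∈ Icc x₁ x₂, (s, x) ∈ K' := by
    intro s hs x hx'
    have := hb (t, x) ⟨rfl, hx'⟩ (s - t) 0 hs (by simpa using hl.le)
    simpa using this
  obtain ⟨M1, hM1⟩ := hK'.exists_bound_of_continuousOn (c1.mono hK'Ω)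
  obtain ⟨M2, hM2⟩ := hK'.exists_bound_of_continuousOn (c2.mono hK'Ω)
  obtain ⟨M3, hM3⟩ := hK'.exists_bound_of_continuousOn (cE.mono hK'Ω)
  have hev : ∀ᶠ s in 𝓝[≠] t, |s - t| ≤ l := by
    refine mem_nhdsWithin_of_mem_nhds ?_
    refine mem_of_superset (Metric.ball_mem_nhds t hl) fun y hy => ?_
    exact (Metric.mem_ball.1 hy).le
  have htl : |t - t| ≤ l := by simpa using hl.le
  set Φ : ℝ → ℝ → ℝ := fun s x => -(2 * ((x - x₁) * (x₂ - x)) * (x₁ + x₂ - 2 * x) *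
      (D1 s x + D1 t x) + ((x - x₁) * (x₂ - x)) ^ 2 * (D2 s x + D2 t x)) * 
      (slope (fun s => D s x) t s) with hΦ
  have sl : ∀ s, |s - t| ≤ l → ∀ k : ℝ → ℝ → ℝ, ContinuousOn (Function.uncurry k) Ω →
      ContinuousOn (k s) (Icc x₁ x₂) := fun s hs k hk =>
    aux_slice_cont hk (fun x hx' => hK'Ω (hin s hs x hx'))
  rw [hasDerivAt_iff_tendsto_slope]
  have hcongr : ∀ᶠ s in 𝓝[≠] t, (∫ x in x₁..x₂, Φ s x) =
      slope (fun t => ∫ x in x₁..x₂, ((x - x₁) * (x₂ - x)) ^ 2 * D1 t x ^ 2) t s := by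
    filter_upwards [hev] with s hs
    have d1s := sl s hs D1 c1
    have d1t := sl t htl D1 c1
    have d2s := sl s hs D2 c2
    have d2t := sl t htl D2 c2
    have d0s := sl s hs D c0
    have d0t := sl t htl D c0
    have ibp := intervalIntegral.integral_mul_deriv_eq_deriv_mul (a := x₁) (b := x₂)
      (u := fun x => ((x - x₁) * (x₂ - x)) ^ 2 * (D1 s x + D1 t x))
      (u' := fun x => 2 * ((x - x₁) * (x₂ - x)) * (x₁ + x₂ - 2 * x) *
        (D1 s x + D1 t x) + ((x - x₁) * (x₂ - x)) ^ 2 * (D2 s x + D2 t x))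
      (v := fun x => D s x - D t x) (v' := fun x => D1 s x - D1 t x) ?_ ?_ ?_ ?_
    · simp only [sub_self, zero_mul, mul_zero, zero_pow two_ne_zero, zero_sub] at ibp
      rw [slope_def_field, ← intervalIntegral.integral_sub, div_eq_inv_mul]
      · have e1 : ∫ x in x₁..x₂, (((x - x₁) * (x₂ - x)) ^ 2 * D1 s x ^ 2 -
            ((x - x₁) * (x₂ - x)) ^ 2 * D1 t x ^ 2) =
            ∫ x in x₁..x₂, ((x - x₁) * (x₂ - x)) ^ 2 * (D1 s x + D1 t x) * (D1 s x - D1 t x) := by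
          congr 1; ext x; ring
        rw [e1, ibp, ← intervalIntegral.integral_neg, ← intervalIntegral.integral_const_mul]
        congr 1; ext x
        simp only [hΦ, slope_def_field]
        ring
      · refine ContinuousOn.intervalIntegrable ?_
        rw [uIcc_of_le hx]; exact (pη.pow 2).continuousOn.mul (d1s.pow 2)
      · refine ContinuousOn.intervalIntegrable ?_
        rw [uIcc_of_le hx]; exact (pη.pow 2).continuousOn.mul (d1t.pow 2)
    · intro x hx'
      rw [uIcc_of_le hx] at hx'
      have a1 := h1 s x (hK'Ω (hin s hs x hx'))
      have a2 := h1 t x (hK'Ω (hin t htl x hx'))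
      have a3 := ((((hasDerivAt_id x).sub_const x₁).mul ((hasDerivAt_id x).const_sub x₂)).pow 2).mul
        (a1.add a2)
      refine a3.congr_deriv ?_
      simp only [id, Pi.add_apply, Pi.mul_apply, Pi.pow_apply]
      ring
    · intro x hx'
      rw [uIcc_of_le hx] at hx'
      exact (h0 s x (hK'Ω (hin s hs x hx'))).sub (h0 t x (hK'Ω (hin t htl x hx')))
    · refine ContinuousOn.intervalIntegrable ?_
      rw [uIcc_of_le hx]; exact (((continuousOn_const.mul pη.continuousOn).mul pη'.continuousOn).mul (d1s.add d1t)).add ((pη.pow 2).continuousOn.mul (d2s.add d2t))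
    · refine ContinuousOn.intervalIntegrable ?_
      rw [uIcc_of_le hx]; exact d1s.sub d1t
  refine Tendsto.congr' hcongr ?_
  set L := x₂ - x₁ with hL
  refine intervalIntegral.tendsto_integral_filter_of_dominated_convergence
    (fun _ => (2 * (L * L) * L * (M1 + M1) + (L * L) ^ 2 * (M2 + M2)) * M3) ?_ ?_ ?_ ?_
  · filter_upwards [hev] with s hs
    have d1s := sl s hs D1 c1
    have d1t := sl t htl D1 c1
    have d2s := sl s hs D2 c2
    have d2t := sl t htl D2 c2
    have d0s := sl s hs D c0
    have d0t := sl t htl D c0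
    have : ContinuousOn (Φ s) (Icc x₁ x₂) := by
      simp only [hΦ, slope_def_field]
      exact (ContinuousOn.neg ((((continuousOn_const.mul pη.continuousOn).mul pη'.continuousOn).mul (d1s.add d1t)).add ((pη.pow 2).continuousOn.mul (d2s.add d2t)))).mul ((d0s.sub d0t).div_const _)
    rw [uIoc_of_le hx]
    exact (this.aestronglyMeasurable measurableSet_Icc).mono_set Ioc_subset_Icc_self
  · filter_upwards [hev] with s hs
    refine Eventually.of_forall fun x hx' => ?_
    rw [uIoc_of_le hx] at hx'
    have hxI : x ∈ Icc x₁ x₂ := Ioc_subset_Icc_self hx'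
    have b1 : |D1 s x| ≤ M1 := hM1 _ (hin s hs x hxI)
    have b1' : |D1 t x| ≤ M1 := hM1 _ (hin t htl x hxI)
    have b2 : |D2 s x| ≤ M2 := hM2 _ (hin s hs x hxI)
    have b2' : |D2 t x| ≤ M2 := hM2 _ (hin t htl x hxI)
    have b3 : |slope (fun s => D s x) t s| ≤ M3 := by
      have key : ‖D s x - D t x‖ ≤ M3 * ‖s - t‖ := by
        refine Convex.norm_image_sub_le_of_norm_hasDerivWithin_le (s := uIcc t s)
          (f := fun s => D s x) (f' := fun s => E s x) ?_ ?_ (convex_uIcc _ _)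
          left_mem_uIcc right_mem_uIcc
        · intro y hy
          have := (abs_sub_left_of_mem_uIcc hy).trans hs
          exact (hE y x (hK'Ω (hin y this x hxI))).hasDerivWithinAt
        · intro y hy
          have := (abs_sub_left_of_mem_uIcc hy).trans hs
          exact hM3 _ (hin y this x hxI)
      rw [slope_def_field, abs_div]
      refine div_le_of_le_mul₀ (abs_nonneg _) ?_ key
      exact (norm_nonneg _).trans (hM3 _ (hin t htl x hxI))
    have g1 : |x - x₁| ≤ L := by rw [abs_of_nonneg (by linarith [hxI.1])]; linarith [hxI.2]
    have g2 : |x₂ - x| ≤ L := by rw [abs_of_nonneg (by linarith [hxI.2])]; linarith [hxI.1]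
    have g3 : |x₁ + x₂ - 2 * x| ≤ L := by
      rw [abs_le]; constructor <;> linarith [hxI.1, hxI.2]
    have hL0 : 0 ≤ L := (abs_nonneg _).trans g1
    have hM10 := (abs_nonneg _).trans b1
    have hM20 := (abs_nonneg _).trans b2
    simp only [hΦ, Real.norm_eq_abs, abs_mul, abs_neg]
    refine mul_le_mul ((abs_add_le _ _).trans ?_) b3 (abs_nonneg _) (by positivity)
    simp only [abs_mul, abs_pow, abs_two]
    have s1 := (abs_add_le (D1 s x) (D1 t x)).trans (add_le_add b1 b1')
    have s2 := (abs_add_le (D2 s x) (D2 t x)).trans (add_le_add b2 b2')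
    gcongr
  · simp
  · refine Eventually.of_forall fun x hx' => ?_
    rw [uIoc_of_le hx] at hx'
    have hxI : x ∈ Icc x₁ x₂ := Ioc_subset_Icc_self hx'
    have hmem := hK'Ω (hin t htl x hxI)
    have t3 := hasDerivAt_iff_tendsto_slope.1 (hE t x hmem)
    have tc : ∀ k : ℝ → ℝ → ℝ, ContinuousOn (Function.uncurry k) Ω →
        Tendsto (fun s => k s x) (𝓝[≠] t) (𝓝 (k t x)) := by
      intro k hk
      have : ContinuousAt (fun s : ℝ => Function.uncurry k (s, x)) t :=
        ContinuousAt.comp (f := fun s : ℝ => (s, x)) (hk.continuousAt (hΩ.mem_nhds hmem))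
          (by fun_prop)
      exact this.tendsto.mono_left nhdsWithin_le_nhds
    have r := ((((tc D1 c1).add_const (D1 t x)).const_mul
      (2 * ((x - x₁) * (x₂ - x)) * (x₁ + x₂ - 2 * x))).add
      (((tc D2 c2).add_const (D2 t x)).const_mul (((x - x₁) * (x₂ - x)) ^ 2))).neg.mul t3
    convert r using 2
    ring

theorem aux_energy {δ t₁ t₂ x₁ x₂ m : ℝ} (hδ : 0 < δ) (ht : t₁ ≤ t₂) (hx : x₁ ≤ x₂)
    {D D1 D2 E g : ℝ → ℝ → ℝ} {Ω : Set (ℝ × ℝ)} (hΩ : IsOpen Ω)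
    (hQ : Icc t₁ t₂ ×ˢ Icc x₁ x₂ ⊆ Ω)
    (c0 : ContinuousOn (Function.uncurry D) Ω)
    (c1 : ContinuousOn (Function.uncurry D1) Ω) (c2 : ContinuousOn (Function.uncurry D2) Ω)
    (cE : ContinuousOn (Function.uncurry E) Ω)
    (h0 : ∀ t x, (t, x) ∈ Ω → HasDerivAt (D t) (D1 t x) x)
    (h1 : ∀ t x, (t, x) ∈ Ω → HasDerivAt (D1 t) (D2 t x) x)
    (hE : ∀ t x, (t, x) ∈ Ω → HasDerivAt (fun s => D s x) (E t x) t)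
    (heq : ∀ t x, (t, x) ∈ Ω → E t x = δ * D2 t x + g t x)
    (hm1 : ∀ t ∈ Icc t₁ t₂, ∀ x ∈ Icc x₁ x₂, |D1 t x| ≤ m)
    (hm2 : ∀ t ∈ Icc t₁ t₂, ∀ x ∈ Icc x₁ x₂, |g t x| ≤ m) :
    ∫ t in t₁..t₂, ∫ x in x₁..x₂, ((x - x₁) * (x₂ - x)) ^ 2 * E t x ^ 2 ≤
      δ * ((x₂ - x₁) ^ 5 + (t₂ - t₁) * ((8 * δ * (x₂ - x₁) ^ 2 + 2 * (x₂ - x₁) ^ 4 / δ)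
        * (x₂ - x₁))) * m ^ 2 := by
  have hd := aux_energy_deriv (t₁ := t₁) (t₂ := t₂) hx hΩ hQ c0 c1 c2 cE h0 h1 hE
  set En : ℝ → ℝ := fun t => ∫ x in x₁..x₂, ((x - x₁) * (x₂ - x)) ^ 2 * D1 t x ^ 2 with hEn
  set L := x₂ - x₁ with hL
  have hL0 : 0 ≤ L := by linarith
  have q1 := c1.mono hQ
  have q2 := c2.mono hQ
  have qE := cE.mono hQ
  have pη : Continuous (fun p : ℝ × ℝ => (p.2 - x₁) * (x₂ - p.2)) := by fun_prop
  have pη' : Continuous (fun p : ℝ × ℝ => x₁ + x₂ - 2 * p.2) := by fun_prop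
  have hq1 : ContinuousOn (fun p : ℝ × ℝ => D1 p.1 p.2) (Icc t₁ t₂ ×ˢ Icc x₁ x₂) := q1
  have hq2 : ContinuousOn (fun p : ℝ × ℝ => D2 p.1 p.2) (Icc t₁ t₂ ×ˢ Icc x₁ x₂) := q2
  have hqE : ContinuousOn (fun p : ℝ × ℝ => E p.1 p.2) (Icc t₁ t₂ ×ˢ Icc x₁ x₂) := qE
  have cI : ContinuousOn (fun t => ∫ x in x₁..x₂, ((x - x₁) * (x₂ - x)) ^ 2 * E t x ^ 2)
      (Icc t₁ t₂) := by
    refine aux_param_cont ht hx ?_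
    simp only [Function.uncurry_def]
    exact (pη.pow 2).continuousOn.mul (hqE.pow 2)
  have cD : ContinuousOn (fun t => ∫ x in x₁..x₂, -2 * (2 * ((x - x₁) * (x₂ - x)) *
      (x₁ + x₂ - 2 * x) * D1 t x + ((x - x₁) * (x₂ - x)) ^ 2 * D2 t x) * E t x) (Icc t₁ t₂) := by
    refine aux_param_cont ht hx ?_
    simp only [Function.uncurry_def]
    exact (continuousOn_const.mul ((((continuousOn_const.mul pη.continuousOn).mul pη'.continuousOn).mul (hq1)).add ((pη.pow 2).continuousOn.mul (hq2)))).mul hqE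
  have iI : IntervalIntegrable (fun t => ∫ x in x₁..x₂, ((x - x₁) * (x₂ - x)) ^ 2 * E t x ^ 2)
      volume t₁ t₂ := by
    refine ContinuousOn.intervalIntegrable ?_
    rwa [uIcc_of_le ht]
  have iD : IntervalIntegrable (fun t => ∫ x in x₁..x₂, -2 * (2 * ((x - x₁) * (x₂ - x)) *
      (x₁ + x₂ - 2 * x) * D1 t x + ((x - x₁) * (x₂ - x)) ^ 2 * D2 t x) * E t x) volume t₁ t₂ := by
    refine ContinuousOn.intervalIntegrable ?_
    rwa [uIcc_of_le ht]
  have ftc := intervalIntegral.integral_eq_sub_of_hasDerivAt (a := t₁) (b := t₂) (f := En)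
    (fun t ht' => hd t (by rwa [uIcc_of_le ht] at ht')) iD
  have hη : ∀ x ∈ Icc x₁ x₂, ((x - x₁) * (x₂ - x)) ^ 2 ≤ L ^ 4 := by
    intro x hx'
    have a1 : 0 ≤ x - x₁ := by linarith [hx'.1]
    have a2 : 0 ≤ x₂ - x := by linarith [hx'.2]
    have : (x - x₁) * (x₂ - x) ≤ L * L :=
      mul_le_mul (by linarith) (by linarith) a2 hL0
    calc ((x - x₁) * (x₂ - x)) ^ 2 ≤ (L * L) ^ 2 := by gcongr
      _ = L ^ 4 := by ring
  have hη' : ∀ x ∈ Icc x₁ x₂, (x₁ + x₂ - 2 * x) ^ 2 ≤ L ^ 2 := by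
    intro x hx'
    exact sq_le_sq' (by linarith [hx'.1, hx'.2]) (by linarith [hx'.1, hx'.2])
  have hsq : ∀ y, |y| ≤ m → y ^ 2 ≤ m ^ 2 := by
    intro y hy
    exact sq_le_sq' (by linarith [(abs_le.1 hy).1]) (abs_le.1 hy).2
  set K0 := (8 * δ * L ^ 2 + 2 * L ^ 4 / δ) with hK0
  have hpt : ∀ t ∈ Icc t₁ t₂, (∫ x in x₁..x₂, -2 * (2 * ((x - x₁) * (x₂ - x)) *
      (x₁ + x₂ - 2 * x) * D1 t x + ((x - x₁) * (x₂ - x)) ^ 2 * D2 t x) * E t x) ≤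
      -(1 / δ) * (∫ x in x₁..x₂, ((x - x₁) * (x₂ - x)) ^ 2 * E t x ^ 2) + K0 * m ^ 2 * L := by
    intro t ht'
    have hO : ∀ x ∈ Icc x₁ x₂, (t, x) ∈ Ω := fun x hx' => hQ ⟨ht', hx'⟩
    have s1 := aux_slice_cont c1 hO
    have s2 := aux_slice_cont c2 hO
    have sE := aux_slice_cont cE hO
    have pη : Continuous (fun x : ℝ => (x - x₁) * (x₂ - x)) := by fun_prop
    have pη' : Continuous (fun x : ℝ => x₁ + x₂ - 2 * x) := by fun_prop
    have sA : ContinuousOn (fun x => -(1 / δ) * (((x - x₁) * (x₂ - x)) ^ 2 * E t x ^ 2)) (Icc x₁ x₂) :=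
      continuousOn_const.mul ((pη.pow 2).continuousOn.mul (sE.pow 2))
    have e : -(1 / δ) * (∫ x in x₁..x₂, ((x - x₁) * (x₂ - x)) ^ 2 * E t x ^ 2) + K0 * m ^ 2 * L
      = ∫ x in x₁..x₂, (-(1 / δ) * (((x - x₁) * (x₂ - x)) ^ 2 * E t x ^ 2) + K0 * m ^ 2) := by
      rw [intervalIntegral.integral_add, intervalIntegral.integral_const_mul,
        intervalIntegral.integral_const, smul_eq_mul]
      · ring
      · refine ContinuousOn.intervalIntegrable ?_
        rw [uIcc_of_le hx]; exact sA
      · simp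
    rw [e]
    refine intervalIntegral.integral_mono_on hx ?_ ?_ ?_
    · refine ContinuousOn.intervalIntegrable ?_
      rw [uIcc_of_le hx]; exact (continuousOn_const.mul ((((continuousOn_const.mul pη.continuousOn).mul
        pη'.continuousOn).mul s1).add ((pη.pow 2).continuousOn.mul s2))).mul sE
    · refine ContinuousOn.intervalIntegrable ?_
      rw [uIcc_of_le hx]; exact sA.add continuousOn_const
    · intro x hx'
      have b1 := hsq _ (hm1 t ht' x hx')
      have b2 := hsq _ (hm2 t ht' x hx')
      have b3 := hη x hx'
      have b4 := hη' x hx'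
      set η := (x - x₁) * (x₂ - x)
      set η' := x₁ + x₂ - 2 * x
      have hq : D2 t x = (E t x - g t x) / δ := by
        rw [heq t x (hO x hx')]; field_simp; ring
      rw [hq]
      have y1 : η' ^ 2 * D1 t x ^ 2 ≤ L ^ 2 * m ^ 2 := by gcongr
      have y2 : η ^ 2 * g t x ^ 2 ≤ L ^ 4 * m ^ 2 := by gcongr
      have : -(1 / δ) * (η ^ 2 * E t x ^ 2) + (8 * δ * (η' ^ 2 * D1 t x ^ 2)
          + 2 * (η ^ 2 * g t x ^ 2) / δ) - 
          -2 * (2 * η * η' * D1 t x + η ^ 2 * ((E t x - g t x) / δ)) * E t x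
          = ((η * E t x + 4 * δ * (η' * D1 t x)) ^ 2 / 2
            + (η * E t x - 2 * (η * g t x)) ^ 2 / 2) / δ := by
        field_simp; ring
      have p : 0 ≤ ((η * E t x + 4 * δ * (η' * D1 t x)) ^ 2 / 2
            + (η * E t x - 2 * (η * g t x)) ^ 2 / 2) / δ := by positivity
      have z1 : 8 * δ * (η' ^ 2 * D1 t x ^ 2) ≤ 8 * δ * (L ^ 2 * m ^ 2) := by gcongr
      have z2 : 2 * (η ^ 2 * g t x ^ 2) / δ ≤ 2 * (L ^ 4 * m ^ 2) / δ := by gcongr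
      have z3 : K0 * m ^ 2 = 8 * δ * (L ^ 2 * m ^ 2) + 2 * (L ^ 4 * m ^ 2) / δ := by
        rw [hK0]; ring
      linarith
  have hint := intervalIntegral.integral_mono_on ht iD ((iI.const_mul (-(1 / δ))).add
    (intervalIntegrable_const (c := K0 * m ^ 2 * L))) hpt
  rw [ftc, intervalIntegral.integral_add (iI.const_mul _) intervalIntegrable_const,
    intervalIntegral.integral_const_mul, intervalIntegral.integral_const, smul_eq_mul] at hint
  have En2 : 0 ≤ En t₂ := by
    refine intervalIntegral.integral_nonneg hx fun x _ => by positivity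
  have En1 : En t₁ ≤ L ^ 5 * m ^ 2 := by
    have e : L ^ 5 * m ^ 2 = ∫ x in x₁..x₂, L ^ 4 * m ^ 2 := by
      rw [intervalIntegral.integral_const, smul_eq_mul]; ring
    have hO : ∀ x ∈ Icc x₁ x₂, (t₁, x) ∈ Ω := fun x hx' => hQ ⟨⟨le_rfl, ht⟩, hx'⟩
    have s1 := aux_slice_cont c1 hO
    rw [e]
    refine intervalIntegral.integral_mono_on hx ?_ ?_ ?_
    · refine ContinuousOn.intervalIntegrable ?_
      rw [uIcc_of_le hx]; fun_prop
    · simp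
    · intro x hx'
      have b1 := hsq _ (hm1 t₁ ⟨le_rfl, ht⟩ x hx')
      have b3 := hη x hx'
      gcongr
  set I := ∫ t in t₁..t₂, ∫ x in x₁..x₂, ((x - x₁) * (x₂ - x)) ^ 2 * E t x ^ 2
  have h3 : 1 / δ * I ≤ L ^ 5 * m ^ 2 + (t₂ - t₁) * (K0 * m ^ 2 * L) := by linarith
  have h4 : I = δ * (1 / δ * I) := by field_simp
  rw [h4]
  calc δ * (1 / δ * I) ≤ δ * (L ^ 5 * m ^ 2 + (t₂ - t₁) * (K0 * m ^ 2 * L)) := by gcongr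
    _ = _ := by ring

end

section
open Topology

theorem aux_M {y₁ y₂ s₁ s₂ : ℝ} (hy : y₁ ≤ y₂) (hs : s₁ ≤ s₂) {φ ψ : ℕ → ℝ → ℝ → ℝ}
    {Φ : ℝ → ℝ → ℝ} {A : ℝ × ℝ → ℝ} (hA : Measurable A)
    (hφ : ∀ k, ∀ y ∈ Icc y₁ y₂, ∀ s ∈ Icc s₁ s₂, HasDerivAt (φ k y) (ψ k y s) s)
    (hψ : ∀ k, ContinuousOn (Function.uncurry (ψ k)) (Icc y₁ y₂ ×ˢ Icc s₁ s₂))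
    (hlim : ∀ y ∈ Icc y₁ y₂, ∀ s ∈ Icc s₁ s₂, Tendsto (fun k => φ k y s) atTop (𝓝 (Φ y s)))
    (hΦ : ContinuousOn (Function.uncurry Φ) (Icc y₁ y₂ ×ˢ Icc s₁ s₂))
    (hAi : IntegrableOn A (Icc y₁ y₂ ×ˢ Icc s₁ s₂))
    (hsum : ∑' k, ∫⁻ p in Icc y₁ y₂ ×ˢ Icc s₁ s₂, ‖Function.uncurry (ψ k) p - A p‖ₑ ≠ ⊤) :
    ∀ᵐ p : ℝ × ℝ, p ∈ Ioo y₁ y₂ ×ˢ Ioo s₁ s₂ → HasDerivAt (Φ p.1) (A p) p.2 := by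
  have hvol : (volume : Measure (ℝ × ℝ)).restrict (Icc y₁ y₂ ×ˢ Icc s₁ s₂)
      = ((volume : Measure ℝ).restrict (Icc y₁ y₂)).prod (volume.restrict (Icc s₁ s₂)) := by
    rw [Measure.volume_eq_prod, Measure.prod_restrict]
  set μ := (volume : Measure ℝ).restrict (Icc y₁ y₂)
  set ν := (volume : Measure ℝ).restrict (Icc s₁ s₂) with hν
  rw [IntegrableOn, hvol] at hAi
  rw [hvol] at hsum
  have hmeas : ∀ k, AEMeasurable (fun p => ‖Function.uncurry (ψ k) p - A p‖ₑ) (μ.prod ν) := by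
    intro k
    rw [← hvol]
    have := (hψ k).aemeasurable (μ := volume) (measurableSet_Icc.prod measurableSet_Icc)
    exact (this.sub hA.aemeasurable).enorm
  have hmeas2 : ∀ k, AEMeasurable (fun y => ∫⁻ s, ‖ψ k y s - A (y, s)‖ₑ ∂ν) μ :=
    fun k => (hmeas k).lintegral_prod_right'
  have e1 : ∀ k, ∫⁻ p, ‖Function.uncurry (ψ k) p - A p‖ₑ ∂(μ.prod ν)
      = ∫⁻ y, ∫⁻ s, ‖ψ k y s - A (y, s)‖ₑ ∂ν ∂μ := fun k => lintegral_prod _ (hmeas k)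
  simp_rw [e1] at hsum
  rw [← lintegral_tsum hmeas2] at hsum
  have ae1 := ae_lt_top' (AEMeasurable.tsum hmeas2) hsum
  have ae2 := hAi.prod_right_ae
  have key : ∀ᵐ y ∂μ, ∀ᵐ s : ℝ, s ∈ Ioo s₁ s₂ → HasDerivAt (Φ y) (A (y, s)) s := by
    have hmem : ∀ᵐ y ∂μ, y ∈ Icc y₁ y₂ := ae_restrict_mem measurableSet_Icc
    filter_upwards [ae1, ae2, hmem] with y h1 h2 h3
    have h1' := ENNReal.tendsto_atTop_zero_of_tsum_ne_top h1.ne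
    have hc : ∀ k, ContinuousOn (ψ k y) (Icc s₁ s₂) := fun k =>
      aux_slice_cont (hψ k) (fun x hx => ⟨h3, hx⟩)
    have hint : ∀ s ∈ Icc s₁ s₂, Φ y s - Φ y s₁ = ∫ σ in s₁..s, A (y, σ) := by
      intro s hs'
      have L1 := tendsto_setIntegral_of_L1 (μ := ν) (fun s => A (y, s)) h2.1
        (F := fun k s => ψ k y s) (l := atTop)
        (Eventually.of_forall fun k => (hc k).integrableOn_Icc) h1' (Ioc s₁ s)
      have hr : ν.restrict (Ioc s₁ s) = volume.restrict (Ioc s₁ s) := by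
        rw [hν, Measure.restrict_restrict measurableSet_Ioc]
        congr 1
        exact inter_eq_left.2 (fun x hx => ⟨hx.1.le, hx.2.trans hs'.2⟩)
      rw [hr] at L1
      simp_rw [← intervalIntegral.integral_of_le hs'.1] at L1
      have e2 : ∀ k, ∫ σ in s₁..s, ψ k y σ = φ k y s - φ k y s₁ := by
        intro k
        refine intervalIntegral.integral_eq_sub_of_hasDerivAt ?_ ?_
        · intro σ hσ
          rw [uIcc_of_le hs'.1] at hσ
          exact hφ k y h3 σ ⟨hσ.1, hσ.2.trans hs'.2⟩
        · refine ContinuousOn.intervalIntegrable ?_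
          rw [uIcc_of_le hs'.1]
          exact (hc k).mono (Icc_subset_Icc_right hs'.2)
      simp_rw [e2] at L1
      exact tendsto_nhds_unique ((hlim y h3 s hs').sub (hlim y h3 s₁ ⟨le_rfl, hs⟩)) L1
    have hii : IntervalIntegrable (fun s => A (y, s)) volume s₁ s₂ := by
      rw [intervalIntegrable_iff_integrableOn_Icc_of_le hs]
      exact h2
    filter_upwards [hii.ae_hasDerivAt_integral] with s hs1 hs2
    rw [uIcc_of_le hs] at hs1
    have h4 := hs1 (Ioo_subset_Icc_self hs2) s₁ ⟨le_rfl, hs⟩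
    refine (h4.const_add (Φ y s₁)).congr_of_eventuallyEq ?_
    filter_upwards [Ioo_mem_nhds hs2.1 hs2.2] with σ hσ
    rw [← hint σ (Ioo_subset_Icc_self hσ)]
    ring
  set Φc := auxClamp y₁ y₂ s₁ s₂ Φ with hΦc
  have hΦcc : Continuous (Function.uncurry Φc) := auxClamp_cont hy hs hΦ
  have hloc : ∀ y ∈ Icc y₁ y₂, ∀ s ∈ Ioo s₁ s₂, Φc y =ᶠ[𝓝 s] Φ y := by
    intro y hy' s hs'
    filter_upwards [Ioo_mem_nhds hs'.1 hs'.2] with σ hσ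
    exact auxClamp_eq hy' (Ioo_subset_Icc_self hσ)
  set S : Set (ℝ × ℝ) := {p | p ∈ Ioo y₁ y₂ ×ˢ Ioo s₁ s₂ →
    (DifferentiableAt ℝ (Φc p.1) p.2 ∧ deriv (Φc p.1) p.2 = A p)} with hS
  have hSm : MeasurableSet S := by
    have m1 := measurableSet_of_differentiableAt_with_param ℝ hΦcc
    have m2 : MeasurableSet {p : ℝ × ℝ | deriv (Φc p.1) p.2 = A p} :=
      measurableSet_eq_fun (measurable_deriv_with_param hΦcc) hA
    have m3 : MeasurableSet (Ioo y₁ y₂ ×ˢ Ioo s₁ s₂) := measurableSet_Ioo.prod measurableSet_Ioo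
    have : S = (Ioo y₁ y₂ ×ˢ Ioo s₁ s₂)ᶜ ∪ ({p : ℝ × ℝ | DifferentiableAt ℝ (Φc p.1) p.2} ∩
      {p : ℝ × ℝ | deriv (Φc p.1) p.2 = A p}) := by
      ext p
      simp only [hS, mem_ofPred_eq, mem_union, mem_compl_iff, mem_inter_iff]
      tauto
    rw [this]
    exact m3.compl.union (m1.inter m2)
  have hSae : ∀ᵐ p : ℝ × ℝ, p ∈ S := by
    rw [Measure.volume_eq_prod, Measure.ae_prod_mem_iff_ae_ae_mem hSm]
    rw [ae_restrict_iff' measurableSet_Icc] at key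
    filter_upwards [key] with y h1
    by_cases hyI : y ∈ Ioo y₁ y₂
    · filter_upwards [h1 (Ioo_subset_Icc_self hyI)] with s h2 h3
      have := (h2 h3.2).congr_of_eventuallyEq (hloc y (Ioo_subset_Icc_self hyI) s h3.2)
      exact ⟨this.differentiableAt, this.deriv⟩
    · exact Eventually.of_forall fun s h3 => absurd h3.1 hyI
  filter_upwards [hSae] with p hp hpI
  have h1 := hp hpI
  have h2 := h1.1.hasDerivAt
  rw [h1.2] at h2
  exact h2.congr_of_eventuallyEq (hloc _ (Ioo_subset_Icc_self hpI.1) _ hpI.2).symm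

end

section
open Topology

theorem aux_L1_lim {μ : Measure (ℝ × ℝ)} {ψ : ℕ → ℝ × ℝ → ℝ} (hψ : ∀ k, Integrable (ψ k) μ)
    (hc : ∀ N n m : ℕ, N ≤ n → N ≤ m →
      ∫⁻ p, ‖ψ n p - ψ m p‖ₑ ∂μ ≤ ENNReal.ofReal ((1/2) ^ N)) :
    ∃ A : ℝ × ℝ → ℝ, Measurable A ∧ Integrable A μ ∧ ∑' k, ∫⁻ p, ‖ψ k p - A p‖ₑ ∂μ ≠ ⊤ := by
  have hs : Summable (fun N : ℕ => 2 * ((1:ℝ)/2) ^ N) := summable_geometric_two.mul_left 2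
  have hB : ∑' N : ℕ, ENNReal.ofReal (2 * (1/2) ^ N) ≠ ⊤ := hs.tsum_ofReal_ne_top
  have hlt : ∀ N : ℕ, ENNReal.ofReal ((1/2) ^ N) < ENNReal.ofReal (2 * (1/2) ^ N) := by
    intro N
    have : (0:ℝ) < (1/2) ^ N := by positivity
    exact (ENNReal.ofReal_lt_ofReal_iff (by positivity)).2 (by linarith)
  have hc' : ∀ N n m : ℕ, N ≤ n → N ≤ m →
      eLpNorm (ψ n - ψ m) 1 μ < ENNReal.ofReal (2 * (1/2) ^ N) := by
    intro N n m hn hm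
    rw [eLpNorm_one_eq_lintegral_enorm]
    exact (hc N n m hn hm).trans_lt (hlt N)
  obtain ⟨A, hA, hlim⟩ := Lp.cauchy_complete_eLpNorm (p := 1) le_rfl
    (fun n => memLp_one_iff_integrable.2 (hψ n)) hB hc'
  have hAi := memLp_one_iff_integrable.1 hA
  have hAe := hAi.1.ae_eq_mk
  refine ⟨hAi.1.mk A, hAi.1.stronglyMeasurable_mk.measurable, hAi.congr hAe, ?_⟩
  refine ne_top_of_le_ne_top hB (ENNReal.tsum_le_tsum fun N => ?_)
  have e : ∫⁻ p, ‖ψ N p - hAi.1.mk A p‖ₑ ∂μ = eLpNorm (ψ N - A) 1 μ := by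
    rw [eLpNorm_one_eq_lintegral_enorm]
    refine lintegral_congr_ae ?_
    filter_upwards [hAe] with p hp
    rw [← hp]; rfl
  rw [e]
  have t1 : Tendsto (fun m => ENNReal.ofReal (2 * (1/2) ^ N) + eLpNorm (ψ m - A) 1 μ) atTop
      (𝓝 (ENNReal.ofReal (2 * (1/2) ^ N) + 0)) := tendsto_const_nhds.add hlim
  rw [add_zero] at t1
  refine ge_of_tendsto t1 ?_
  filter_upwards [eventually_ge_atTop N] with m hm
  have e2 : ψ N - A = (ψ N - ψ m) + (ψ m - A) := by abel
  rw [e2]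
  refine (eLpNorm_add_le ((hψ N).1.sub (hψ m).1) ((hψ m).1.sub hA.1) le_rfl).trans ?_
  gcongr
  exact (hc' N N m le_rfl hm).le

/-- time-direction version -/
theorem aux_M_swap {y₁ y₂ s₁ s₂ : ℝ} (hy : y₁ ≤ y₂) (hs : s₁ ≤ s₂) {φ ψ : ℕ → ℝ → ℝ → ℝ}
    {Φ : ℝ → ℝ → ℝ} {A : ℝ × ℝ → ℝ} (hA : Measurable A)
    (hφ : ∀ k, ∀ s ∈ Icc s₁ s₂, ∀ y ∈ Icc y₁ y₂, HasDerivAt (fun s => φ k s y) (ψ k s y) s)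
    (hψ : ∀ k, ContinuousOn (Function.uncurry (ψ k)) (Icc s₁ s₂ ×ˢ Icc y₁ y₂))
    (hlim : ∀ s ∈ Icc s₁ s₂, ∀ y ∈ Icc y₁ y₂, Tendsto (fun k => φ k s y) atTop (𝓝 (Φ s y)))
    (hΦ : ContinuousOn (Function.uncurry Φ) (Icc s₁ s₂ ×ˢ Icc y₁ y₂))
    (hAi : IntegrableOn A (Icc s₁ s₂ ×ˢ Icc y₁ y₂))
    (hsum : ∑' k, ∫⁻ p in Icc s₁ s₂ ×ˢ Icc y₁ y₂, ‖Function.uncurry (ψ k) p - A p‖ₑ ≠ ⊤) :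
    ∀ᵐ p : ℝ × ℝ, p ∈ Ioo s₁ s₂ ×ˢ Ioo y₁ y₂ → HasDerivAt (fun s => Φ s p.2) (A p) p.1 := by
  have hsw : ∀ {k : ℝ → ℝ → ℝ}, ContinuousOn (Function.uncurry k) (Icc s₁ s₂ ×ˢ Icc y₁ y₂) →
      ContinuousOn (Function.uncurry (fun y s => k s y)) (Icc y₁ y₂ ×ˢ Icc s₁ s₂) := by
    intro k hk
    exact hk.comp (f := Prod.swap) continuous_swap.continuousOn (fun p hp => ⟨hp.2, hp.1⟩)
  have hv1 : ∀ a b c d : ℝ, (volume : Measure (ℝ × ℝ)).restrict (Icc a b ×ˢ Icc c d)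
      = ((volume : Measure ℝ).restrict (Icc a b)).prod (volume.restrict (Icc c d)) := by
    intro a b c d
    rw [Measure.volume_eq_prod, Measure.prod_restrict]
  have := aux_M hy hs (φ := fun k y s => φ k s y) (ψ := fun k y s => ψ k s y)
    (Φ := fun y s => Φ s y) (A := A ∘ Prod.swap) (hA.comp measurable_swap)
    (fun k y hy s hs => hφ k s hs y hy) (fun k => hsw (hψ k)) (fun y hy s hs => hlim s hs y hy)
    (hsw hΦ) ?_ ?_
  · have h2 := (Measure.measurePreserving_swap (μ := (volume : Measure ℝ))
      (ν := (volume : Measure ℝ))).quasiMeasurePreserving.ae this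
    filter_upwards [h2] with p hp hpI
    exact hp ⟨hpI.2, hpI.1⟩
  · rw [IntegrableOn, hv1] at hAi ⊢
    exact hAi.swap
  · rw [hv1] at hsum ⊢
    have e : ∀ k, ∫⁻ p, ‖Function.uncurry (fun y s => ψ k s y) p - (A ∘ Prod.swap) p‖ₑ
        ∂((volume.restrict (Icc y₁ y₂)).prod (volume.restrict (Icc s₁ s₂))) =
        ∫⁻ p, ‖Function.uncurry (ψ k) p - A p‖ₑ
        ∂((volume.restrict (Icc s₁ s₂)).prod (volume.restrict (Icc y₁ y₂))) := by
      intro k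
      rw [← lintegral_prod_swap]
      rfl
    simp_rw [e]
    exact hsum

end

section
open Topology

theorem aux_L1_est {t₁ t₂ x₁ x₂ l ε I : ℝ} (ht : t₁ ≤ t₂) (hx : x₁ ≤ x₂) (hl : 0 < l) (hε : 0 < ε)
    {e : ℝ → ℝ → ℝ}
    (hc : ContinuousOn (Function.uncurry e) (Icc t₁ t₂ ×ˢ Icc (x₁ - l) (x₂ + l)))
    (hI : ∫ t in t₁..t₂, ∫ x in (x₁ - l)..(x₂ + l),
      ((x - (x₁ - l)) * ((x₂ + l) - x)) ^ 2 * e t x ^ 2 ≤ I * ε ^ 2) :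
    ∫⁻ p in Icc t₁ t₂ ×ˢ Icc x₁ x₂, ‖Function.uncurry e p‖ₑ ≤
      ENNReal.ofReal (((t₂ - t₁) * (x₂ - x₁ + 2 * l) + I / l ^ 4) * ε) := by
  set Q := Icc t₁ t₂ ×ˢ Icc x₁ x₂
  set Q' := Icc t₁ t₂ ×ˢ Icc (x₁ - l) (x₂ + l)
  have hQQ : Q ⊆ Q' := prod_mono_right (Icc_subset_Icc (by linarith) (by linarith))
  have hQ' : IsCompact Q' := isCompact_Icc.prod isCompact_Icc
  have hQ : IsCompact Q := isCompact_Icc.prod isCompact_Icc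
  have hce : ContinuousOn (fun p : ℝ × ℝ => e p.1 p.2) Q' := hc
  have i1 : IntegrableOn (Function.uncurry e) Q := (hc.mono hQQ).integrableOn_compact hQ
  have hcf : ContinuousOn (fun p : ℝ × ℝ => ((p.2 - (x₁ - l)) * ((x₂ + l) - p.2)) ^ 2 * e p.1 p.2 ^ 2)
      Q' :=
    (Continuous.continuousOn (f := fun p : ℝ × ℝ => ((p.2 - (x₁ - l)) * ((x₂ + l) - p.2)) ^ 2)
      (((continuous_snd.sub continuous_const).mul (continuous_const.sub continuous_snd)).pow 2)).mul (hce.pow 2)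
  have i2' : IntegrableOn (fun p : ℝ × ℝ =>
      ((p.2 - (x₁ - l)) * ((x₂ + l) - p.2)) ^ 2 * e p.1 p.2 ^ 2) Q' := hcf.integrableOn_compact hQ'
  have ic : IntegrableOn (fun p : ℝ × ℝ => ε) Q' :=
    continuousOn_const.integrableOn_compact hQ'
  have i2 : IntegrableOn (fun p : ℝ × ℝ => ε + 1 / (l ^ 4 * ε) *
      (((p.2 - (x₁ - l)) * ((x₂ + l) - p.2)) ^ 2 * e p.1 p.2 ^ 2)) Q' :=
    ic.add (i2'.const_mul _)
  rw [← ofReal_integral_norm_eq_lintegral_enorm i1]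
  refine ENNReal.ofReal_le_ofReal ?_
  calc ∫ p in Q, ‖Function.uncurry e p‖ ≤ ∫ p in Q, (ε + 1 / (l ^ 4 * ε) *
      (((p.2 - (x₁ - l)) * ((x₂ + l) - p.2)) ^ 2 * e p.1 p.2 ^ 2)) := by
        refine setIntegral_mono_on i1.norm (i2.mono_set hQQ) hQ.measurableSet ?_
        intro p hp
        simp only [Function.uncurry, Real.norm_eq_abs]
        have a1 : l ≤ p.2 - (x₁ - l) := by linarith [hp.2.1]
        have a2 : l ≤ (x₂ + l) - p.2 := by linarith [hp.2.2]
        have a3 : l * l ≤ (p.2 - (x₁ - l)) * ((x₂ + l) - p.2) :=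
          mul_le_mul a1 a2 hl.le (by linarith)
        have a4 : l ^ 4 ≤ ((p.2 - (x₁ - l)) * ((x₂ + l) - p.2)) ^ 2 := by
          calc l ^ 4 = (l * l) ^ 2 := by ring
            _ ≤ _ := by gcongr
        have a5 : l ^ 4 * e p.1 p.2 ^ 2 ≤
          ((p.2 - (x₁ - l)) * ((x₂ + l) - p.2)) ^ 2 * e p.1 p.2 ^ 2 := by gcongr
        have a6 : e p.1 p.2 ^ 2 / ε ≤ 1 / (l ^ 4 * ε) *
          (((p.2 - (x₁ - l)) * ((x₂ + l) - p.2)) ^ 2 * e p.1 p.2 ^ 2) := by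
          rw [one_div, inv_mul_eq_div, div_le_div_iff₀ hε (by positivity)]
          nlinarith
        have a7 : |e p.1 p.2| ≤ ε + e p.1 p.2 ^ 2 / ε := by
          rw [← sq_abs]
          set a := |e p.1 p.2|
          have : ε + a ^ 2 / ε - a = ((a - ε / 2) ^ 2 + 3 / 4 * ε ^ 2) / ε := by
            field_simp; ring
          have : 0 ≤ ((a - ε / 2) ^ 2 + 3 / 4 * ε ^ 2) / ε := by positivity
          linarith
        linarith
    _ ≤ ∫ p in Q', (ε + 1 / (l ^ 4 * ε) *
      (((p.2 - (x₁ - l)) * ((x₂ + l) - p.2)) ^ 2 * e p.1 p.2 ^ 2)) := by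
        refine setIntegral_mono_set i2 (Eventually.of_forall fun p => ?_) hQQ.eventuallyLE
        simp only [Pi.zero_apply]
        positivity
    _ = (t₂ - t₁) * (x₂ - x₁ + 2 * l) * ε + 1 / (l ^ 4 * ε) * ∫ t in t₁..t₂,
        ∫ x in (x₁ - l)..(x₂ + l), ((x - (x₁ - l)) * ((x₂ + l) - x)) ^ 2 * e t x ^ 2 := by
        rw [integral_add ic (i2'.const_mul _), integral_const_mul]
        congr 1
        · rw [setIntegral_const, smul_eq_mul, Measure.real, Measure.volume_eq_prod,
            Measure.prod_prod, Real.volume_Icc, Real.volume_Icc, ENNReal.toReal_mul,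
            ENNReal.toReal_ofReal (by linarith), ENNReal.toReal_ofReal (by linarith)]
          ring
        · congr 1
          rw [Measure.volume_eq_prod, setIntegral_prod _ (by rw [← Measure.volume_eq_prod]; exact i2'),
            intervalIntegral.integral_of_le ht, integral_Icc_eq_integral_Ioc]
          congr 1
          ext t
          rw [intervalIntegral.integral_of_le (by linarith), integral_Icc_eq_integral_Ioc]
    _ ≤ (t₂ - t₁) * (x₂ - x₁ + 2 * l) * ε + 1 / (l ^ 4 * ε) * (I * ε ^ 2) := by gcongr
    _ = _ := by field_simp

theorem aux_seq (d : ℕ → ℝ) (hd : ∀ k, 0 < d k) : ∃ h : ℕ → ℝ, (∀ k, 0 < h k) ∧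
    (∀ N k, N ≤ k → h k < d N) ∧ Tendsto h atTop (𝓝 0) := by
  have hne : ∀ k : ℕ, (Finset.range (k + 1)).Nonempty := fun k => ⟨0, by simp⟩
  have hp : ∀ k : ℕ, 0 < (Finset.range (k + 1)).inf' (hne k) d := by
    intro k
    rw [Finset.lt_inf'_iff]
    exact fun i _ => hd i
  refine ⟨fun k => min ((Finset.range (k + 1)).inf' (hne k) d) (1 / (k + 1)) / 2, ?_, ?_, ?_⟩
  · intro k
    have := hp k
    positivity
  · intro N k hN
    have h1 : (Finset.range (k + 1)).inf' (hne k) d ≤ d N :=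
      Finset.inf'_le _ (by simp; omega)
    have h2 := min_le_left ((Finset.range (k + 1)).inf' (hne k) d) (1 / ((k:ℝ) + 1))
    have := hd N
    simp only
    linarith
  · refine squeeze_zero (fun k => ?_) (fun k => ?_) tendsto_one_div_add_atTop_nhds_zero_nat
    · have := hp k
      positivity
    · have h2 := min_le_right ((Finset.range (k + 1)).inf' (hne k) d) (1 / ((k:ℝ) + 1))
      have : (0:ℝ) < 1 / ((k:ℝ) + 1) := by positivity
      linarith

theorem aux_reg {δ : ℝ} (hδ : 0 < δ) {z f g : ℝ → ℝ → ℝ} {Ω : Set (ℝ × ℝ)} (hΩ : IsOpen Ω)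
    (h : AuxSol δ z f Ω) (hf : ContinuousOn (Function.uncurry f) Ω)
    (hfd : ∀ t x, (t, x) ∈ Ω → HasDerivAt (f t) (g t x) x)
    (hg : ContinuousOn (Function.uncurry g) Ω) {t₁ t₂ x₁ x₂ : ℝ} (ht : t₁ ≤ t₂) (hx : x₁ ≤ x₂)
    (hQ : Icc t₁ t₂ ×ˢ Icc x₁ x₂ ⊆ Ω) :
    ∀ᵐ p : ℝ × ℝ, p ∈ Ioo t₁ t₂ ×ˢ Ioo x₁ x₂ → ∃ Z,
      HasDerivAt (fun s => deriv (z s) p.2) Z p.1 ∧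
      HasDerivAt (fun y => deriv (fun s => z s y) p.1) Z p.2 := by
  have hQc : IsCompact (Icc t₁ t₂ ×ˢ Icc x₁ x₂) := isCompact_Icc.prod isCompact_Icc
  obtain ⟨l, hl, -, K', hK', hK'Ω, hb⟩ := aux_thick hΩ hQc hQ
  set Q' := Icc t₁ t₂ ×ˢ Icc (x₁ - l) (x₂ + l) with hQ'def
  have hQ' : IsCompact Q' := isCompact_Icc.prod isCompact_Icc
  have hQ'Ω : Q' ⊆ Ω := by
    intro p hp
    set x := max x₁ (min x₂ p.2) with hxd
    have hxm : x ∈ Icc x₁ x₂ := ⟨le_max_left _ _, max_le hx (min_le_left _ _)⟩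
    have hd : |p.2 - x| ≤ l := by
      rw [abs_le]
      have := hp.2.1
      have := hp.2.2
      rcases le_total p.2 x₁ with h1 | h1
      · have : x = x₁ := by rw [hxd, min_eq_right (h1.trans hx), max_eq_left h1]
        rw [this]; constructor <;> linarith
      · rcases le_total p.2 x₂ with h2 | h2
        · have : x = p.2 := by rw [hxd, min_eq_right h2, max_eq_right h1]
          rw [this]; constructor <;> linarith
        · have : x = x₂ := by rw [hxd, min_eq_left h2, max_eq_right hx]
          rw [this]; constructor <;> linarith
    have := hb (p.1, x) ⟨hp.1, hxm⟩ 0 (p.2 - x) (by simpa using hl.le) hd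
    simp only [add_zero, add_sub_cancel] at this
    exact hK'Ω this
  have hQQ : Icc t₁ t₂ ×ˢ Icc x₁ x₂ ⊆ Q' :=
    prod_mono_right (Icc_subset_Icc (by linarith) (by linarith))
  set zx : ℝ → ℝ → ℝ := fun t x => deriv (z t) x with hzx
  set zxx : ℝ → ℝ → ℝ := fun t x => deriv (deriv (z t)) x with hzxx
  set zt : ℝ → ℝ → ℝ := fun t x => δ * zxx t x + f t x with hzt
  have cx : ContinuousOn (Function.uncurry zx) Ω := aux_cont_dx hδ hΩ h hf
  have cxx : ContinuousOn (Function.uncurry zxx) Ω := aux_cont_dxx hδ hΩ h hf hfd hg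
  have ct : ContinuousOn (Function.uncurry zt) Ω := (continuousOn_const.mul cxx).add hf
  have dzx : ∀ t x, (t, x) ∈ Ω → HasDerivAt (z t) (zx t x) x := fun t x hx => (h.dx t x hx).hasDerivAt
  have dzxx : ∀ t x, (t, x) ∈ Ω → HasDerivAt (zx t) (zxx t x) x :=
    fun t x hx => (h.dxx t x hx).hasDerivAt
  have ddq : ∀ (k k' : ℝ → ℝ → ℝ), (∀ t x, (t, x) ∈ Ω → HasDerivAt (k t) (k' t x) x) →
      ∀ a t x, (t, x) ∈ auxSh a Ω → HasDerivAt (auxDq a k t) (auxDq a k' t x) x := by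
    intro k k' hk a t x hm
    have hm' := auxSh_mem hm
    exact (((hk _ _ hm'.1).comp_add_const x a).sub (hk _ _ hm'.2)).const_mul _
  have ddt : ∀ a t x, (t, x) ∈ auxSh a Ω →
      HasDerivAt (fun s => auxDq a z s x) (auxDq a zt t x) t := by
    intro a t x hm
    have hm' := auxSh_mem hm
    exact ((h.dt _ _ hm'.1).sub (h.dt _ _ hm'.2)).const_mul _
  have main : ∀ ε > 0, ∃ d > 0, ∀ a b, 0 < a → a < d → 0 < b → b < d →
      Q' ⊆ auxSh a Ω ∧
      ∫⁻ p in Icc t₁ t₂ ×ˢ Icc x₁ x₂, ‖auxDq a zt p.1 p.2 - auxDq b zt p.1 p.2‖ₑ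
        ≤ ENNReal.ofReal ε := by
    set K0 := δ * (((x₂ + l) - (x₁ - l)) ^ 5 + (t₂ - t₁) * ((8 * δ * ((x₂ + l) - (x₁ - l)) ^ 2 +
      2 * ((x₂ + l) - (x₁ - l)) ^ 4 / δ) * ((x₂ + l) - (x₁ - l)))) with hK0
    have hK0p : 0 < K0 := by
      have : 0 < (x₂ + l) - (x₁ - l) := by linarith
      have : 0 ≤ t₂ - t₁ := by linarith
      positivity
    set B := ((t₂ - t₁) * (x₂ - x₁ + 2 * l) + (K0 * 4) / l ^ 4) with hB
    have hBp : 0 < B := by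
      have : 0 ≤ t₂ - t₁ := by linarith
      have : 0 ≤ x₂ - x₁ := by linarith
      positivity
    intro ε hε
    have hε' : 0 < ε / B := by positivity
    obtain ⟨d1, hd1, H1⟩ := aux_dq_cauchy hδ hΩ h hf hfd hg hQ' hQ'Ω hε'
    obtain ⟨d2, hd2, H2⟩ := aux_dq_conv hΩ hQ' hQ'Ω hfd hg hε'
    refine ⟨min d1 d2, by positivity, ?_⟩
    intro a b ha ha' hb hb'
    have a1 := H1 a ha.ne' (by rw [abs_of_pos ha]; exact ha'.trans_le (min_le_left _ _))
    have a2 := H2 a ha.ne' (by rw [abs_of_pos ha]; exact ha'.trans_le (min_le_right _ _))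
    have b1 := H1 b hb.ne' (by rw [abs_of_pos hb]; exact hb'.trans_le (min_le_left _ _))
    have b2 := H2 b hb.ne' (by rw [abs_of_pos hb]; exact hb'.trans_le (min_le_right _ _))
    refine ⟨a1.1, ?_⟩
    have hop : IsOpen (auxSh a Ω ∩ auxSh b Ω) := (auxSh_open hΩ).inter (auxSh_open hΩ)
    have cc : ∀ k : ℝ → ℝ → ℝ, ContinuousOn (Function.uncurry k) Ω →
        ContinuousOn (Function.uncurry (fun t x => auxDq a k t x - auxDq b k t x))
          (auxSh a Ω ∩ auxSh b Ω) := fun k hk =>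
      ((aux_cont_comp hk).mono inter_subset_left).sub ((aux_cont_comp hk).mono inter_subset_right)
    have hsub : Q' ⊆ auxSh a Ω ∩ auxSh b Ω := fun p hp => ⟨a1.1 hp, b1.1 hp⟩
    have en := aux_energy (m := 2 * (ε / B)) hδ ht (by linarith : x₁ - l ≤ x₂ + l)
      (D := fun t x => auxDq a z t x - auxDq b z t x)
      (D1 := fun t x => auxDq a zx t x - auxDq b zx t x)
      (D2 := fun t x => auxDq a zxx t x - auxDq b zxx t x)
      (E := fun t x => auxDq a zt t x - auxDq b zt t x)
      (g := fun t x => auxDq a f t x - auxDq b f t x) hop hsub (cc z h.cont) (cc zx cx)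
      (cc zxx cxx) (cc zt ct)
      (fun t x hm => (ddq z zx dzx a t x hm.1).sub (ddq z zx dzx b t x hm.2))
      (fun t x hm => (ddq zx zxx dzxx a t x hm.1).sub (ddq zx zxx dzxx b t x hm.2))
      (fun t x hm => (ddt a t x hm.1).sub (ddt b t x hm.2))
      (fun t x hm => by simp only [auxDq, hzt]; ring)
      (fun t ht x hx => by
        have e1 := abs_le.1 (a1.2 t x ⟨ht, hx⟩)
        have e2 := abs_le.1 (b1.2 t x ⟨ht, hx⟩)
        exact abs_le.2 ⟨by linarith, by linarith⟩)
      (fun t ht x hx => by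
        have e1 := abs_le.1 (a2.2 t x ⟨ht, hx⟩)
        have e2 := abs_le.1 (b2.2 t x ⟨ht, hx⟩)
        exact abs_le.2 ⟨by linarith, by linarith⟩)
    have := aux_L1_est (I := K0 * 4) ht hx hl hε' ((cc zt ct).mono hsub)
      (en.trans (le_of_eq (by rw [hK0]; ring)))
    rw [← hB, show B * (ε / B) = ε by field_simp] at this
    exact this
  choose d hd Hd using fun N : ℕ => main ((1/2) ^ N) (by positivity)
  obtain ⟨a, hap, had, halim⟩ := aux_seq d hd
  have hsh : ∀ k, Q' ⊆ auxSh (a k) Ω := fun k =>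
    (Hd k (a k) (a k) (hap k) (had k k le_rfl) (hap k) (had k k le_rfl)).1
  have cdq : ∀ k, ContinuousOn (Function.uncurry (auxDq (a k) zt)) (Icc t₁ t₂ ×ˢ Icc x₁ x₂) :=
    fun k => (aux_cont_comp ct).mono (hQQ.trans (hsh k))
  obtain ⟨A, hAm, hAi, hAs⟩ := aux_L1_lim (μ := volume.restrict (Icc t₁ t₂ ×ˢ Icc x₁ x₂))
    (ψ := fun k => Function.uncurry (auxDq (a k) zt))
    (fun k => (cdq k).integrableOn_compact hQc)
    (fun N n m hn hm => (Hd N (a n) (a m) (hap n) (had N n hn) (hap m) (had N m hm)).2)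
  have hane : Tendsto a atTop (𝓝[≠] 0) :=
    tendsto_nhdsWithin_iff.2 ⟨halim, Eventually.of_forall fun k => (hap k).ne'⟩
  have R1 := aux_M_swap hx ht (φ := fun k => auxDq (a k) z) (ψ := fun k => auxDq (a k) zt)
    (Φ := zx) hAm (fun k s hs y hy => ddt (a k) s y (hsh k (hQQ ⟨hs, hy⟩))) cdq
    (fun s hs y hy => ((dzx s y (hQ ⟨hs, hy⟩)).tendsto_slope_zero).comp hane)
    (cx.mono hQ) hAi hAs
  set P : ℝ → ℝ → ℝ := fun t x => ∫ σ in x₁..x, zt t σ with hP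
  have q1 : x₁ - l ≤ x₁ := sub_le_self _ hl.le
  have q2 : x₂ ≤ x₂ + l := le_add_of_nonneg_right hl.le
  have dP : ∀ t ∈ Icc t₁ t₂, ∀ x ∈ Icc (x₁ - l) (x₂ + l), HasDerivAt (P t) (zt t x) x := by
    intro t ht x hx'
    have hm : (t, x) ∈ Ω := hQ'Ω ⟨ht, hx'⟩
    have hopen : IsOpen {y : ℝ | (t, y) ∈ Ω} := hΩ.preimage (by fun_prop : Continuous fun y : ℝ => (t, y))
    have hco : ContinuousOn (zt t) {y : ℝ | (t, y) ∈ Ω} :=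
      ct.comp (f := fun y : ℝ => (t, y)) (by fun_prop) (fun y hy => hy)
    refine intervalIntegral.integral_hasDerivAt_right ?_
      (hco.stronglyMeasurableAtFilter hopen x hm) (hco.continuousAt (hopen.mem_nhds hm))
    refine (hco.mono ?_).intervalIntegrable
    intro y hy
    refine hQ'Ω ⟨ht, ?_⟩
    exact (uIcc_subset_Icc ⟨q1, hx.trans q2⟩ hx') hy
  have hal : ∀ k, ∀ t ∈ Icc t₁ t₂, ∀ x ∈ Icc x₁ x₂, a k ≤ l →
      HasDerivAt (auxDq (a k) P t) (auxDq (a k) zt t x) x := by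
    intro k t ht x hx' hk
    have e1 := dP t ht (x + a k) ⟨(q1.trans hx'.1).trans (le_add_of_nonneg_right (hap k).le), add_le_add hx'.2 hk⟩
    have e2 := dP t ht x ⟨q1.trans hx'.1, hx'.2.trans q2⟩
    exact ((e1.comp_add_const x (a k)).sub e2).const_mul _
  obtain ⟨k0, hk0⟩ := (halim.eventually (gt_mem_nhds hl)).exists_forall_of_atTop
  have hAs' : ∑' k, ∫⁻ p in Icc t₁ t₂ ×ˢ Icc x₁ x₂,
      ‖Function.uncurry (auxDq (a (k + k0)) zt) p - A p‖ₑ ≠ ⊤ := by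
    refine ne_top_of_le_ne_top hAs ?_
    exact ENNReal.tsum_comp_le_tsum_of_injective (add_left_injective k0)
      (fun k => ∫⁻ p in Icc t₁ t₂ ×ˢ Icc x₁ x₂, ‖Function.uncurry (auxDq (a k) zt) p - A p‖ₑ)
  have R2 := aux_M ht hx (φ := fun k => auxDq (a (k + k0)) P) (ψ := fun k => auxDq (a (k + k0)) zt)
    (Φ := zt) hAm (fun k s hs y hy => hal (k + k0) s hs y hy (hk0 _ (by omega)).le)
    (fun k => cdq (k + k0))
    (fun s hs y hy => ((dP s hs y (Icc_subset_Icc q1 q2 hy)).tendsto_slope_zero).comp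
      (hane.comp (tendsto_add_atTop_nat k0)))
    (ct.mono hQ) hAi hAs'
  filter_upwards [R1, R2] with p h1 h2 hp
  refine ⟨A p, h1 hp, (h2 hp).congr_of_eventuallyEq ?_⟩
  have hm : (p.1, p.2) ∈ Ω := hQ ⟨Ioo_subset_Icc_self hp.1, Ioo_subset_Icc_self hp.2⟩
  filter_upwards [aux_slice_nhds hΩ hm] with y hy
  exact (h.dt p.1 y hy).deriv

end

section
open Topology

structure AuxRad (d N : ℝ) (z f : ℝ → ℝ → ℝ) (Ω : Set (ℝ × ℝ)) : Prop where
  cont : ContinuousOn (Function.uncurry z) Ω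
  dx : ∀ t x, (t, x) ∈ Ω → DifferentiableAt ℝ (z t) x
  dxx : ∀ t x, (t, x) ∈ Ω → DifferentiableAt ℝ (deriv (z t)) x
  dt : ∀ t x, (t, x) ∈ Ω →
    HasDerivAt (fun s => z s x) (d * (deriv (deriv (z t)) x + N / x * deriv (z t) x) + f t x) t

theorem aux_pow_deriv {x : ℝ} (hx : 0 < x) (m : ℝ) :
    HasDerivAt (fun y : ℝ => y ^ m) (m * x ^ m / x) x := by
  have := Real.hasDerivAt_rpow_const (x := x) (p := m) (Or.inl hx.ne')
  refine this.congr_deriv ?_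
  rw [Real.rpow_sub_one hx.ne']; ring

theorem aux_rad_dx {d N : ℝ} {z f : ℝ → ℝ → ℝ} {Ω : Set (ℝ × ℝ)}
    (hpos : ∀ t x, (t, x) ∈ Ω → 0 < x) (h : AuxRad d N z f Ω) (m : ℝ) (t x : ℝ) (hx : (t, x) ∈ Ω) :
    HasDerivAt (fun y => y ^ m * z t y) (x ^ m * (deriv (z t) x + m * z t x / x)) x := by
  refine ((aux_pow_deriv (hpos t x hx) m).mul (h.dx t x hx).hasDerivAt).congr_deriv ?_
  have := hpos t x hx
  field_simp
  ring

theorem aux_rad_dxx {d N : ℝ} {z f : ℝ → ℝ → ℝ} {Ω : Set (ℝ × ℝ)} (hΩ : IsOpen Ω)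
    (hpos : ∀ t x, (t, x) ∈ Ω → 0 < x) (h : AuxRad d N z f Ω) (m : ℝ) (t x : ℝ) (hx : (t, x) ∈ Ω) :
    HasDerivAt (deriv (fun y => y ^ m * z t y)) (x ^ m * (deriv (deriv (z t)) x
      + 2 * m * deriv (z t) x / x + m * (m - 1) * z t x / x ^ 2)) x := by
  have e : deriv (fun y => y ^ m * z t y) =ᶠ[𝓝 x]
      fun y => y ^ m * (deriv (z t) y + m * z t y / y) := by
    filter_upwards [aux_slice_nhds hΩ hx] with y hy
    exact (aux_rad_dx hpos h m t y hy).deriv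
  have hp := hpos t x hx
  refine HasDerivAt.congr_of_eventuallyEq ?_ e
  have h1 := (aux_pow_deriv hp m).mul ((h.dxx t x hx).hasDerivAt.add
    (((h.dx t x hx).hasDerivAt.const_mul m).div (hasDerivAt_id x) hp.ne'))
  refine h1.congr_deriv ?_
  simp only [id, Pi.add_apply, Pi.div_apply, Pi.mul_apply]
  field_simp
  ring

theorem aux_rad_sol {d N : ℝ} {z f : ℝ → ℝ → ℝ} {Ω : Set (ℝ × ℝ)} (hΩ : IsOpen Ω)
    (hpos : ∀ t x, (t, x) ∈ Ω → 0 < x) (h : AuxRad d N z f Ω) :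
    AuxSol d (fun t x => x ^ (N / 2) * z t x)
      (fun t x => x ^ (N / 2) * (f t x - d * (N / 2 * (N / 2 - 1)) * z t x / x ^ 2)) Ω := by
  refine ⟨?_, fun t x hx => (aux_rad_dx hpos h _ t x hx).differentiableAt,
    fun t x hx => (aux_rad_dxx hΩ hpos h _ t x hx).differentiableAt, ?_⟩
  · have h1 : ContinuousOn (fun p : ℝ × ℝ => p.2 ^ (N / 2)) Ω :=
      ContinuousOn.rpow_const continuousOn_snd (fun p hp => Or.inl (hpos p.1 p.2 hp).ne')
    exact h1.mul h.cont
  · intro t x hx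
    rw [(aux_rad_dxx hΩ hpos h _ t x hx).deriv]
    have hp := hpos t x hx
    refine ((h.dt t x hx).const_mul (x ^ (N / 2))).congr_deriv ?_
    field_simp
    ring

theorem aux_rad_cont_dx {d N : ℝ} (hd : 0 < d) {z f : ℝ → ℝ → ℝ} {Ω : Set (ℝ × ℝ)} (hΩ : IsOpen Ω)
    (hpos : ∀ t x, (t, x) ∈ Ω → 0 < x) (h : AuxRad d N z f Ω)
    (hf : ContinuousOn (Function.uncurry f) Ω) :
    ContinuousOn (Function.uncurry (fun t x => deriv (z t) x)) Ω := by
  have h1 : ContinuousOn (fun p : ℝ × ℝ => p.2 ^ (N / 2)) Ω :=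
      ContinuousOn.rpow_const continuousOn_snd (fun p hp => Or.inl (hpos p.1 p.2 hp).ne')
  have hz : ContinuousOn (fun p : ℝ × ℝ => z p.1 p.2) Ω := h.cont
  have hf' : ContinuousOn (fun p : ℝ × ℝ => f p.1 p.2) Ω := hf
  have h2 := aux_cont_dx hd hΩ (aux_rad_sol hΩ hpos h) (by
    have : ContinuousOn (fun p : ℝ × ℝ => p.2 ^ (N / 2) *
      (f p.1 p.2 - d * (N / 2 * (N / 2 - 1)) * z p.1 p.2 / p.2 ^ 2)) Ω := by
      refine h1.mul (hf'.sub (ContinuousOn.div (by fun_prop) (by fun_prop) ?_))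
      intro p hp
      have := hpos p.1 p.2 hp
      positivity
    exact this)
  have h3 : ContinuousOn (fun p : ℝ × ℝ =>
      deriv (fun y => y ^ (N / 2) * z p.1 y) p.2 / p.2 ^ (N / 2) - N / 2 * z p.1 p.2 / p.2) Ω := by
    refine (ContinuousOn.div h2 h1 ?_).sub (ContinuousOn.div (by fun_prop) (by fun_prop) ?_)
    · intro p hp
      exact (Real.rpow_pos_of_pos (hpos p.1 p.2 hp) _).ne'
    · intro p hp
      exact (hpos p.1 p.2 hp).ne'
  refine h3.congr ?_
  intro p hp
  have hp0 := hpos p.1 p.2 hp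
  have hP := Real.rpow_pos_of_pos hp0 (N / 2)
  simp only [Function.uncurry_def]
  rw [(aux_rad_dx hpos h _ p.1 p.2 hp).deriv]
  field_simp
  ring

theorem aux_rad_reg {d N : ℝ} (hd : 0 < d) {z f g : ℝ → ℝ → ℝ} {Ω : Set (ℝ × ℝ)} (hΩ : IsOpen Ω)
    (hpos : ∀ t x, (t, x) ∈ Ω → 0 < x) (h : AuxRad d N z f Ω)
    (hf : ContinuousOn (Function.uncurry f) Ω)
    (hfd : ∀ t x, (t, x) ∈ Ω → HasDerivAt (f t) (g t x) x)
    (hg : ContinuousOn (Function.uncurry g) Ω) {t₁ t₂ x₁ x₂ : ℝ} (ht : t₁ ≤ t₂) (hx : x₁ ≤ x₂)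
    (hQ : Icc t₁ t₂ ×ˢ Icc x₁ x₂ ⊆ Ω) :
    ∀ᵐ p : ℝ × ℝ, p ∈ Ioo t₁ t₂ ×ˢ Ioo x₁ x₂ → ∃ W Y,
      HasDerivAt (fun s => deriv (z s) p.2) W p.1 ∧
      HasDerivAt (deriv (deriv (z p.1))) Y p.2 ∧
      W = d * (Y + N / p.2 * deriv (deriv (z p.1)) p.2 - N / p.2 ^ 2 * deriv (z p.1) p.2)
        + g p.1 p.2 := by
  have hdx := aux_rad_cont_dx hd hΩ hpos h hf
  have h1 : ContinuousOn (fun p : ℝ × ℝ => p.2 ^ (N / 2)) Ω :=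
      ContinuousOn.rpow_const continuousOn_snd (fun p hp => Or.inl (hpos p.1 p.2 hp).ne')
  have hz : ContinuousOn (fun p : ℝ × ℝ => z p.1 p.2) Ω := h.cont
  have hdx' : ContinuousOn (fun p : ℝ × ℝ => deriv (z p.1) p.2) Ω := hdx
  have hf' : ContinuousOn (fun p : ℝ × ℝ => f p.1 p.2) Ω := hf
  have hg' : ContinuousOn (fun p : ℝ × ℝ => g p.1 p.2) Ω := hg
  have hne : ∀ p ∈ Ω, p.2 ≠ 0 := fun p hp => (hpos p.1 p.2 hp).ne'
  set k := d * (N / 2 * (N / 2 - 1)) with hk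
  have key := aux_reg hd hΩ (aux_rad_sol hΩ hpos h)
    (g := fun t x => (N / 2) * x ^ (N / 2) / x * (f t x - k * z t x / x ^ 2)
      + x ^ (N / 2) * (g t x - (k * deriv (z t) x / x ^ 2 - 2 * k * z t x / x ^ 3))) ?_ ?_ ?_ ht hx hQ
  · filter_upwards [key] with p hp hpm
    obtain ⟨Z, hZ1, hZ2⟩ := hp hpm
    obtain ⟨t, x⟩ := p
    simp only at hZ1 hZ2 ⊢
    have hmem : (t, x) ∈ Ω := hQ ⟨Ioo_subset_Icc_self hpm.1, Ioo_subset_Icc_self hpm.2⟩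
    have hx0 := hpos t x hmem
    have hP := Real.rpow_pos_of_pos hx0 (N / 2)
    set zt := d * (deriv (deriv (z t)) x + N / x * deriv (z t) x) + f t x with hzt
    have hW1 : HasDerivAt (fun s => deriv (z s) x) (Z / x ^ (N / 2) - N / 2 * zt / x) t := by
      have e : (fun s => deriv (z s) x) =ᶠ[𝓝 t] fun s =>
          deriv (fun y => y ^ (N / 2) * z s y) x / x ^ (N / 2) - N / 2 * z s x / x := by
        filter_upwards [aux_slice_nhds' hΩ hmem] with s hs
        rw [(aux_rad_dx hpos h _ s x hs).deriv]
        field_simp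
        ring
      refine HasDerivAt.congr_of_eventuallyEq ?_ e
      exact (hZ1.div_const _).sub (((h.dt t x hmem).const_mul (N / 2)).div_const x)
    have hW2 : HasDerivAt (fun y => deriv (fun s => z s y) t) (Z / x ^ (N / 2) - N / 2 * zt / x) x := by
      have e0 : ∀ y, (t, y) ∈ Ω → deriv (fun s => y ^ (N / 2) * z s y) t =
          y ^ (N / 2) * deriv (fun s => z s y) t := by
        intro y hy
        exact deriv_const_mul _ (h.dt t y hy).differentiableAt
      have e : (fun y => deriv (fun s => z s y) t) =ᶠ[𝓝 x] fun y =>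
          deriv (fun s => y ^ (N / 2) * z s y) t / y ^ (N / 2) := by
        filter_upwards [aux_slice_nhds hΩ hmem] with y hy
        rw [e0 y hy]
        have hP := Real.rpow_pos_of_pos (hpos t y hy) (N / 2)
        field_simp
      refine HasDerivAt.congr_of_eventuallyEq ?_ e
      refine (hZ2.div (aux_pow_deriv hx0 (N / 2)) hP.ne').congr_deriv ?_
      rw [e0 x hmem, (h.dt t x hmem).deriv, ← hzt]
      field_simp
    have hY : HasDerivAt (deriv (deriv (z t))) ((Z / x ^ (N / 2) - N / 2 * zt / x) / d - 
        (N / x * deriv (deriv (z t)) x - N / x ^ 2 * deriv (z t) x) - g t x / d) x := by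
      have e : deriv (deriv (z t)) =ᶠ[𝓝 x] fun y =>
          deriv (fun s => z s y) t / d - N / y * deriv (z t) y - f t y / d := by
        filter_upwards [aux_slice_nhds hΩ hmem] with y hy
        rw [(h.dt t y hy).deriv]
        field_simp
        ring
      refine HasDerivAt.congr_of_eventuallyEq ?_ e
      have a1 : HasDerivAt (fun y : ℝ => N / y) (-(N / x ^ 2)) x := by
        refine ((hasDerivAt_inv hx0.ne').const_mul N).congr_deriv ?_
        ring
      have := ((hW2.div_const d).sub (a1.mul (h.dxx t x hmem).hasDerivAt)).sub
        ((hfd t x hmem).div_const d)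
      refine this.congr_deriv ?_
      ring
    refine ⟨_, _, hW1, hY, ?_⟩
    field_simp
    ring
  · have : ContinuousOn (fun p : ℝ × ℝ => p.2 ^ (N / 2) *
      (f p.1 p.2 - k * z p.1 p.2 / p.2 ^ 2)) Ω := by
      refine h1.mul (hf'.sub (ContinuousOn.div (by fun_prop) (by fun_prop) ?_))
      intro p hp
      exact pow_ne_zero _ (hne p hp)
    exact this
  · intro t x hmem
    have hx0 := hpos t x hmem
    have a2 : HasDerivAt (fun y => k * z t y / y ^ 2) (k * deriv (z t) x / x ^ 2 - 2 * k * z t x / x ^ 3) x := by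
      refine (((h.dx t x hmem).hasDerivAt.const_mul k).div (hasDerivAt_pow 2 x) (by positivity)).congr_deriv ?_
      push_cast
      field_simp
    refine ((aux_pow_deriv hx0 (N / 2)).mul ((hfd t x hmem).sub a2)).congr_deriv ?_
    simp only [Pi.sub_apply]
  · have : ContinuousOn (fun p : ℝ × ℝ => (N / 2) * p.2 ^ (N / 2) / p.2 * (f p.1 p.2 - k * z p.1 p.2 / p.2 ^ 2)
      + p.2 ^ (N / 2) * (g p.1 p.2 - (k * deriv (z p.1) p.2 / p.2 ^ 2 - 2 * k * z p.1 p.2 / p.2 ^ 3))) Ω := by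
      have i1 : ContinuousOn (fun p : ℝ × ℝ => (p.2)⁻¹) Ω := continuousOn_snd.inv₀ hne
      simp only [div_eq_mul_inv, ← inv_pow] at *
      fun_prop
    exact this

end

section
open Topology

structure AuxSys (N R p q d₁ d₂ c₁ c₂ T : ℝ) (F G u v : ℝ → ℝ → ℝ) : Prop where
  N0 : 0 ≤ N
  R0 : 0 < R
  p1 : 1 < p
  q1 : 1 < q
  d10 : 0 < d₁
  d20 : 0 < d₂
  c10 : 0 < c₁
  c20 : 0 < c₂
  T0 : 0 < T
  FC : ContDiff ℝ 1 (Function.uncurry F)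
  GC : ContDiff ℝ 1 (Function.uncurry G)
  Flow : ∀ a b : ℝ, 0 ≤ a → 0 ≤ b → c₁ * b ^ p ≤ F a b
  Glow : ∀ a b : ℝ, 0 ≤ a → 0 ≤ b → c₁ * a ^ q ≤ G a b
  Fup : ∀ a b : ℝ, 0 ≤ a → 0 ≤ b → F a b ≤ c₂ * (b ^ p + a ^ (p * (q + 1) / (p + 1)) + 1)
  Gup : ∀ a b : ℝ, 0 ≤ a → 0 ≤ b → G a b ≤ c₂ * (a ^ q + b ^ (q * (p + 1) / (q + 1)) + 1)
  unn : ∀ t ∈ Ico (0:ℝ) T, ∀ x ∈ Icc (0:ℝ) R, 0 ≤ u t x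
  vnn : ∀ t ∈ Ico (0:ℝ) T, ∀ x ∈ Icc (0:ℝ) R, 0 ≤ v t x
  ucont : ContinuousOn (Function.uncurry u) (Ico (0:ℝ) T ×ˢ Icc (0:ℝ) R)
  vcont : ContinuousOn (Function.uncurry v) (Ico (0:ℝ) T ×ˢ Icc (0:ℝ) R)
  ubc : ∀ t ∈ Ioo (0:ℝ) T, u t R = 0
  vbc : ∀ t ∈ Ioo (0:ℝ) T, v t R = 0
  uneg : ∀ t ∈ Ioo (0:ℝ) T, ∀ x ∈ Ioo (0:ℝ) R, deriv (u t) x ≤ 0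
  vneg : ∀ t ∈ Ioo (0:ℝ) T, ∀ x ∈ Ioo (0:ℝ) R, deriv (v t) x ≤ 0
  urad : AuxRad d₁ N u (fun t x => F (u t x) (v t x)) (Ioo (0:ℝ) T ×ˢ Ioo (0:ℝ) R)
  vrad : AuxRad d₂ N v (fun t x => G (u t x) (v t x)) (Ioo (0:ℝ) T ×ˢ Ioo (0:ℝ) R)

variable {N R p q d₁ d₂ c₁ c₂ T : ℝ} {F G u v : ℝ → ℝ → ℝ}

theorem AuxSys.swap (S : AuxSys N R p q d₁ d₂ c₁ c₂ T F G u v) :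
    AuxSys N R q p d₂ d₁ c₁ c₂ T (fun a b => G b a) (fun a b => F b a) v u where
  N0 := S.N0
  R0 := S.R0
  p1 := S.q1
  q1 := S.p1
  d10 := S.d20
  d20 := S.d10
  c10 := S.c10
  c20 := S.c20
  T0 := S.T0
  FC := S.GC.comp (contDiff_snd.prodMk contDiff_fst)
  GC := S.FC.comp (contDiff_snd.prodMk contDiff_fst)
  Flow := fun a b ha hb => S.Glow b a hb ha
  Glow := fun a b ha hb => S.Flow b a hb ha
  Fup := fun a b ha hb => S.Gup b a hb ha
  Gup := fun a b ha hb => S.Fup b a hb ha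
  unn := S.vnn
  vnn := S.unn
  ucont := S.vcont
  vcont := S.ucont
  ubc := S.vbc
  vbc := S.ubc
  uneg := S.vneg
  vneg := S.uneg
  urad := S.vrad
  vrad := S.urad

theorem AuxSys.anti (S : AuxSys N R p q d₁ d₂ c₁ c₂ T F G u v) {t : ℝ} (ht : t ∈ Ioo 0 T)
    {x y : ℝ} (hx : 0 ≤ x) (hxy : x ≤ y) (hy : y ≤ R) : u t y ≤ u t x := by
  have hc : ContinuousOn (u t) (Icc 0 R) := by
    refine S.ucont.comp (f := fun x : ℝ => (t, x)) (by fun_prop) ?_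
    intro y hy
    exact ⟨⟨ht.1.le, ht.2⟩, hy⟩
  have : AntitoneOn (u t) (Icc 0 R) := by
    refine antitoneOn_of_deriv_nonpos (convex_Icc 0 R) hc ?_ ?_
    · rw [interior_Icc]
      intro y hy
      exact (S.urad.dx t y ⟨ht, hy⟩).differentiableWithinAt
    · rw [interior_Icc]
      exact S.uneg t ht
  exact this ⟨hx, hxy.trans hy⟩ ⟨hx.trans hxy, hy⟩ hxy

theorem aux_partial (hF : ContDiff ℝ 1 (Function.uncurry F)) (a b : ℝ) :
    deriv (fun x => F x b) a = fderiv ℝ (Function.uncurry F) (a, b) (1, 0) ∧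
    deriv (fun y => F a y) b = fderiv ℝ (Function.uncurry F) (a, b) (0, 1) := by
  have h : HasFDerivAt (Function.uncurry F) (fderiv ℝ (Function.uncurry F) (a, b)) (a, b) :=
    (hF.differentiable (by norm_num)).differentiableAt.hasFDerivAt
  constructor
  · have : HasDerivAt (fun x : ℝ => (x, b)) ((1:ℝ), (0:ℝ)) a :=
      (hasDerivAt_id a).prodMk (hasDerivAt_const a b)
    exact (h.comp_hasDerivAt a this).deriv
  · have : HasDerivAt (fun x : ℝ => (a, x)) ((0:ℝ), (1:ℝ)) b :=
      (hasDerivAt_const b a).prodMk (hasDerivAt_id b)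
    exact (h.comp_hasDerivAt b this).deriv

theorem aux_partial_cont (hF : ContDiff ℝ 1 (Function.uncurry F)) :
    Continuous (fun p : ℝ × ℝ => deriv (fun x => F x p.2) p.1) ∧
    Continuous (fun p : ℝ × ℝ => deriv (fun y => F p.1 y) p.2) := by
  have h := hF.continuous_fderiv (by norm_num)
  constructor
  · have : (fun p : ℝ × ℝ => deriv (fun x => F x p.2) p.1) =
      fun p => fderiv ℝ (Function.uncurry F) p (1, 0) := by
      funext p; exact (aux_partial hF p.1 p.2).1
    rw [this]; fun_prop
  · have : (fun p : ℝ × ℝ => deriv (fun y => F p.1 y) p.2) =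
      fun p => fderiv ℝ (Function.uncurry F) p (0, 1) := by
      funext p; exact (aux_partial hF p.1 p.2).2
    rw [this]; fun_prop

theorem aux_chain (hF : ContDiff ℝ 1 (Function.uncurry F)) {f g : ℝ → ℝ} {f' g' x : ℝ}
    (hf : HasDerivAt f f' x) (hg : HasDerivAt g g' x) :
    HasDerivAt (fun y => F (f y) (g y)) (deriv (fun a => F a (g x)) (f x) * f'
      + deriv (fun b => F (f x) b) (g x) * g') x := by
  have h : HasFDerivAt (Function.uncurry F) (fderiv ℝ (Function.uncurry F) (f x, g x)) (f x, g x) :=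
    (hF.differentiable (by norm_num)).differentiableAt.hasFDerivAt
  have h2 := h.comp_hasDerivAt x (hf.prodMk hg)
  refine h2.congr_deriv ?_
  rw [(aux_partial hF _ _).1, (aux_partial hF _ _).2]
  have : (f', g') = f' • ((1:ℝ), (0:ℝ)) + g' • ((0:ℝ), (1:ℝ)) := by simp
  rw [this, map_add, map_smul, map_smul]
  simp only [smul_eq_mul]; ring

theorem AuxSys.reg (S : AuxSys N R p q d₁ d₂ c₁ c₂ T F G u v) :
    ∀ᵐ p : ℝ × ℝ, p ∈ Ioo 0 T ×ˢ Ioo 0 R → ∃ W Y,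
      HasDerivAt (fun s => deriv (u s) p.2) W p.1 ∧
      HasDerivAt (deriv (deriv (u p.1))) Y p.2 ∧
      W = d₁ * (Y + N / p.2 * deriv (deriv (u p.1)) p.2 - N / p.2 ^ 2 * deriv (u p.1) p.2)
        + (deriv (fun a => F a (v p.1 p.2)) (u p.1 p.2) * deriv (u p.1) p.2
          + deriv (fun b => F (u p.1 p.2) b) (v p.1 p.2) * deriv (v p.1) p.2) := by
  set Ω : Set (ℝ × ℝ) := Ioo 0 T ×ˢ Ioo 0 R with hΩd
  have hΩ : IsOpen Ω := isOpen_Ioo.prod isOpen_Ioo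
  have hpos : ∀ t x, (t, x) ∈ Ω → 0 < x := fun t x h => h.2.1
  have hu := S.urad.cont
  have hv := S.vrad.cont
  have huv : ContinuousOn (fun p : ℝ × ℝ => (u p.1 p.2, v p.1 p.2)) Ω := hu.prodMk hv
  have hFc : ContinuousOn (Function.uncurry fun t x => F (u t x) (v t x)) Ω :=
    S.FC.continuous.comp_continuousOn huv
  have hGc : ContinuousOn (Function.uncurry fun t x => G (u t x) (v t x)) Ω :=
    S.GC.continuous.comp_continuousOn huv
  have hux := aux_rad_cont_dx S.d10 hΩ hpos S.urad hFc
  have hvx := aux_rad_cont_dx S.d20 hΩ hpos S.vrad hGc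
  have hk : ∀ k : ℕ, ∀ᵐ p : ℝ × ℝ, p ∈ Ioo (T * (1 / ((k:ℝ) + 2))) (T * (1 - 1 / ((k:ℝ) + 2))) ×ˢ
        Ioo (R * (1 / ((k:ℝ) + 2))) (R * (1 - 1 / ((k:ℝ) + 2))) → ∃ W Y,
      HasDerivAt (fun s => deriv (u s) p.2) W p.1 ∧
      HasDerivAt (deriv (deriv (u p.1))) Y p.2 ∧
      W = d₁ * (Y + N / p.2 * deriv (deriv (u p.1)) p.2 - N / p.2 ^ 2 * deriv (u p.1) p.2)
        + (deriv (fun a => F a (v p.1 p.2)) (u p.1 p.2) * deriv (u p.1) p.2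
          + deriv (fun b => F (u p.1 p.2) b) (v p.1 p.2) * deriv (v p.1) p.2) := by
    intro k
    have h0 : (0:ℝ) < 1 / ((k:ℝ) + 2) := by positivity
    have h1 : 1 / ((k:ℝ) + 2) ≤ 1 / 2 := by
      apply one_div_le_one_div_of_le <;> [norm_num; linarith [(Nat.cast_nonneg k : (0:ℝ) ≤ k)]]
    set e := 1 / ((k:ℝ) + 2)
    have hT := S.T0
    have hR := S.R0
    refine aux_rad_reg S.d10 hΩ hpos S.urad hFc
      (g := fun t x => deriv (fun a => F a (v t x)) (u t x) * deriv (u t) x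
          + deriv (fun b => F (u t x) b) (v t x) * deriv (v t) x) ?_ ?_ ?_ ?_ ?_
    · intro t x hx
      exact aux_chain S.FC (S.urad.dx t x hx).hasDerivAt (S.vrad.dx t x hx).hasDerivAt
    · have c1 := (aux_partial_cont S.FC).1.comp_continuousOn huv
      have c2 := (aux_partial_cont S.FC).2.comp_continuousOn huv
      exact (c1.mul hux).add (c2.mul hvx)
    · nlinarith
    · nlinarith
    · rintro ⟨t, x⟩ ⟨⟨a1, a2⟩, ⟨a3, a4⟩⟩
      simp only at a1 a2 a3 a4
      have : 0 < T * e := by positivity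
      have : 0 < R * e := by positivity
      refine ⟨⟨?_, ?_⟩, ⟨?_, ?_⟩⟩ <;> simp only <;> nlinarith
  filter_upwards [ae_all_iff.2 hk] with p hp hpm
  obtain ⟨⟨a1, a2⟩, ⟨a3, a4⟩⟩ := hpm
  have hT := S.T0
  have hR := S.R0
  have hm : 0 < min (min (p.1 / T) (1 - p.1 / T)) (min (p.2 / R) (1 - p.2 / R)) := by
    have b1 : p.1 / T < 1 := by rw [div_lt_one hT]; exact a2
    have b2 : p.2 / R < 1 := by rw [div_lt_one hR]; exact a4
    have b3 : 0 < p.1 / T := by positivity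
    have b4 : 0 < p.2 / R := by positivity
    refine lt_min (lt_min b3 (by linarith)) (lt_min b4 (by linarith))
  obtain ⟨k, hk⟩ := exists_nat_one_div_lt hm
  have hk2 : 1 / ((k:ℝ) + 2) ≤ 1 / ((k:ℝ) + 1) :=
    one_div_le_one_div_of_le (by positivity) (by linarith)
  have hk3 := lt_of_le_of_lt hk2 hk
  refine hp k ?_
  set e := 1 / ((k:ℝ) + 2)
  simp only [lt_min_iff] at hk3
  obtain ⟨⟨b1, b2⟩, b3, b4⟩ := hk3
  have e1 : T * (p.1 / T) = p.1 := by field_simp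
  have e2 : R * (p.2 / R) = p.2 := by field_simp
  refine ⟨⟨?_, ?_⟩, ⟨?_, ?_⟩⟩ <;> nlinarith

end

section
open Topology

theorem aux_touch_sub {d N t x : ℝ} (hd : 0 ≤ d) {z f φ : ℝ → ℝ → ℝ} {Ω : Set (ℝ × ℝ)}
    (hΩ : IsOpen Ω) (h : AuxRad d N z f Ω) (hm : (t, x) ∈ Ω) {φ1 : ℝ → ℝ} {φ2 φt : ℝ}
    (h1 : ∀ᶠ y in 𝓝 x, HasDerivAt (φ t) (φ1 y) y) (h2 : HasDerivAt φ1 φ2 x)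
    (ht : HasDerivAt (fun s => φ s x) φt t)
    (w0 : deriv (fun y => φ t y - z t y) x = 0)
    (w1 : deriv (deriv (fun y => φ t y - z t y)) x ≤ 0)
    (hneg : φt < d * (φ2 + N / x * φ1 x) + f t x) :
    ∃ e < 0, HasDerivAt (fun s => φ s x - z s x) e t := by
  have hz : ∀ᶠ y in 𝓝 x, HasDerivAt (z t) (deriv (z t) y) y := by
    filter_upwards [aux_slice_nhds hΩ hm] with y hy
    exact (h.dx t y hy).hasDerivAt
  obtain ⟨e1, e2⟩ := aux_deriv_sub h1 h2 hz (h.dxx t x hm).hasDerivAt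
  rw [e1] at w0
  rw [e2] at w1
  refine ⟨_, ?_, ht.sub (h.dt t x hm)⟩
  have e3 : deriv (z t) x = φ1 x := by linarith
  rw [e3]
  have : d * φ2 ≤ d * deriv (deriv (z t)) x := mul_le_mul_of_nonneg_left (by linarith) hd
  linarith

theorem aux_touch_sup {d N t x : ℝ} (hd : 0 ≤ d) {z f φ : ℝ → ℝ → ℝ} {Ω : Set (ℝ × ℝ)}
    (hΩ : IsOpen Ω) (h : AuxRad d N z f Ω) (hm : (t, x) ∈ Ω) {φ1 : ℝ → ℝ} {φ2 φt : ℝ}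
    (h1 : ∀ᶠ y in 𝓝 x, HasDerivAt (φ t) (φ1 y) y) (h2 : HasDerivAt φ1 φ2 x)
    (ht : HasDerivAt (fun s => φ s x) φt t)
    (w0 : deriv (fun y => z t y - φ t y) x = 0)
    (w1 : deriv (deriv (fun y => z t y - φ t y)) x ≤ 0)
    (hneg : d * (φ2 + N / x * φ1 x) + f t x < φt) :
    ∃ e < 0, HasDerivAt (fun s => z s x - φ s x) e t := by
  have hz : ∀ᶠ y in 𝓝 x, HasDerivAt (z t) (deriv (z t) y) y := by
    filter_upwards [aux_slice_nhds hΩ hm] with y hy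
    exact (h.dx t y hy).hasDerivAt
  obtain ⟨e1, e2⟩ := aux_deriv_sub hz (h.dxx t x hm).hasDerivAt h1 h2
  rw [e1] at w0
  rw [e2] at w1
  refine ⟨_, ?_, (h.dt t x hm).sub ht⟩
  have e3 : deriv (z t) x = φ1 x := by linarith
  rw [e3]
  have : d * deriv (deriv (z t)) x ≤ d * φ2 := mul_le_mul_of_nonneg_left (by linarith) hd
  linarith

theorem aux_persist {d N R T : ℝ} (hd : 0 < d) (hN : 0 ≤ N) {z f : ℝ → ℝ → ℝ}
    (h : AuxRad d N z f (Ioo 0 T ×ˢ Ioo 0 R)) {b t₀ t₂ K m : ℝ} (hb : 0 < b) (hbR : b < R)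
    (ht₀ : 0 < t₀) (ht : t₀ ≤ t₂) (ht₂ : t₂ < T) (hK : 0 ≤ K) (hm : 0 ≤ m)
    (hnn : ∀ t ∈ Icc t₀ t₂, ∀ x ∈ Icc (b / 2) b, 0 ≤ z t x)
    (hf : ∀ t ∈ Icc t₀ t₂, ∀ x ∈ Icc (b / 2) b, m ≤ f t x)
    (hi : ∀ x ∈ Icc (b / 2) b, K ≤ z t₀ x)
    (hs : d * (2 + N) * 16 / b ^ 2 * (t₂ - t₀) ≤ 1 / 4) :
    (K + m * (t₂ - t₀)) / 2 ≤ z t₂ (7 * b / 8) := by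
  set Ω : Set (ℝ × ℝ) := Ioo 0 T ×ˢ Ioo 0 R with hΩd
  have hΩ : IsOpen Ω := isOpen_Ioo.prod isOpen_Ioo
  have hsub : Icc t₀ t₂ ×ˢ Icc (b / 2) b ⊆ Ω := by
    rintro ⟨t, x⟩ ⟨⟨a1, a2⟩, ⟨a3, a4⟩⟩
    simp only at a1 a2 a3 a4
    exact ⟨⟨by simp only; linarith, by simp only; linarith⟩, ⟨by simp only; linarith, by simp only; linarith⟩⟩
  set l := d * (2 + N) * 16 / b ^ 2 with hl
  have hl0 : 0 ≤ l := by positivity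
  set c := 3 * b / 4 with hcd
  set H := 16 / b ^ 2 with hHd
  have hH : 0 < H := by positivity
  have key : ∀ ε > 0, (K + m * (t₂ - t₀)) * (1 - H * (7 * b / 8 - c) ^ 2 - l * (t₂ - t₀))
      - ε * (1 + (t₂ - t₀)) - z t₂ (7 * b / 8) < 0 := by
    intro ε hε
    have hzc : ContinuousOn (fun p : ℝ × ℝ => z p.1 p.2) (Icc t₀ t₂ ×ˢ Icc (b / 2) b) :=
      h.cont.mono hsub
    set φ : ℝ → ℝ → ℝ := fun t x => (K + m * (t - t₀)) * (1 - H * (x - c) ^ 2 - l * (t - t₀))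
      - ε * (1 + (t - t₀)) with hφ
    have := aux_mp (t₁ := t₀) (t₂ := t₂) (a := b / 2) (b := b) (fun t x => φ t x - z t x)
      ?_ ?_ ?_ ?_ t₂ ⟨ht, le_rfl⟩ (7 * b / 8) ⟨by linarith, by linarith⟩
    · exact this
    · have : ContinuousOn (fun p : ℝ × ℝ => φ p.1 p.2 - z p.1 p.2) (Icc t₀ t₂ ×ˢ Icc (b / 2) b) := by
        simp only [hφ]
        fun_prop
      exact this
    · intro x hx
      have := hi x hx
      simp only [hφ, sub_self, mul_zero, add_zero, sub_zero, mul_one]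
      have : 0 ≤ K * (H * (x - c) ^ 2) := by positivity
      linarith
    · intro t ht
      have e1 : H * (b / 2 - c) ^ 2 = 1 := by simp only [hHd, hcd]; field_simp; ring
      have e2 : H * (b - c) ^ 2 = 1 := by simp only [hHd, hcd]; field_simp; ring
      have a1 := hnn t ht (b / 2) ⟨by linarith, by linarith⟩
      have a2 := hnn t ht b ⟨by linarith, by linarith⟩
      have a3 : 0 ≤ t - t₀ := by linarith [ht.1]
      have a4 : 0 ≤ (K + m * (t - t₀)) * (l * (t - t₀)) := by positivity
      have a5 : 0 ≤ ε * (t - t₀) := by positivity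
      constructor
      · simp only [hφ, e1]; linarith
      · simp only [hφ, e2]; linarith
    · intro t ht x hx w w0 w1
      have hmem : (t, x) ∈ Ω := hsub ⟨Ioc_subset_Icc_self ht, Ioo_subset_Icc_self hx⟩
      have hs0 : 0 ≤ t - t₀ := by linarith [ht.1]
      set A := K + m * (t - t₀) with hA
      have hA0 : 0 ≤ A := by positivity
      refine aux_touch_sub hd.le hΩ h hmem (φ := φ) (φ1 := fun y => A * (-(H * (2 * (y - c)))))
        (φ2 := A * (-(H * 2)))
        (φt := m * (1 - H * (x - c) ^ 2 - l * (t - t₀)) + A * (-l) - ε) ?_ ?_ ?_ w0 w1 ?_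
      · refine Eventually.of_forall fun y => ?_
        have e1 : HasDerivAt (fun y : ℝ => (y - c) ^ 2) (2 * (y - c)) y := by
          refine (((hasDerivAt_id y).sub_const c).pow 2).congr_deriv ?_
          simp
        refine ((((e1.const_mul H).const_sub 1).sub_const (l * (t - t₀))).const_mul A).sub_const
          (ε * (1 + (t - t₀)))
      · have e1 : HasDerivAt (fun y : ℝ => (y - c)) 1 x := (hasDerivAt_id x).sub_const c
        refine ((((e1.const_mul 2).const_mul H).neg).const_mul A).congr_deriv ?_
        ring
      · have e1 : HasDerivAt (fun s : ℝ => (s - t₀)) 1 t := (hasDerivAt_id t).sub_const t₀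
        have e2 := (((e1.const_mul m).const_add K).mul
          ((e1.const_mul l).const_sub (1 - H * (x - c) ^ 2))).sub ((e1.const_add 1).const_mul ε)
        refine e2.congr_deriv ?_
        simp only [hA]
        ring
      · have h1 := hf t (Ioc_subset_Icc_self ht) x (Ioo_subset_Icc_self hx)
        have hx0 : 0 < x := by linarith [hx.1]
        have h2 : N / x * (x - c) ≤ N / 2 := by
          rw [div_mul_eq_mul_div, div_le_div_iff₀ hx0 two_pos]
          have : (x - c) * 2 ≤ x := by linarith [hx.2]
          nlinarith
        have h3 : 0 ≤ m * (H * (x - c) ^ 2) := by positivity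
        have h4 : 0 ≤ m * (l * (t - t₀)) := by positivity
        have h5 : l = d * H * (2 + N) := by simp only [hl, hHd]; ring
        have h6 : A * (d * H * (2 * (N / x * (x - c)))) ≤ A * (d * H * N) := by
          gcongr; linarith
        have h7 : d * (A * (-(H * 2)) + N / x * (A * (-(H * (2 * (x - c)))))) =
          - (A * (d * H * 2)) - A * (d * H * (2 * (N / x * (x - c)))) := by ring
        have h8 : A * l = A * (d * H * 2) + A * (d * H * N) := by rw [h5]; ring
        rw [h7]
        linarith
  have e : H * (7 * b / 8 - c) ^ 2 = 1 / 4 := by simp only [hHd, hcd]; field_simp; ring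
  rw [e] at key
  have hs0 : 0 ≤ t₂ - t₀ := by linarith
  have hA0 : 0 ≤ K + m * (t₂ - t₀) := by positivity
  refine le_of_forall_pos_le_add fun η hη => ?_
  have := key (η / (1 + (t₂ - t₀))) (by positivity)
  rw [div_mul_cancel₀ _ (by positivity)] at this
  have h2 : (K + m * (t₂ - t₀)) * (1 / 2) ≤ (K + m * (t₂ - t₀)) * (1 - 1 / 4 - l * (t₂ - t₀)) :=
    mul_le_mul_of_nonneg_left (by linarith) hA0
  linarith

end

section
open Topology

theorem aux_theta {A k x₀ α : ℝ} (hA : 0 < A) (hk : 0 ≤ k) (y : ℝ) :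
    HasDerivAt (fun y : ℝ => (A + k * (y - x₀) ^ 2) ^ (-α))
      (-α * (A + k * (y - x₀) ^ 2) ^ (-α - 1) * (2 * k * (y - x₀))) y ∧
    HasDerivAt (fun y : ℝ => -α * (A + k * (y - x₀) ^ 2) ^ (-α - 1) * (2 * k * (y - x₀)))
      (α * (α + 1) * (A + k * (y - x₀) ^ 2) ^ (-α - 2) * (2 * k * (y - x₀)) ^ 2
        - α * (A + k * (y - x₀) ^ 2) ^ (-α - 1) * (2 * k)) y := by
  have h0 : 0 < A + k * (y - x₀) ^ 2 := by positivity
  have e0 : HasDerivAt (fun y : ℝ => (y - x₀)) 1 y := (hasDerivAt_id y).sub_const x₀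
  have e1 : HasDerivAt (fun y : ℝ => (A + k * (y - x₀) ^ 2)) (2 * k * (y - x₀)) y := by
    refine (((e0.pow 2).const_mul k).const_add A).congr_deriv ?_
    simp; ring
  have e2 := e1.rpow_const (p := -α) (Or.inl h0.ne')
  have e3 := e1.rpow_const (p := -α - 1) (Or.inl h0.ne')
  refine ⟨e2.congr_deriv (by ring), ?_⟩
  refine ((e3.const_mul (-α)).mul (e0.const_mul (2 * k))).congr_deriv ?_
  rw [show -α - 1 - 1 = -α - 2 by ring]
  ring

theorem aux_theta_t {m s k x₀ α x t : ℝ} (h : 0 < m * (s - t) + k * (x - x₀) ^ 2) :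
    HasDerivAt (fun t : ℝ => (m * (s - t) + k * (x - x₀) ^ 2) ^ (-α))
      (α * m * (m * (s - t) + k * (x - x₀) ^ 2) ^ (-α - 1)) t := by
  have e0 : HasDerivAt (fun t : ℝ => m * (s - t) + k * (x - x₀) ^ 2) (-m) t := by
    refine ((((hasDerivAt_id t).const_sub s).const_mul m).add_const _).congr_deriv ?_
    ring
  refine (e0.rpow_const (p := -α) (Or.inl h.ne')).congr_deriv ?_
  ring

variable {N R p q d₁ d₂ c₁ c₂ T : ℝ} {F G u v : ℝ → ℝ → ℝ}

theorem AuxSys.transfer (S : AuxSys N R p q d₁ d₂ c₁ c₂ T F G u v) {α β : ℝ}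
    (hq : α * q = β + 1) {b : ℝ} (hb : 0 < b) (hbR : b < R) :
    ∃ τ₀ > 0, ∀ t₀ M, 0 < t₀ → t₀ < T → T - t₀ ≤ τ₀ → 0 ≤ M → M * (T - t₀) ^ (-α) ≤ u t₀ b →
      ∀ t, t₀ + (T - t₀) / 2 ≤ t → t < T →
        M / 2 * (T - t₀) ^ (-α) ≤ u t (49 * b / 64) ∧
        c₁ * (M / 2) ^ q / 4 * (T - t₀) ^ (-β) ≤ v t (49 * b / 64) := by
  set l₁ := d₁ * (2 + N) * 16 / b ^ 2
  set l₂ := d₂ * (2 + N) * 16 / (7 * b / 8) ^ 2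
  have hd₁ := S.d10
  have hd₂ := S.d20
  have hN := S.N0
  have hc₁ := S.c10
  have hq1 := S.q1
  have hl₁ : 0 < l₁ := by positivity
  have hl₂ : 0 < l₂ := by positivity
  refine ⟨1 / (4 * (l₁ + l₂)), by positivity, ?_⟩
  intro t₀ M ht₀ htT hτ hM hu t ht1 ht2
  set τ := T - t₀ with hτd
  have hτ0 : 0 < τ := by linarith
  rw [le_div_iff₀ (by positivity)] at hτ
  have hP := Real.rpow_pos_of_pos hτ0 (-α)
  have A1 : ∀ s ∈ Ico t₀ T, M / 2 * τ ^ (-α) ≤ u s (7 * b / 8) := by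
    intro s hs
    have := aux_persist hd₁ hN S.urad (b := b) (t₀ := t₀) (t₂ := s) (K := M * τ ^ (-α)) (m := 0)
      hb hbR ht₀ hs.1 hs.2 (by positivity) le_rfl
      (fun t ht x hx => S.unn t ⟨by linarith [ht.1], by linarith [ht.2, hs.2]⟩ x
        ⟨by linarith [hx.1], by linarith [hx.2]⟩) ?_ ?_ ?_
    · linarith
    · intro t ht x hx
      have ht' : t ∈ Ico 0 T := ⟨by linarith [ht.1], by linarith [ht.2, hs.2]⟩
      have hx' : x ∈ Icc 0 R := ⟨by linarith [hx.1], by linarith [hx.2]⟩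
      have h0 := S.vnn t ht' x hx'
      exact le_trans (by positivity) (S.Flow _ _ (S.unn t ht' x hx') h0)
    · intro x hx
      exact hu.trans (S.anti ⟨ht₀, htT⟩ (by linarith [hx.1]) hx.2 hbR.le)
    · have h1 : l₁ * (s - t₀) ≤ l₁ * τ := mul_le_mul_of_nonneg_left (by linarith [hs.2]) hl₁.le
      have h2 : 0 < l₂ * τ := by positivity
      show l₁ * (s - t₀) ≤ 1 / 4
      nlinarith
  have htm : t ∈ Ioo 0 T := ⟨by linarith, ht2⟩
  constructor
  · exact (A1 t ⟨by linarith, ht2⟩).trans (S.anti htm (by linarith) (by linarith) (by linarith))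
  · have hpow : (M / 2 * τ ^ (-α)) ^ q = (M / 2) ^ q * (τ ^ (-β) / τ) := by
      rw [Real.mul_rpow (by positivity) hP.le, ← Real.rpow_mul hτ0.le, ← Real.rpow_sub_one hτ0.ne']
      congr 2
      linarith
    have hPb := Real.rpow_pos_of_pos hτ0 (-β)
    have hMq : 0 ≤ (M / 2) ^ q := by positivity
    have := aux_persist hd₂ hN S.vrad (b := 7 * b / 8) (t₀ := t₀) (t₂ := t) (K := 0)
      (m := c₁ * ((M / 2) ^ q * (τ ^ (-β) / τ)))
      (by positivity) (by linarith) ht₀ (by linarith) ht2 le_rfl (by positivity)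
      (fun s hs x hx => S.vnn s ⟨by linarith [hs.1], by linarith [hs.2]⟩ x
        ⟨by linarith [hx.1], by linarith [hx.2]⟩) ?_ ?_ ?_
    · rw [show 7 * (7 * b / 8) / 8 = 49 * b / 64 by ring] at this
      refine le_trans ?_ this
      have h1 : τ / 2 ≤ t - t₀ := by linarith
      have h2 : c₁ * (M / 2) ^ q / 4 * τ ^ (-β) =
        (0 + c₁ * ((M / 2) ^ q * (τ ^ (-β) / τ)) * (τ / 2)) / 2 := by field_simp; ring
      rw [h2]
      gcongr
    · intro s hs x hx
      have hs' : s ∈ Ico 0 T := ⟨by linarith [hs.1], by linarith [hs.2]⟩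
      have hx' : x ∈ Icc 0 R := ⟨by linarith [hx.1], by linarith [hx.2]⟩
      refine le_trans ?_ (S.Glow _ _ (S.unn s hs' x hx') (S.vnn s hs' x hx'))
      rw [← hpow]
      have h1 := (A1 s ⟨hs.1, hs'.2⟩).trans (S.anti (x := x) (y := 7 * b / 8)
        ⟨by linarith [hs.1], hs'.2⟩ hx'.1 hx.2 (by linarith))
      gcongr
    · intro x hx
      exact S.vnn t₀ ⟨ht₀.le, htT⟩ x ⟨by linarith [hx.1], by linarith [hx.2]⟩
    · have h1 : l₂ * (t - t₀) ≤ l₂ * τ := mul_le_mul_of_nonneg_left (by linarith) hl₂.le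
      have h2 : 0 < l₁ * τ := by positivity
      show l₂ * (t - t₀) ≤ 1 / 4
      nlinarith

end

section
open Topology
variable {N R p q d₁ d₂ c₁ c₂ T : ℝ} {F G u v : ℝ → ℝ → ℝ}

theorem aux_theta_sub {d c₁ α m k s b t x : ℝ} (hd : 0 < d) (hN : 0 ≤ N) (hα : 0 < α) (hm : 0 < m)
    (hk : 0 < k)
    (hc : α * (m + d * k * (2 + N)) < c₁) (hx0 : 0 < x) (hx : x ≤ b) (ht : t < s)
    {z f : ℝ → ℝ → ℝ} {Ω : Set (ℝ × ℝ)} (hΩ : IsOpen Ω) (h : AuxRad d N z f Ω) (hmem : (t, x) ∈ Ω)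
    (hf : c₁ * (m * (s - t) + k * (x - 3 * b / 4) ^ 2) ^ (-α - 1) ≤ f t x)
    (w0 : deriv (fun y => (m * (s - t) + k * (y - 3 * b / 4) ^ 2) ^ (-α) - z t y) x = 0)
    (w1 : deriv (deriv (fun y => (m * (s - t) + k * (y - 3 * b / 4) ^ 2) ^ (-α) - z t y)) x ≤ 0) :
    ∃ e < 0, HasDerivAt (fun t => (m * (s - t) + k * (x - 3 * b / 4) ^ 2) ^ (-α) - z t x) e t := by
  have hA : 0 < m * (s - t) := mul_pos hm (by linarith)
  have hθ : 0 < m * (s - t) + k * (x - 3 * b / 4) ^ 2 := by positivity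
  refine aux_touch_sub hd.le hΩ h hmem
    (φ := fun t y => (m * (s - t) + k * (y - 3 * b / 4) ^ 2) ^ (-α))
    (Eventually.of_forall fun y => (aux_theta hA hk.le y).1) (aux_theta hA hk.le x).2
    (aux_theta_t hθ) w0 w1 ?_
  set θ := m * (s - t) + k * (x - 3 * b / 4) ^ 2
  have hP := Real.rpow_pos_of_pos hθ (-α - 1)
  have hP2 := Real.rpow_pos_of_pos hθ (-α - 2)
  have h2 : N / x * (x - 3 * b / 4) ≤ N / 2 := by
    rw [div_mul_eq_mul_div, div_le_div_iff₀ hx0 two_pos]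
    have : (x - 3 * b / 4) * 2 ≤ x := by linarith
    nlinarith
  have h3 : 0 ≤ d * (α * (α + 1) * θ ^ (-α - 2) * (2 * k * (x - 3 * b / 4)) ^ 2) := by positivity
  have h4 : α * (m + d * k * (2 + N)) * θ ^ (-α - 1) < c₁ * θ ^ (-α - 1) :=
    mul_lt_mul_of_pos_right hc hP
  have h5 : d * α * θ ^ (-α - 1) * 2 * k * (N / x * (x - 3 * b / 4)) ≤
    d * α * θ ^ (-α - 1) * 2 * k * (N / 2) := mul_le_mul_of_nonneg_left h2 (by positivity)
  have e : d * (α * (α + 1) * θ ^ (-α - 2) * (2 * k * (x - 3 * b / 4)) ^ 2 - α * θ ^ (-α - 1) * (2 * k) +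
    N / x * (-α * θ ^ (-α - 1) * (2 * k * (x - 3 * b / 4)))) =
    d * (α * (α + 1) * θ ^ (-α - 2) * (2 * k * (x - 3 * b / 4)) ^ 2)
     - d * α * θ ^ (-α - 1) * 2 * k - d * α * θ ^ (-α - 1) * 2 * k * (N / x * (x - 3 * b / 4)) := by ring
  have e2 : α * (m + d * k * (2 + N)) * θ ^ (-α - 1) = α * m * θ ^ (-α - 1)
    + d * α * θ ^ (-α - 1) * 2 * k + d * α * θ ^ (-α - 1) * 2 * k * (N / 2) := by ring
  show α * m * θ ^ (-α - 1) < d * (α * (α + 1) * θ ^ (-α - 2) * (2 * k * (x - 3 * b / 4)) ^ 2 - α * θ ^ (-α - 1) * (2 * k) +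
    N / x * (-α * θ ^ (-α - 1) * (2 * k * (x - 3 * b / 4)))) + f t x
  rw [e]
  linarith

theorem aux_rpow_neg_le {a b α : ℝ} (hα : 0 < α) (ha : 0 < a) (hab : a ≤ b) : b ^ (-α) ≤ a ^ (-α) :=
  Real.rpow_le_rpow_of_nonpos ha hab (by linarith)

set_option maxHeartbeats 1000000 in
theorem AuxSys.noblow (S : AuxSys N R p q d₁ d₂ c₁ c₂ T F G u v) {α β : ℝ} (hα : 0 < α) (hβ : 0 < β)
    (hp : β * p = α + 1) (hq : α * q = β + 1) {b : ℝ} (hb : 0 < b) (hbR : b < R) :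
    ∃ K > (0:ℝ), ∃ τ₀ > (0:ℝ), ∀ t₁ τ, 0 < τ → τ ≤ τ₀ → 0 < t₁ → t₁ + τ / 2 ≤ T →
      (∀ t ∈ Ico t₁ T, K * τ ^ (-α) ≤ u t b ∧ K * τ ^ (-β) ≤ v t b) → False := by
  have hd₁ := S.d10
  have hd₂ := S.d20
  have hN := S.N0
  have hc₁ := S.c10
  set m := c₁ / (4 * (α + β)) with hm
  set k := c₁ / (4 * (α + β) * ((d₁ + d₂) * (2 + N))) with hk
  have hm0 : 0 < m := by positivity
  have hk0 : 0 < k := by positivity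
  have e0 : (α + β) * (m + (d₁ + d₂) * k * (2 + N)) = c₁ / 2 := by
    simp only [hm, hk]; field_simp; ring
  have hca : α * (m + d₁ * k * (2 + N)) < c₁ := by
    have h1 : α * (m + d₁ * k * (2 + N)) ≤ (α + β) * (m + (d₁ + d₂) * k * (2 + N)) := by
      gcongr <;> linarith
    linarith
  have hcb : β * (m + d₂ * k * (2 + N)) < c₁ := by
    have h1 : β * (m + d₂ * k * (2 + N)) ≤ (α + β) * (m + (d₁ + d₂) * k * (2 + N)) := by
      gcongr <;> linarith
    linarith
  clear_value m k
  clear hm hk e0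
  have g1 : 0 < (m / 4) ^ (-α) := by positivity
  have g2 : 0 < (m / 4) ^ (-β) := by positivity
  refine ⟨1 + (m / 4) ^ (-α) + (m / 4) ^ (-β), by positivity, k * (b / 4) ^ 2, by positivity, ?_⟩
  intro t₁ τ hτ hτ2 ht₁ hT H
  set K := 1 + (m / 4) ^ (-α) + (m / 4) ^ (-β) with hK
  set s := t₁ + τ / 4 with hs
  have hsT : s < T := by linarith
  clear_value K s
  have hKa' : (m / 4) ^ (-α) < K := by rw [hK]; linarith
  have hKb' : (m / 4) ^ (-β) < K := by rw [hK]; linarith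
  have hK1' : 1 < K := by rw [hK]; linarith
  clear hK g1 g2
  set Ω : Set (ℝ × ℝ) := Ioo 0 T ×ˢ Ioo 0 R with hΩd
  have hΩ : IsOpen Ω := isOpen_Ioo.prod isOpen_Ioo
  have ua : ∀ t ∈ Ico t₁ T, ∀ x ∈ Icc 0 b, K * τ ^ (-α) ≤ u t x := fun t ht x hx =>
    (H t ht).1.trans (S.anti ⟨by linarith [ht.1], ht.2⟩ hx.1 hx.2 hbR.le)
  have va : ∀ t ∈ Ico t₁ T, ∀ x ∈ Icc 0 b, K * τ ^ (-β) ≤ v t x := fun t ht x hx =>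
    (H t ht).2.trans (S.swap.anti ⟨by linarith [ht.1], ht.2⟩ hx.1 hx.2 hbR.le)
  have ini : ∀ a : ℝ, 0 < a → (m / 4) ^ (-a) < K → ∀ x, (m * (s - t₁) + k * (x - 3 * b / 4) ^ 2) ^ (-a)
      < K * τ ^ (-a) := by
    intro a ha hKa x
    have h1 : m / 4 * τ ≤ m * (s - t₁) + k * (x - 3 * b / 4) ^ 2 := by
      have : 0 ≤ k * (x - 3 * b / 4) ^ 2 := by positivity
      have e : m * (s - t₁) = m / 4 * τ := by simp only [hs]; ring
      linarith
    have h2 := aux_rpow_neg_le ha (by positivity) h1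
    rw [Real.mul_rpow (by positivity) hτ.le] at h2
    refine h2.trans_lt ?_
    have := Real.rpow_pos_of_pos hτ (-a)
    gcongr
  have lat : ∀ a : ℝ, 0 < a → ∀ t, t < s → ∀ x, (x - 3 * b / 4) ^ 2 = (b / 4) ^ 2 →
      (m * (s - t) + k * (x - 3 * b / 4) ^ 2) ^ (-a) < K * τ ^ (-a) := by
    intro a ha t ht x hx
    have h1 : τ ≤ m * (s - t) + k * (x - 3 * b / 4) ^ 2 := by
      rw [hx]
      have : 0 < m * (s - t) := mul_pos hm0 (by linarith)
      linarith
    refine (aux_rpow_neg_le ha hτ h1).trans_lt ?_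
    have h2 := Real.rpow_pos_of_pos hτ (-a)
    have h3 : 1 < K := hK1'
    exact lt_mul_of_one_lt_left h2 h3
  have cont : ∀ a : ℝ, ∀ t₂ < s, ContinuousOn (fun p : ℝ × ℝ => (m * (s - p.1) + k * (p.2 - 3 * b / 4) ^ 2) ^ (-a))
      (Icc t₁ t₂ ×ˢ Icc (b / 2) b) := by
    intro a t₂ ht₂
    refine ContinuousOn.rpow_const (by fun_prop) ?_
    intro p hp
    left
    have : 0 < m * (s - p.1) := mul_pos hm0 (by linarith [hp.1.2])
    positivity
  have main : ∀ t₂, t₁ ≤ t₂ → t₂ < s → (m * (s - t₂)) ^ (-α) < u t₂ (3 * b / 4) := by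
    intro t₂ ht12 ht2
    have hsub : Icc t₁ t₂ ×ˢ Icc (b / 2) b ⊆ Ω := by
      rintro ⟨t, x⟩ ⟨⟨a1, a2⟩, ⟨a3, a4⟩⟩
      simp only at a1 a2 a3 a4
      exact ⟨⟨by simp only; linarith, by simp only; linarith⟩, ⟨by simp only; linarith, by simp only; linarith⟩⟩
    have L1 : (b / 2 - 3 * b / 4) ^ 2 = (b / 4) ^ 2 := by ring
    have L2 : (b - 3 * b / 4) ^ 2 = (b / 4) ^ 2 := by ring
    have := (aux_mp_sys (t₁ := t₁) (t₂ := t₂) (a := b / 2) (b := b)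
      (fun t x => (m * (s - t) + k * (x - 3 * b / 4) ^ 2) ^ (-α) - u t x)
      (fun t x => (m * (s - t) + k * (x - 3 * b / 4) ^ 2) ^ (-β) - v t x)
      ?_ ?_ ?_ ?_ ?_ ?_ t₂ ⟨ht12, le_rfl⟩ (3 * b / 4) ⟨by linarith, by linarith⟩).1
    · simp only [sub_self] at this
      rw [show m * (s - t₂) + k * (0:ℝ) ^ 2 = m * (s - t₂) by ring] at this
      linarith
    · exact (cont α t₂ ht2).sub (S.urad.cont.mono hsub)
    · exact (cont β t₂ ht2).sub (S.vrad.cont.mono hsub)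
    · intro x hx
      have h1 := ini α hα hKa' x
      have h2 := ini β hβ hKb' x
      have h3 := ua t₁ ⟨le_rfl, by linarith⟩ x ⟨by linarith [hx.1], hx.2⟩
      have h4 := va t₁ ⟨le_rfl, by linarith⟩ x ⟨by linarith [hx.1], hx.2⟩
      constructor <;> linarith
    · intro t ht
      have ht' : t ∈ Ico t₁ T := ⟨ht.1, by linarith [ht.2]⟩
      have hts : t < s := by linarith [ht.2]
      refine ⟨⟨?_, ?_⟩, ⟨?_, ?_⟩⟩
      · linarith [lat α hα t hts _ L1, ua t ht' (b / 2) ⟨by linarith, by linarith⟩]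
      · linarith [lat β hβ t hts _ L1, va t ht' (b / 2) ⟨by linarith, by linarith⟩]
      · linarith [lat α hα t hts _ L2, ua t ht' b ⟨by linarith, by linarith⟩]
      · linarith [lat β hβ t hts _ L2, va t ht' b ⟨by linarith, by linarith⟩]
    · intro t ht x hx z1 z2 w0 w1
      have hts : t < s := by linarith [ht.2]
      have hθ : 0 < m * (s - t) + k * (x - 3 * b / 4) ^ 2 := by
        have : 0 < m * (s - t) := mul_pos hm0 (by linarith)
        positivity
      have htI : t ∈ Ico 0 T := ⟨by linarith [ht.1], by linarith⟩
      have hxI : x ∈ Icc 0 R := ⟨by linarith [hx.1], by linarith [hx.2]⟩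
      refine aux_theta_sub hd₁ hN hα hm0 hk0 hca (by linarith [hx.1]) hx.2.le hts hΩ S.urad
        (hsub ⟨Ioc_subset_Icc_self ht, Ioo_subset_Icc_self hx⟩) ?_ w0 w1
      refine le_trans ?_ (S.Flow _ _ (S.unn t htI x hxI) (S.vnn t htI x hxI))
      rw [show -α - 1 = -β * p by linarith, Real.rpow_mul hθ.le]
      have hp1 := S.p1
      have := Real.rpow_pos_of_pos hθ (-β)
      gcongr
      linarith
    · intro t ht x hx z1 z2 w0 w1
      have hts : t < s := by linarith [ht.2]
      have hθ : 0 < m * (s - t) + k * (x - 3 * b / 4) ^ 2 := by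
        have : 0 < m * (s - t) := mul_pos hm0 (by linarith)
        positivity
      have htI : t ∈ Ico 0 T := ⟨by linarith [ht.1], by linarith⟩
      have hxI : x ∈ Icc 0 R := ⟨by linarith [hx.1], by linarith [hx.2]⟩
      refine aux_theta_sub hd₂ hN hβ hm0 hk0 hcb (by linarith [hx.1]) hx.2.le hts hΩ S.vrad
        (hsub ⟨Ioc_subset_Icc_self ht, Ioo_subset_Icc_self hx⟩) ?_ w0 w1
      refine le_trans ?_ (S.Glow _ _ (S.unn t htI x hxI) (S.vnn t htI x hxI))
      rw [show -β - 1 = -α * q by linarith, Real.rpow_mul hθ.le]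
      have hq1 := S.q1
      have := Real.rpow_pos_of_pos hθ (-α)
      gcongr
      linarith
  -- contradiction
  have hcs : ContinuousAt (fun t => u t (3 * b / 4)) s :=
    (S.urad.dt s (3 * b / 4) ⟨⟨by linarith, hsT⟩, ⟨by linarith, by linarith⟩⟩).continuousAt
  have ht : Tendsto (fun t => (m * (s - t)) ^ (-α)) (𝓝[<] s) atTop := by
    have h1 : Tendsto (fun t => m * (s - t)) (𝓝[<] s) (𝓝[>] 0) := by
      refine tendsto_nhdsWithin_iff.2 ⟨?_, ?_⟩
      · have : Continuous (fun t => m * (s - t)) := by fun_prop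
        have h := this.tendsto s
        simp only [sub_self, mul_zero] at h
        exact h.mono_left nhdsWithin_le_nhds
      · filter_upwards [self_mem_nhdsWithin] with t ht
        exact mul_pos hm0 (by simpa using ht)
    exact (tendsto_rpow_neg_nhdsGT_zero (by linarith)).comp h1
  have hle : ∀ᶠ t in 𝓝[<] s, (m * (s - t)) ^ (-α) ≤ u s (3 * b / 4) + 1 := by
    have h1 : ∀ᶠ t in 𝓝[<] s, u t (3 * b / 4) < u s (3 * b / 4) + 1 :=
      (hcs.mono_left nhdsWithin_le_nhds).eventually (gt_mem_nhds (by linarith))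
    filter_upwards [h1, self_mem_nhdsWithin, Ioo_mem_nhdsLT (show t₁ < s by linarith)] with t a1 a2 a3
    exact ((main t a3.1.le a3.2).trans a1).le
  have hge := ht.eventually_gt_atTop (u s (3 * b / 4) + 1)
  obtain ⟨t, h1, h2⟩ := (hle.and hge).exists
  linarith

end

section
open Topology
variable {N R p q d₁ d₂ c₁ c₂ T : ℝ} {F G u v : ℝ → ℝ → ℝ}

theorem AuxSys.upper1 (S : AuxSys N R p q d₁ d₂ c₁ c₂ T F G u v) {α β : ℝ} (hα : 0 < α) (hβ : 0 < β)
    (hp : β * p = α + 1) (hq : α * q = β + 1) {b : ℝ} (hb : 0 < b) (hbR : b < R) :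
    ∃ C > (0:ℝ), ∃ τ₀ > (0:ℝ), ∀ t₀, 0 < t₀ → t₀ < T → T - t₀ ≤ τ₀ →
      u t₀ b < C * (T - t₀) ^ (-α) := by
  obtain ⟨τ₁, hτ₁, H1⟩ := S.transfer hq hb hbR
  obtain ⟨K, hK, τ₂, hτ₂, H2⟩ := S.noblow hα hβ hp hq (b := 49 * b / 64) (by linarith) (by linarith)
  have hc₁ := S.c10
  set y := 1 + K + 4 * K / c₁ with hy
  have hy1 : 1 ≤ y := by
    have : 0 < 4 * K / c₁ := by positivity
    linarith
  have hyK : K ≤ y := by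
    have : 0 < 4 * K / c₁ := by positivity
    linarith
  have hyq : K ≤ c₁ * y ^ q / 4 := by
    have h1 : y ^ (1:ℝ) ≤ y ^ q := Real.rpow_le_rpow_of_exponent_le hy1 S.q1.le
    rw [Real.rpow_one] at h1
    have h2 : 4 * K / c₁ ≤ y ^ q := by linarith
    rw [div_le_iff₀ hc₁] at h2
    linarith
  refine ⟨2 * y, by linarith, min τ₁ τ₂, lt_min hτ₁ hτ₂, ?_⟩
  intro t₀ h0 hT hτ
  by_contra! hcon
  have hτ0 : 0 < T - t₀ := by linarith
  have H := H1 t₀ (2 * y) h0 hT (hτ.trans (min_le_left _ _)) (by linarith) hcon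
  refine H2 (t₀ + (T - t₀) / 2) (T - t₀) hτ0 (hτ.trans (min_le_right _ _)) (by linarith)
    (by linarith) ?_
  intro t ht
  obtain ⟨a1, a2⟩ := H t ht.1 ht.2
  rw [show 2 * y / 2 = y by ring] at a1 a2
  have e1 := Real.rpow_pos_of_pos hτ0 (-α)
  have e2 := Real.rpow_pos_of_pos hτ0 (-β)
  exact ⟨le_trans (by gcongr) a1, le_trans (by gcongr) a2⟩

theorem AuxSys.upper (S : AuxSys N R p q d₁ d₂ c₁ c₂ T F G u v) {α β : ℝ} (hα : 0 < α) (hβ : 0 < β)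
    (hp : β * p = α + 1) (hq : α * q = β + 1) {b : ℝ} (hb : 0 < b) (hbR : b < R) :
    ∃ C > (0:ℝ), ∃ τ₀ > (0:ℝ), ∀ t, 0 < t → t < T → T - t ≤ τ₀ → ∀ x ∈ Icc b R,
      u t x < C * (T - t) ^ (-α) ∧ v t x < C * (T - t) ^ (-β) := by
  obtain ⟨C1, hC1, τ1, hτ1, H1⟩ := S.upper1 hα hβ hp hq hb hbR
  obtain ⟨C2, hC2, τ2, hτ2, H2⟩ := S.swap.upper1 hβ hα hq hp hb hbR
  refine ⟨max C1 C2, lt_max_of_lt_left hC1, min τ1 τ2, lt_min hτ1 hτ2, ?_⟩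
  intro t h0 hT hτ x hx
  have hτ0 : 0 < T - t := by linarith
  have e1 := Real.rpow_pos_of_pos hτ0 (-α)
  have e2 := Real.rpow_pos_of_pos hτ0 (-β)
  have a1 := H1 t h0 hT (hτ.trans (min_le_left _ _))
  have a2 := H2 t h0 hT (hτ.trans (min_le_right _ _))
  have b1 : u t x ≤ u t b := S.anti ⟨h0, hT⟩ hb.le hx.1 hx.2
  have b2 : v t x ≤ v t b := S.swap.anti ⟨h0, hT⟩ hb.le hx.1 hx.2
  constructor
  · refine b1.trans_lt (a1.trans_le ?_)
    gcongr; exact le_max_left _ _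
  · refine b2.trans_lt (a2.trans_le ?_)
    gcongr; exact le_max_right _ _

/-- supersolution based on theta -/
theorem aux_theta_sup {d c₂ α m k s x₀ t x : ℝ} (hd : 0 < d) (hN : 0 ≤ N) (hα : 0 < α) (hm : 0 < m)
    (hk : 0 < k) (hk1 : k ≤ 1) (hc : 3 * c₂ + 4 * d * α * (α + 1) < α * m) (hc₂ : 0 < c₂)
    (hx0 : 0 < x) (hx : x₀ ≤ x) (ht : t < s)
    {z f : ℝ → ℝ → ℝ} {Ω : Set (ℝ × ℝ)} (hΩ : IsOpen Ω) (h : AuxRad d N z f Ω) (hmem : (t, x) ∈ Ω)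
    (hf : f t x ≤ 3 * c₂ * (m * (s - t) + k * (x - x₀) ^ 2) ^ (-α - 1))
    (w0 : deriv (fun y => z t y - (m * (s - t) + k * (y - x₀) ^ 2) ^ (-α)) x = 0)
    (w1 : deriv (deriv (fun y => z t y - (m * (s - t) + k * (y - x₀) ^ 2) ^ (-α))) x ≤ 0) :
    ∃ e < 0, HasDerivAt (fun t => z t x - (m * (s - t) + k * (x - x₀) ^ 2) ^ (-α)) e t := by
  have hA : 0 < m * (s - t) := mul_pos hm (by linarith)
  have hθ : 0 < m * (s - t) + k * (x - x₀) ^ 2 := by positivity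
  refine aux_touch_sup hd.le hΩ h hmem
    (φ := fun t y => (m * (s - t) + k * (y - x₀) ^ 2) ^ (-α))
    (Eventually.of_forall fun y => (aux_theta hA hk.le y).1) (aux_theta hA hk.le x).2
    (aux_theta_t hθ) w0 w1 ?_
  have hB : k * (x - x₀) ^ 2 ≤ m * (s - t) + k * (x - x₀) ^ 2 := by linarith
  set θ := m * (s - t) + k * (x - x₀) ^ 2
  have hP := Real.rpow_pos_of_pos hθ (-α - 1)
  have hP2 := Real.rpow_pos_of_pos hθ (-α - 2)
  have e1 : θ ^ (-α - 2) * θ = θ ^ (-α - 1) := by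
    rw [← Real.rpow_add_one hθ.ne']; congr 1; ring
  have h2 : 0 ≤ d * (N / x * (α * θ ^ (-α - 1) * (2 * k * (x - x₀)))) := by
    have : 0 ≤ x - x₀ := by linarith
    positivity
  have h3 : d * (α * (α + 1) * θ ^ (-α - 2) * (2 * k * (x - x₀)) ^ 2) ≤
      4 * d * α * (α + 1) * θ ^ (-α - 1) := by
    have i1 : θ ^ (-α - 2) * (k * (k * (x - x₀) ^ 2)) ≤ θ ^ (-α - 2) * (1 * θ) := by
      gcongr
    rw [one_mul, e1] at i1
    have i2 := mul_le_mul_of_nonneg_left i1 (show 0 ≤ 4 * d * α * (α + 1) by positivity)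
    calc _ = 4 * d * α * (α + 1) * (θ ^ (-α - 2) * (k * (k * (x - x₀) ^ 2))) := by ring
      _ ≤ _ := i2
  have h4 := mul_lt_mul_of_pos_right hc hP
  have h5 : 0 ≤ d * (α * θ ^ (-α - 1) * (2 * k)) := by positivity
  show d * (α * (α + 1) * θ ^ (-α - 2) * (2 * k * (x - x₀)) ^ 2 - α * θ ^ (-α - 1) * (2 * k) +
    N / x * (-α * θ ^ (-α - 1) * (2 * k * (x - x₀)))) + f t x < α * m * θ ^ (-α - 1)
  have e : d * (α * (α + 1) * θ ^ (-α - 2) * (2 * k * (x - x₀)) ^ 2 - α * θ ^ (-α - 1) * (2 * k) +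
    N / x * (-α * θ ^ (-α - 1) * (2 * k * (x - x₀)))) =
    d * (α * (α + 1) * θ ^ (-α - 2) * (2 * k * (x - x₀)) ^ 2)
    - d * (α * θ ^ (-α - 1) * (2 * k)) - d * (N / x * (α * θ ^ (-α - 1) * (2 * k * (x - x₀)))) := by ring
  rw [e]
  linarith

end

section
open Topology
variable {N R p q d₁ d₂ c₁ c₂ T : ℝ} {F G u v : ℝ → ℝ → ℝ}

theorem AuxSys.Fbound (S : AuxSys N R p q d₁ d₂ c₁ c₂ T F G u v) {α β : ℝ} (hα : 0 < α)
    (hp : β * p = α + 1) (hr : α * (p * (q + 1) / (p + 1)) = α + 1) {a b θ : ℝ} (ha : 0 ≤ a)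
    (hb : 0 ≤ b) (hθ : 0 < θ) (hθ1 : θ ≤ 1) (hau : a ≤ θ ^ (-α)) (hbu : b ≤ θ ^ (-β)) :
    F a b ≤ 3 * c₂ * θ ^ (-α - 1) := by
  have hp1 := S.p1
  have hq1 := S.q1
  have hc2 := S.c20
  have h1 : b ^ p ≤ θ ^ (-α - 1) := by
    rw [show -α - 1 = -β * p by linarith, Real.rpow_mul hθ.le]
    gcongr
  have h2 : a ^ (p * (q + 1) / (p + 1)) ≤ θ ^ (-α - 1) := by
    rw [show -α - 1 = -α * (p * (q + 1) / (p + 1)) by linarith, Real.rpow_mul hθ.le]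
    gcongr
  have h3 : 1 ≤ θ ^ (-α - 1) := Real.one_le_rpow_of_pos_of_le_one_of_nonpos hθ hθ1 (by linarith)
  refine (S.Fup a b ha hb).trans ?_
  calc c₂ * (b ^ p + a ^ (p * (q + 1) / (p + 1)) + 1)
      ≤ c₂ * (θ ^ (-α - 1) + θ ^ (-α - 1) + θ ^ (-α - 1)) := by gcongr
    _ = _ := by ring

set_option maxHeartbeats 1000000 in
theorem AuxSys.step2 (S : AuxSys N R p q d₁ d₂ c₁ c₂ T F G u v) {α β : ℝ} (hα : 0 < α) (hβ : 0 < β)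
    (hp : β * p = α + 1) (hq : α * q = β + 1) (hr : α * (p * (q + 1) / (p + 1)) = α + 1)
    (hs : β * (q * (p + 1) / (q + 1)) = β + 1) {ξ ρ₀ : ℝ} (hξ : 0 < ξ) (hξρ : ξ < ρ₀) (hρR : ρ₀ < R) :
    ∃ η₀ > (0:ℝ), ∃ τ₀ > (0:ℝ), ∀ t₀ η, 0 < t₀ → t₀ < T → T - t₀ ≤ τ₀ → 0 < η → η ≤ η₀ →
      (∀ x ∈ Icc ξ R, u t₀ x < η * (T - t₀) ^ (-α) ∧ v t₀ x < η * (T - t₀) ^ (-β)) →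
      (∀ t ∈ Ico t₀ T, u t ξ < 2 * η * (T - t) ^ (-α) ∧ v t ξ < 2 * η * (T - t) ^ (-β)) →
      ∃ M, ∀ t ∈ Ico t₀ T, u t ρ₀ + v t ρ₀ ≤ M := by
  have hd₁ := S.d10
  have hd₂ := S.d20
  have hN := S.N0
  have hc₂ := S.c20
  have hR := S.R0
  set κ := 1 + (3 * c₂ + 4 * d₁ * α * (α + 1)) / α + (3 * c₂ + 4 * d₂ * β * (β + 1)) / β with hκ
  have k1 : 0 < (3 * c₂ + 4 * d₁ * α * (α + 1)) / α := by positivity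
  have k2 : 0 < (3 * c₂ + 4 * d₂ * β * (β + 1)) / β := by positivity
  have hκ0 : 0 < κ := by positivity
  have hκa : 3 * c₂ + 4 * d₁ * α * (α + 1) < α * κ := by
    have : (3 * c₂ + 4 * d₁ * α * (α + 1)) / α < κ := by linarith
    rw [div_lt_iff₀ hα] at this; linarith
  have hκb : 3 * c₂ + 4 * d₂ * β * (β + 1) < β * κ := by
    have : (3 * c₂ + 4 * d₂ * β * (β + 1)) / β < κ := by linarith
    rw [div_lt_iff₀ hβ] at this; linarith
  clear_value κ
  have g1 : 0 < (2 * κ) ^ (-α) := by positivity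
  have g2 : 0 < (2 * κ) ^ (-β) := by positivity
  refine ⟨min ((2 * κ) ^ (-α)) ((2 * κ) ^ (-β)) / 2, by positivity,
    min (R ^ 2 / κ) (1 / (2 * κ)), by positivity, ?_⟩
  intro t₀ η ht₀ hT hτ hη hη₀ Hi Hl
  set τ := T - t₀ with hτd
  have hτ0 : 0 < τ := by linarith
  have hηa : 2 * η ≤ (2 * κ) ^ (-α) := by
    have := min_le_left ((2 * κ) ^ (-α)) ((2 * κ) ^ (-β)); linarith
  have hηb : 2 * η ≤ (2 * κ) ^ (-β) := by
    have := min_le_right ((2 * κ) ^ (-α)) ((2 * κ) ^ (-β)); linarith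
  have hτa : κ * τ ≤ R ^ 2 := by
    have := hτ.trans (min_le_left _ _)
    rw [le_div_iff₀ hκ0] at this; linarith
  have hτb : 2 * κ * τ ≤ 1 := by
    have := hτ.trans (min_le_right _ _)
    rw [le_div_iff₀ (by positivity)] at this; linarith
  set k := κ * τ / R ^ 2 with hk
  have hk0 : 0 < k := by positivity
  have hk1 : k ≤ 1 := by rw [hk, div_le_one (by positivity)]; exact hτa
  have hkR : k * R ^ 2 = κ * τ := by rw [hk]; field_simp
  clear_value k
  set Ω : Set (ℝ × ℝ) := Ioo 0 T ×ˢ Ioo 0 R with hΩd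
  have hΩ : IsOpen Ω := isOpen_Ioo.prod isOpen_Ioo
  have θle : ∀ t ∈ Ico t₀ T, ∀ x ∈ Icc ξ R, κ * (T - t) + k * (x - ξ) ^ 2 ≤ 2 * κ * τ := by
    intro t ht x hx
    have h1 : κ * (T - t) ≤ κ * τ := by gcongr; linarith [ht.1]
    have h2 : k * (x - ξ) ^ 2 ≤ k * R ^ 2 := by
      have a1 : 0 ≤ x - ξ := by linarith [hx.1]
      have a2 : x - ξ ≤ R := by linarith [hx.2]
      gcongr
    linarith
  have θpos : ∀ t < T, ∀ x, 0 < κ * (T - t) + k * (x - ξ) ^ 2 := by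
    intro t ht x
    have : 0 < κ * (T - t) := mul_pos hκ0 (by linarith)
    positivity
  have ini : ∀ a : ℝ, 0 < a → 2 * η ≤ (2 * κ) ^ (-a) → ∀ x ∈ Icc ξ R,
      η * τ ^ (-a) < (κ * (T - t₀) + k * (x - ξ) ^ 2) ^ (-a) := by
    intro a ha h x hx
    have h1 := aux_rpow_neg_le ha (θpos t₀ hT x) (θle t₀ ⟨le_rfl, hT⟩ x hx)
    rw [Real.mul_rpow (by positivity) hτ0.le] at h1
    refine lt_of_lt_of_le ?_ h1
    have := Real.rpow_pos_of_pos hτ0 (-a)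
    have h2 : η < (2 * κ) ^ (-a) := by linarith
    gcongr
  have lat : ∀ a : ℝ, 0 < a → 2 * η ≤ (2 * κ) ^ (-a) → ∀ t < T,
      2 * η * (T - t) ^ (-a) ≤ (κ * (T - t) + k * (ξ - ξ) ^ 2) ^ (-a) := by
    intro a ha h t ht
    have h1 : (2 * κ * (T - t)) ^ (-a) ≤ (κ * (T - t) + k * (ξ - ξ) ^ 2) ^ (-a) := by
      refine aux_rpow_neg_le ha (θpos t ht ξ) ?_
      have : 0 < κ * (T - t) := mul_pos hκ0 (by linarith)
      simp only [sub_self]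
      linarith
    rw [Real.mul_rpow (by positivity) (by linarith)] at h1
    refine le_trans ?_ h1
    have := Real.rpow_pos_of_pos (show 0 < T - t by linarith) (-a)
    gcongr
  have cont : ∀ a : ℝ, ∀ t₂ < T, ContinuousOn (fun p : ℝ × ℝ => (κ * (T - p.1) + k * (p.2 - ξ) ^ 2) ^ (-a))
      (Icc t₀ t₂ ×ˢ Icc ξ R) := by
    intro a t₂ ht₂
    refine ContinuousOn.rpow_const (by fun_prop) ?_
    intro p hp
    left
    exact (θpos p.1 (by linarith [hp.1.2]) p.2).ne'
  have main : ∀ t ∈ Ico t₀ T, u t ρ₀ < (κ * (T - t) + k * (ρ₀ - ξ) ^ 2) ^ (-α) ∧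
      v t ρ₀ < (κ * (T - t) + k * (ρ₀ - ξ) ^ 2) ^ (-β) := by
    intro t₂ ht₂
    have hsub : Icc t₀ t₂ ×ˢ Icc ξ R ⊆ Ico 0 T ×ˢ Icc 0 R := by
      rintro ⟨t, x⟩ ⟨⟨a1, a2⟩, ⟨a3, a4⟩⟩
      simp only at a1 a2 a3 a4
      exact ⟨⟨by simp only; linarith, by simp only; linarith [ht₂.2]⟩, ⟨by simp only; linarith, by simp only; linarith⟩⟩
    have := (aux_mp_sys (t₁ := t₀) (t₂ := t₂) (a := ξ) (b := R)
      (fun t x => u t x - (κ * (T - t) + k * (x - ξ) ^ 2) ^ (-α))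
      (fun t x => v t x - (κ * (T - t) + k * (x - ξ) ^ 2) ^ (-β))
      ?_ ?_ ?_ ?_ ?_ ?_ t₂ ⟨ht₂.1, le_rfl⟩ ρ₀ ⟨by linarith, by linarith⟩)
    · exact ⟨by linarith [this.1], by linarith [this.2]⟩
    · exact (S.ucont.mono hsub).sub (cont α t₂ ht₂.2)
    · exact (S.vcont.mono hsub).sub (cont β t₂ ht₂.2)
    · intro x hx
      obtain ⟨a1, a2⟩ := Hi x hx
      have b1 := ini α hα hηa x hx
      have b2 := ini β hβ hηb x hx
      constructor <;> linarith
    · intro t ht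
      have htT : t < T := by linarith [ht.2, ht₂.2]
      obtain ⟨a1, a2⟩ := Hl t ⟨ht.1, htT⟩
      have b1 := lat α hα hηa t htT
      have b2 := lat β hβ hηb t htT
      have e1 := S.ubc t ⟨by linarith [ht.1], htT⟩
      have e2 := S.vbc t ⟨by linarith [ht.1], htT⟩
      have f1 := Real.rpow_pos_of_pos (θpos t htT R) (-α)
      have f2 := Real.rpow_pos_of_pos (θpos t htT R) (-β)
      refine ⟨⟨?_, ?_⟩, ⟨?_, ?_⟩⟩ <;> linarith
    · intro t ht x hx z1 z2 w0 w1
      have htT : t < T := by linarith [ht.2, ht₂.2]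
      have htI : t ∈ Ico 0 T := ⟨by linarith [ht.1], htT⟩
      have hxI : x ∈ Icc 0 R := ⟨by linarith [hx.1], by linarith [hx.2]⟩
      refine aux_theta_sup hd₁ hN hα hκ0 hk0 hk1 hκa hc₂ (by linarith [hx.1]) hx.1.le htT hΩ S.urad
        ⟨⟨by simp only; linarith [ht.1], htT⟩, ⟨by simp only; linarith [hx.1], hx.2⟩⟩ ?_ w0 w1
      exact S.Fbound hα hp hr (S.unn t htI x hxI) (S.vnn t htI x hxI) (θpos t htT x)
        ((θle t ⟨ht.1.le, htT⟩ x (Ioo_subset_Icc_self hx)).trans hτb) (by linarith) (by linarith)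
    · intro t ht x hx z1 z2 w0 w1
      have htT : t < T := by linarith [ht.2, ht₂.2]
      have htI : t ∈ Ico 0 T := ⟨by linarith [ht.1], htT⟩
      have hxI : x ∈ Icc 0 R := ⟨by linarith [hx.1], by linarith [hx.2]⟩
      refine aux_theta_sup hd₂ hN hβ hκ0 hk0 hk1 hκb hc₂ (by linarith [hx.1]) hx.1.le htT hΩ S.vrad
        ⟨⟨by simp only; linarith [ht.1], htT⟩, ⟨by simp only; linarith [hx.1], hx.2⟩⟩ ?_ w0 w1
      exact S.swap.Fbound hβ hq hs (S.vnn t htI x hxI) (S.unn t htI x hxI) (θpos t htT x)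
        ((θle t ⟨ht.1.le, htT⟩ x (Ioo_subset_Icc_self hx)).trans hτb) (by linarith) (by linarith)
  have hB : 0 < k * (ρ₀ - ξ) ^ 2 := by
    have : 0 < ρ₀ - ξ := by linarith
    positivity
  refine ⟨(k * (ρ₀ - ξ) ^ 2) ^ (-α) + (k * (ρ₀ - ξ) ^ 2) ^ (-β), ?_⟩
  intro t ht
  obtain ⟨a1, a2⟩ := main t ht
  have hh : k * (ρ₀ - ξ) ^ 2 ≤ κ * (T - t) + k * (ρ₀ - ξ) ^ 2 := by
    have : 0 < κ * (T - t) := mul_pos hκ0 (by linarith [ht.2])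
    linarith
  have b1 := aux_rpow_neg_le hα hB hh
  have b2 := aux_rpow_neg_le hβ hB hh
  linarith

end

section
open Topology
variable {N R p q d₁ d₂ c₁ c₂ T : ℝ} {F G u v : ℝ → ℝ → ℝ}

theorem aux_Z {η X C e : ℝ} (hη : 0 < η) (hX : 0 < X) (hC : η + X ≤ C) (he : 1 < e) :
    (η + X) ^ e ≤ (2 * η) ^ e + 2 * C ^ (e - 1) * X := by
  have hC0 : 0 < C := by linarith
  have h0 : 0 ≤ (2 * η) ^ e := by positivity
  have h1 : 0 ≤ 2 * C ^ (e - 1) * X := by positivity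
  rcases le_total X η with h | h
  · have : (η + X) ^ e ≤ (2 * η) ^ e := by
      apply Real.rpow_le_rpow (by positivity) (by linarith) (by linarith)
    linarith
  · have h2 : (η + X) ^ e = (η + X) ^ (e - 1) * (η + X) := by
      rw [← Real.rpow_add_one (by positivity)]; congr 1; ring
    have h3 : (η + X) ^ (e - 1) ≤ C ^ (e - 1) :=
      Real.rpow_le_rpow (by positivity) hC (by linarith)
    have h4 : (η + X) ^ (e - 1) * (η + X) ≤ C ^ (e - 1) * (2 * X) := by
      gcongr; linarith
    rw [h2]; linarith

theorem aux_expineq {K B z a : ℝ} (hB : 0 < B) (h : B * Real.exp (2 * K) < a) :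
    (K + z / 2) * (B * Real.exp (-z)) < a := by
  have e1 : Real.exp (-z) = Real.exp (2 * K) * Real.exp (-(z + 2 * K)) := by
    rw [← Real.exp_add]; congr 1; ring
  have h1 : (z + 2 * K) * Real.exp (-(z + 2 * K)) ≤ 1 := by
    have := Real.add_one_le_exp (z + 2 * K)
    rw [Real.exp_neg, ← div_eq_mul_inv, div_le_one (Real.exp_pos _)]
    linarith
  have h2 : 0 < B * Real.exp (2 * K) := by positivity
  calc (K + z / 2) * (B * Real.exp (-z))
      = (B * Real.exp (2 * K)) * (((z + 2 * K) * Real.exp (-(z + 2 * K))) / 2) := by rw [e1]; ring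
    _ ≤ (B * Real.exp (2 * K)) * (1 / 2) := by gcongr
    _ < a := by linarith

theorem aux_exp_sup {d α η B K2 ξ t x : ℝ} (hd : 0 < d) (hN : 0 ≤ N) (hα : 0 < α)
    (hB : 0 < B) (hBs : B * Real.exp (2 * (d + K2)) < α * η / 2)
    (hx0 : 0 < x) (ht : t < T)
    {z f : ℝ → ℝ → ℝ} {Ω : Set (ℝ × ℝ)} (hΩ : IsOpen Ω) (h : AuxRad d N z f Ω) (hmem : (t, x) ∈ Ω)
    (hf : f t x ≤ (T - t) ^ (-α - 1) *
      (α * η / 2 + K2 * (B * Real.exp (-((x - ξ) / √(T - t))))))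
    (w0 : deriv (fun y => z t y - (T - t) ^ (-α) *
      (η + B * Real.exp (-((y - ξ) / √(T - t))))) x = 0)
    (w1 : deriv (deriv (fun y => z t y - (T - t) ^ (-α) *
      (η + B * Real.exp (-((y - ξ) / √(T - t)))))) x ≤ 0) :
    ∃ e < 0, HasDerivAt (fun t => z t x - (T - t) ^ (-α) *
      (η + B * Real.exp (-((x - ξ) / √(T - t))))) e t := by
  have hs : 0 < T - t := by linarith
  have hσ : 0 < √(T - t) := Real.sqrt_pos.2 hs
  have hσ2 : √(T - t) ^ 2 = T - t := Real.sq_sqrt hs.le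
  have hP := Real.rpow_pos_of_pos hs (-α)
  have hP1 := Real.rpow_pos_of_pos hs (-α - 1)
  have ePP : (T - t) ^ (-α) = (T - t) ^ (-α - 1) * (T - t) := by
    rw [← Real.rpow_add_one hs.ne']; congr 1; ring
  have hE : ∀ y, HasDerivAt (fun y : ℝ => B * Real.exp (-((y - ξ) / √(T - t))))
      (-(B * Real.exp (-((y - ξ) / √(T - t))) / √(T - t))) y := by
    intro y
    have e0 : HasDerivAt (fun y : ℝ => -((y - ξ) / √(T - t))) (-(1 / √(T - t))) y :=
      (((hasDerivAt_id y).sub_const ξ).div_const _).neg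
    refine ((e0.exp).const_mul B).congr_deriv ?_
    ring
  have hEt : HasDerivAt (fun t : ℝ => B * Real.exp (-((x - ξ) / √(T - t))))
      (-(B * Real.exp (-((x - ξ) / √(T - t))) * ((x - ξ) / √(T - t)) / (2 * (T - t)))) t := by
    have e0 : HasDerivAt (fun t : ℝ => T - t) (-1) t := by
      simpa using (hasDerivAt_id t).const_sub T
    have e1 := e0.sqrt hs.ne'
    have e2 := (((hasDerivAt_const t (x - ξ)).div e1 hσ.ne').neg.exp).const_mul B
    refine e2.congr_deriv ?_
    simp only [Pi.div_apply, Pi.neg_apply]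
    rw [hσ2]
    field_simp
    ring
  have hPt : HasDerivAt (fun t : ℝ => (T - t) ^ (-α)) (α * (T - t) ^ (-α - 1)) t := by
    have e0 : HasDerivAt (fun t : ℝ => T - t) (-1) t := by
      simpa using (hasDerivAt_id t).const_sub T
    refine (e0.rpow_const (p := -α) (Or.inl hs.ne')).congr_deriv ?_
    ring
  refine aux_touch_sup hd.le hΩ h hmem
    (φ := fun t y => (T - t) ^ (-α) * (η + B * Real.exp (-((y - ξ) / √(T - t)))))
    (φ1 := fun y => (T - t) ^ (-α) * (-(B * Real.exp (-((y - ξ) / √(T - t))) / √(T - t))))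
    (φ2 := (T - t) ^ (-α) * (-(-(B * Real.exp (-((x - ξ) / √(T - t))) / √(T - t)) / √(T - t))))
    (Eventually.of_forall fun y => ((hE y).const_add η).const_mul _)
    (((hE x).div_const _).neg.const_mul _)
    (hPt.mul (hEt.const_add η)) w0 w1 ?_
  have hk := aux_expineq (z := (x - ξ) / √(T - t)) hB hBs
  set Z := (x - ξ) / √(T - t) with hZ
  set X := B * Real.exp (-Z) with hX
  have hX0 : 0 < X := by positivity
  clear_value X Z
  have h1 : (T - t) ^ (-α) * (-(-(X / √(T - t)) / √(T - t))) = (T - t) ^ (-α - 1) * X := by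
    rw [ePP]
    have : X / √(T - t) / √(T - t) = X / (T - t) := by rw [div_div, ← sq, hσ2]
    rw [neg_div, neg_neg, this]
    field_simp
  have h2 : 0 ≤ d * (N / x * ((T - t) ^ (-α) * (X / √(T - t)))) := by positivity
  have h3 : (T - t) ^ (-α) * (-(X * Z / (2 * (T - t)))) = (T - t) ^ (-α - 1) * (-(X * Z / 2)) := by
    rw [ePP]; field_simp
  rw [h1, h3]
  have h4 : (T - t) ^ (-α - 1) * ((d + K2 + Z / 2) * X) < (T - t) ^ (-α - 1) * (α * η / 2) :=
    mul_lt_mul_of_pos_left hk hP1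
  have h5 : 0 < (T - t) ^ (-α - 1) * (α * X) := by positivity
  have e6 : d * ((T - t) ^ (-α - 1) * X + N / x * ((T - t) ^ (-α) * (-(X / √(T - t))))) =
    (T - t) ^ (-α - 1) * (d * X) - d * (N / x * ((T - t) ^ (-α) * (X / √(T - t)))) := by ring
  rw [e6]
  nlinarith

theorem AuxSys.Fbound1 (S : AuxSys N R p q d₁ d₂ c₁ c₂ T F G u v) {α β : ℝ} (hα : 0 < α)
    (hr1 : 1 < p * (q + 1) / (p + 1))
    (hp : β * p = α + 1) (hr : α * (p * (q + 1) / (p + 1)) = α + 1) {a b s η X C : ℝ} (ha : 0 ≤ a)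
    (hb : 0 ≤ b) (hs : 0 < s) (hη : 0 < η) (hX : 0 < X) (hC : η + X ≤ C)
    (hη1 : c₂ * ((2 * η) ^ p + (2 * η) ^ (p * (q + 1) / (p + 1))) ≤ α * η / 4)
    (hs1 : c₂ * s ^ (α + 1) ≤ α * η / 4)
    (hau : a ≤ s ^ (-α) * (η + X)) (hbu : b ≤ s ^ (-β) * (η + X)) :
    F a b ≤ s ^ (-α - 1) *
      (α * η / 2 + (2 * c₂ * (C ^ (p - 1) + C ^ (p * (q + 1) / (p + 1) - 1))) * X) := by
  have hp1 := S.p1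
  have hq1 := S.q1
  have hc2 := S.c20
  set r := p * (q + 1) / (p + 1)
  have hP := Real.rpow_pos_of_pos hs (-α - 1)
  have h1 : b ^ p ≤ s ^ (-α - 1) * (η + X) ^ p := by
    rw [show -α - 1 = -β * p by linarith, Real.rpow_mul hs.le, ← Real.mul_rpow (by positivity) (by positivity)]
    gcongr
  have h2 : a ^ r ≤ s ^ (-α - 1) * (η + X) ^ r := by
    rw [show -α - 1 = -α * r by linarith, Real.rpow_mul hs.le, ← Real.mul_rpow (by positivity) (by positivity)]
    gcongr
  have h3 : 1 = s ^ (-α - 1) * s ^ (α + 1) := by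
    rw [← Real.rpow_add hs, show -α - 1 + (α + 1) = 0 by ring, Real.rpow_zero]
  have z1 := aux_Z hη hX hC hp1
  have z2 := aux_Z hη hX hC hr1
  refine (S.Fup a b ha hb).trans ?_
  calc c₂ * (b ^ p + a ^ r + 1)
      ≤ c₂ * (s ^ (-α - 1) * (η + X) ^ p + s ^ (-α - 1) * (η + X) ^ r + s ^ (-α - 1) * s ^ (α + 1)) := by
        rw [← h3]; gcongr
    _ = s ^ (-α - 1) * (c₂ * (η + X) ^ p + c₂ * (η + X) ^ r + c₂ * s ^ (α + 1)) := by ring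
    _ ≤ s ^ (-α - 1) * (c₂ * ((2 * η) ^ p + 2 * C ^ (p - 1) * X)
        + c₂ * ((2 * η) ^ r + 2 * C ^ (r - 1) * X) + α * η / 4) := by gcongr
    _ = s ^ (-α - 1) * (c₂ * ((2 * η) ^ p + (2 * η) ^ r) + α * η / 4
        + (2 * c₂ * (C ^ (p - 1) + C ^ (r - 1))) * X) := by ring
    _ ≤ s ^ (-α - 1) * (α * η / 4 + α * η / 4
        + (2 * c₂ * (C ^ (p - 1) + C ^ (r - 1))) * X) := by gcongr
    _ = _ := by ring

end

section
open Topology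
variable {N R p q d₁ d₂ c₁ c₂ T : ℝ} {F G u v : ℝ → ℝ → ℝ}

theorem aux_small_pow {c a e : ℝ} (ha : 0 < a) (he : 0 < e) :
    ∀ᶠ s in 𝓝[>] (0:ℝ), c * s ^ e ≤ a := by
  have h1 : Tendsto (fun s : ℝ => c * s ^ e) (𝓝 0) (𝓝 (c * 0 ^ e)) :=
    (Real.continuousAt_rpow_const 0 e (Or.inr he.le)).tendsto.const_mul c
  rw [Real.zero_rpow he.ne', mul_zero] at h1
  filter_upwards [(h1.mono_left nhdsWithin_le_nhds).eventually (gt_mem_nhds ha)] with s hs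
  exact hs.le

theorem aux_small_exp {B C l : ℝ} (hB : 0 < B) (hl : 0 < l) :
    ∀ᶠ s in 𝓝[>] (0:ℝ), C < B * Real.exp (l / √s) := by
  have h0 : Tendsto (fun s : ℝ => √s) (𝓝[>] 0) (𝓝[>] 0) := by
    refine tendsto_nhdsWithin_iff.2 ⟨?_, ?_⟩
    · have := Real.continuous_sqrt.tendsto 0
      rw [Real.sqrt_zero] at this
      exact this.mono_left nhdsWithin_le_nhds
    · filter_upwards [self_mem_nhdsWithin] with s hs
      exact Real.sqrt_pos.2 hs
  have h1 : Tendsto (fun s : ℝ => l / √s) (𝓝[>] 0) atTop := by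
    simp only [div_eq_mul_inv]
    exact (tendsto_inv_nhdsGT_zero.comp h0).const_mul_atTop hl
  have h2 := (Real.tendsto_exp_atTop.comp h1).const_mul_atTop hB
  exact h2.eventually_gt_atTop C

theorem aux_r1 {w P η B : ℝ} (h : w - P * (η + B) < 0) (hP : 0 < P) (hB : B ≤ η) : w < 2 * η * P := by
  nlinarith

theorem aux_r2 {w P η X : ℝ} (h : w < η * P) (hP : 0 < P) (hX : 0 < X) : w - P * (η + X) < 0 := by
  nlinarith [mul_pos hP hX]

theorem aux_r3 {w P η C X : ℝ} (h : w < C * P) (hP : 0 < P) (hX : C < X) (hη : 0 < η) :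
    w - P * (η + X) < 0 := by
  nlinarith [mul_pos hP hη, mul_lt_mul_of_pos_right hX hP]

set_option maxHeartbeats 1000000 in
theorem AuxSys.step1 (S : AuxSys N R p q d₁ d₂ c₁ c₂ T F G u v) {α β : ℝ} (hα : 0 < α) (hβ : 0 < β)
    (hp : β * p = α + 1) (hq : α * q = β + 1) (hr : α * (p * (q + 1) / (p + 1)) = α + 1)
    (hs : β * (q * (p + 1) / (q + 1)) = β + 1)
    (hr1 : 1 < p * (q + 1) / (p + 1)) (hs1 : 1 < q * (p + 1) / (q + 1)) {ξ b η : ℝ} (hb : 0 < b)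
    (hbξ : b < ξ) (hξR : ξ < R) (hη : 0 < η)
    (hη1 : c₂ * ((2 * η) ^ p + (2 * η) ^ (p * (q + 1) / (p + 1))) ≤ α * η / 4)
    (hη2 : c₂ * ((2 * η) ^ q + (2 * η) ^ (q * (p + 1) / (q + 1))) ≤ β * η / 4) :
    ∃ τ₀ > (0:ℝ), ∀ t₀, 0 < t₀ → t₀ < T → T - t₀ ≤ τ₀ →
      (∀ x ∈ Icc b R, u t₀ x < η * (T - t₀) ^ (-α) ∧ v t₀ x < η * (T - t₀) ^ (-β)) →
      (∀ t ∈ Ico t₀ T, u t ξ < 2 * η * (T - t) ^ (-α) ∧ v t ξ < 2 * η * (T - t) ^ (-β)) := by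
  have hd₁ := S.d10
  have hd₂ := S.d20
  have hN := S.N0
  have hc₂ := S.c20
  have hR := S.R0
  obtain ⟨C, hC, τ₁, hτ₁, HU⟩ := S.upper hα hβ hp hq hb (hbξ.trans hξR)
  set Ka := 2 * c₂ * (C ^ (p - 1) + C ^ (p * (q + 1) / (p + 1) - 1)) with hKa
  set Kb := 2 * c₂ * (C ^ (q - 1) + C ^ (q * (p + 1) / (q + 1) - 1)) with hKb
  obtain ⟨B, hB, hBη, hBa, hBb⟩ : ∃ B > 0, B ≤ η ∧ B * Real.exp (2 * (d₁ + Ka)) < α * η / 2 ∧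
      B * Real.exp (2 * (d₂ + Kb)) < β * η / 2 := by
    set Ea := Real.exp (2 * (d₁ + Ka))
    set Eb := Real.exp (2 * (d₂ + Kb))
    have hEa : 0 < Ea := Real.exp_pos _
    have hEb : 0 < Eb := Real.exp_pos _
    clear_value Ea Eb
    refine ⟨min η (min (α * η / 4 / Ea) (β * η / 4 / Eb)), by positivity, min_le_left _ _, ?_, ?_⟩
    · have h1 : min η (min (α * η / 4 / Ea) (β * η / 4 / Eb)) ≤ α * η / 4 / Ea :=
        (min_le_right _ _).trans (min_le_left _ _)
      rw [le_div_iff₀ hEa] at h1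
      have : 0 < α * η := by positivity
      linarith
    · have h1 : min η (min (α * η / 4 / Ea) (β * η / 4 / Eb)) ≤ β * η / 4 / Eb :=
        (min_le_right _ _).trans (min_le_right _ _)
      rw [le_div_iff₀ hEb] at h1
      have : 0 < β * η := by positivity
      linarith
  have hev := (aux_small_pow (c := c₂) (a := α * η / 4) (e := α + 1) (by positivity) (by positivity)).and
    ((aux_small_pow (c := c₂) (a := β * η / 4) (e := β + 1) (by positivity) (by positivity)).and
     (aux_small_exp (C := C) (l := ξ - b) hB (by linarith)))
  obtain ⟨τ₂, hτ₂, H2⟩ := mem_nhdsGT_iff_exists_Ioo_subset.1 hev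
  simp only [mem_Ioi] at hτ₂
  refine ⟨min τ₁ (τ₂ / 2), lt_min hτ₁ (by linarith), ?_⟩
  intro t₀ ht₀ hT hτ Hi
  have hτ1 := hτ.trans (min_le_left _ _)
  have hτ2 := hτ.trans (min_le_right _ _)
  have sm : ∀ t ∈ Ico t₀ T, c₂ * (T - t) ^ (α + 1) ≤ α * η / 4 ∧ c₂ * (T - t) ^ (β + 1) ≤ β * η / 4 ∧
      C < B * Real.exp ((ξ - b) / √(T - t)) := by
    intro t ht
    exact H2 ⟨by linarith [ht.2], by linarith [ht.1]⟩
  set Ω : Set (ℝ × ℝ) := Ioo 0 T ×ˢ Ioo 0 R with hΩd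
  have hΩ : IsOpen Ω := isOpen_Ioo.prod isOpen_Ioo
  clear_value Ka Kb
  intro t₂ ht₂
  have hsub : Icc t₀ t₂ ×ˢ Icc b R ⊆ Ico 0 T ×ˢ Icc 0 R := by
    rintro ⟨t, x⟩ ⟨⟨a1, a2⟩, ⟨a3, a4⟩⟩
    simp only at a1 a2 a3 a4
    exact ⟨⟨by simp only; linarith, by simp only; linarith [ht₂.2]⟩, ⟨by simp only; linarith, by simp only; linarith⟩⟩
  have cont : ∀ a : ℝ, ContinuousOn (fun p : ℝ × ℝ => (T - p.1) ^ (-a) *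
      (η + B * Real.exp (-((p.2 - ξ) / √(T - p.1))))) (Icc t₀ t₂ ×ˢ Icc b R) := by
    intro a
    have hpos : ∀ p ∈ Icc t₀ t₂ ×ˢ Icc b R, 0 < T - p.1 := by
      intro p hp
      linarith [hp.1.2, ht₂.2]
    have i1 : ContinuousOn (fun p : ℝ × ℝ => (T - p.1) ^ (-a)) (Icc t₀ t₂ ×ˢ Icc b R) :=
      ContinuousOn.rpow_const (by fun_prop) fun p hp => Or.inl (hpos p hp).ne'
    have i2 : ContinuousOn (fun p : ℝ × ℝ => (p.2 - ξ) / √(T - p.1)) (Icc t₀ t₂ ×ˢ Icc b R) :=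
      ContinuousOn.div (by fun_prop) (by fun_prop) fun p hp => (Real.sqrt_pos.2 (hpos p hp)).ne'
    exact i1.mul (continuousOn_const.add (continuousOn_const.mul i2.neg.rexp))
  have := (aux_mp_sys (t₁ := t₀) (t₂ := t₂) (a := b) (b := R)
      (fun t x => u t x - (T - t) ^ (-α) * (η + B * Real.exp (-((x - ξ) / √(T - t)))))
      (fun t x => v t x - (T - t) ^ (-β) * (η + B * Real.exp (-((x - ξ) / √(T - t)))))
      ?_ ?_ ?_ ?_ ?_ ?_ t₂ ⟨ht₂.1, le_rfl⟩ ξ ⟨by linarith, by linarith⟩)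
  · have hs0 : 0 < T - t₂ := by linarith [ht₂.2]
    have e1 := Real.rpow_pos_of_pos hs0 (-α)
    have e2 := Real.rpow_pos_of_pos hs0 (-β)
    simp only [sub_self, zero_div, neg_zero, Real.exp_zero, mul_one] at this
    constructor
    · exact aux_r1 this.1 e1 hBη
    · exact aux_r1 this.2 e2 hBη
  · exact (S.ucont.mono hsub).sub (cont α)
  · exact (S.vcont.mono hsub).sub (cont β)
  · intro x hx
    obtain ⟨a1, a2⟩ := Hi x hx
    have e1 := Real.rpow_pos_of_pos (show 0 < T - t₀ by linarith) (-α)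
    have e2 := Real.rpow_pos_of_pos (show 0 < T - t₀ by linarith) (-β)
    have hX : 0 < B * Real.exp (-((x - ξ) / √(T - t₀))) := by positivity
    constructor
    · exact aux_r2 a1 e1 hX
    · exact aux_r2 a2 e2 hX
  · intro t ht
    have htT : t < T := by linarith [ht.2, ht₂.2]
    have hts : 0 < T - t := by linarith
    have e1 := S.ubc t ⟨by linarith [ht.1], htT⟩
    have e2 := S.vbc t ⟨by linarith [ht.1], htT⟩
    have f1 := Real.rpow_pos_of_pos hts (-α)
    have f2 := Real.rpow_pos_of_pos hts (-β)
    have f3 : 0 < B * Real.exp (-((R - ξ) / √(T - t))) := by positivity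
    have f4 : C < B * Real.exp (-((b - ξ) / √(T - t))) := by
      have := (sm t ⟨ht.1, htT⟩).2.2
      rwa [show -((b - ξ) / √(T - t)) = (ξ - b) / √(T - t) by ring]
    obtain ⟨a1, a2⟩ := HU t (by linarith [ht.1]) htT (by linarith [ht.1]) b ⟨le_rfl, by linarith⟩
    refine ⟨⟨?_, ?_⟩, ⟨?_, ?_⟩⟩
    · exact aux_r3 a1 f1 f4 hη
    · exact aux_r3 a2 f2 f4 hη
    · rw [e1]
      have : 0 < (T - t) ^ (-α) * (η + B * Real.exp (-((R - ξ) / √(T - t)))) := by positivity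
      linarith
    · rw [e2]
      have : 0 < (T - t) ^ (-β) * (η + B * Real.exp (-((R - ξ) / √(T - t)))) := by positivity
      linarith
  · intro t ht x hx z1 z2 w0 w1
    have htT : t < T := by linarith [ht.2, ht₂.2]
    have hts : 0 < T - t := by linarith
    have htI : t ∈ Ico 0 T := ⟨by linarith [ht.1], htT⟩
    have hxI : x ∈ Icc 0 R := ⟨by linarith [hx.1], by linarith [hx.2]⟩
    obtain ⟨a1, a2⟩ := HU t (by linarith [ht.1]) htT (by linarith [ht.1]) x ⟨hx.1.le, hx.2.le⟩
    have f1 := Real.rpow_pos_of_pos hts (-α)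
    have hX : 0 < B * Real.exp (-((x - ξ) / √(T - t))) := by positivity
    have hXC : η + B * Real.exp (-((x - ξ) / √(T - t))) ≤ C := by
      have : (T - t) ^ (-α) * (η + B * Real.exp (-((x - ξ) / √(T - t)))) ≤ (T - t) ^ (-α) * C := by
        linarith
      exact le_of_mul_le_mul_left this f1
    refine aux_exp_sup (K2 := Ka) hd₁ hN hα hB hBa (by linarith [hx.1]) htT hΩ S.urad
      ⟨⟨by simp only; linarith [ht.1], htT⟩, ⟨by simp only; linarith [hx.1], hx.2⟩⟩ ?_ w0 w1
    rw [hKa]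
    exact S.Fbound1 hα hr1 hp hr (S.unn t htI x hxI) (S.vnn t htI x hxI) hts hη hX hXC hη1
      (sm t ⟨ht.1.le, htT⟩).1 (by linarith) (by linarith)
  · intro t ht x hx z1 z2 w0 w1
    have htT : t < T := by linarith [ht.2, ht₂.2]
    have hts : 0 < T - t := by linarith
    have htI : t ∈ Ico 0 T := ⟨by linarith [ht.1], htT⟩
    have hxI : x ∈ Icc 0 R := ⟨by linarith [hx.1], by linarith [hx.2]⟩
    obtain ⟨a1, a2⟩ := HU t (by linarith [ht.1]) htT (by linarith [ht.1]) x ⟨hx.1.le, hx.2.le⟩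
    have f1 := Real.rpow_pos_of_pos hts (-β)
    have hX : 0 < B * Real.exp (-((x - ξ) / √(T - t))) := by positivity
    have hXC : η + B * Real.exp (-((x - ξ) / √(T - t))) ≤ C := by
      have : (T - t) ^ (-β) * (η + B * Real.exp (-((x - ξ) / √(T - t)))) ≤ (T - t) ^ (-β) * C := by
        linarith
      exact le_of_mul_le_mul_left this f1
    refine aux_exp_sup (K2 := Kb) hd₂ hN hβ hB hBb (by linarith [hx.1]) htT hΩ S.vrad
      ⟨⟨by simp only; linarith [ht.1], htT⟩, ⟨by simp only; linarith [hx.1], hx.2⟩⟩ ?_ w0 w1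
    rw [hKb]
    exact S.swap.Fbound1 hβ hs1 hq hs (S.vnn t htI x hxI) (S.unn t htI x hxI) hts hη hX hXC hη2
      (sm t ⟨ht.1.le, htT⟩).2.1 (by linarith) (by linarith)

end

section
open Topology
variable {N R p q d₁ d₂ c₁ c₂ T : ℝ} {F G u v : ℝ → ℝ → ℝ}

theorem aux_small_eta {a c e : ℝ} (ha : 0 < a) (he : 1 < e) :
    ∀ᶠ η in 𝓝[>] (0:ℝ), c * (2 * η) ^ e ≤ a * η := by
  filter_upwards [aux_small_pow (c := c * 2 ^ e) ha (sub_pos.2 he), self_mem_nhdsWithin] with η h1 h2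
  have h2 : 0 < η := h2
  have h3 : η ^ e = η ^ (e - 1) * η := by
    rw [Real.rpow_sub_one h2.ne']; field_simp
  rw [Real.mul_rpow (by norm_num) h2.le, h3]
  calc c * (2 ^ e * (η ^ (e - 1) * η)) = (c * 2 ^ e * η ^ (e - 1)) * η := by ring
    _ ≤ a * η := by gcongr

theorem AuxSys.lower_or (S : AuxSys N R p q d₁ d₂ c₁ c₂ T F G u v) {α β : ℝ} (hα : 0 < α) (hβ : 0 < β)
    (hp : β * p = α + 1) (hq : α * q = β + 1) (hr : α * (p * (q + 1) / (p + 1)) = α + 1)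
    (hs : β * (q * (p + 1) / (q + 1)) = β + 1)
    (hr1 : 1 < p * (q + 1) / (p + 1)) (hs1 : 1 < q * (p + 1) / (q + 1)) {ρ₀ : ℝ} (hρ : ρ₀ ∈ Ioo 0 R)
    (hblow₀ : ∀ M : ℝ, ∀ ε > (0:ℝ), ∃ t, T - ε < t ∧ t < T ∧ M < u t ρ₀ + v t ρ₀) :
    ∃ η > (0:ℝ), ∃ τ₀ > (0:ℝ), ∀ t₀, 0 < t₀ → t₀ < T → T - t₀ ≤ τ₀ →
      η * (T - t₀) ^ (-α) ≤ u t₀ (3 * ρ₀ / 4) ∨ η * (T - t₀) ^ (-β) ≤ v t₀ (3 * ρ₀ / 4) := by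
  obtain ⟨h0, hR⟩ := hρ
  obtain ⟨η₀, hη₀, τ₂, hτ₂, H2⟩ := S.step2 hα hβ hp hq hr hs (ξ := 7 * ρ₀ / 8) (ρ₀ := ρ₀)
    (by linarith) (by linarith) hR
  obtain ⟨η, e1, e2, e3, e4, e5, e6⟩ := ((aux_small_eta (c := c₂) (show 0 < α / 8 by positivity) S.p1).and
    ((aux_small_eta (c := c₂) (show 0 < α / 8 by positivity) hr1).and
    ((aux_small_eta (c := c₂) (show 0 < β / 8 by positivity) S.q1).and
    ((aux_small_eta (c := c₂) (show 0 < β / 8 by positivity) hs1).and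
    ((show ∀ᶠ η in 𝓝[>] (0:ℝ), η ≤ η₀ by
      filter_upwards [Ioc_mem_nhdsGT hη₀] with η h using h.2).and
    (show ∀ᶠ η in 𝓝[>] (0:ℝ), 0 < η from self_mem_nhdsWithin)))))).exists
  obtain ⟨τ₁, hτ₁, H1⟩ := S.step1 hα hβ hp hq hr hs hr1 hs1 (b := 3 * ρ₀ / 4) (ξ := 7 * ρ₀ / 8) (η := η)
    (by linarith) (by linarith) (by linarith) e6 (by linarith) (by linarith)
  refine ⟨η, e6, min τ₁ τ₂, lt_min hτ₁ hτ₂, fun t₀ a1 a2 a3 => ?_⟩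
  by_contra hcon
  push Not at hcon
  have hall : ∀ x ∈ Icc (3 * ρ₀ / 4) R, u t₀ x < η * (T - t₀) ^ (-α) ∧ v t₀ x < η * (T - t₀) ^ (-β) :=
    fun x hx => ⟨(S.anti ⟨a1, a2⟩ (by linarith) hx.1 hx.2).trans_lt hcon.1,
      (S.swap.anti ⟨a1, a2⟩ (by linarith) hx.1 hx.2).trans_lt hcon.2⟩
  have h1 := H1 t₀ a1 a2 (a3.trans (min_le_left _ _)) hall
  obtain ⟨M, hM⟩ := H2 t₀ η a1 a2 (a3.trans (min_le_right _ _)) e6 e5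
    (fun x hx => hall x ⟨by linarith [hx.1], hx.2⟩) h1
  obtain ⟨t, b1, b2, b3⟩ := hblow₀ M (T - t₀) (by linarith)
  linarith [hM t ⟨by linarith, b2⟩]

theorem AuxSys.two_sided (S : AuxSys N R p q d₁ d₂ c₁ c₂ T F G u v) {α β : ℝ} (hα : 0 < α) (hβ : 0 < β)
    (hp : β * p = α + 1) (hq : α * q = β + 1) (hr : α * (p * (q + 1) / (p + 1)) = α + 1)
    (hs : β * (q * (p + 1) / (q + 1)) = β + 1)
    (hr1 : 1 < p * (q + 1) / (p + 1)) (hs1 : 1 < q * (p + 1) / (q + 1)) {ρ₀ : ℝ} (hρ : ρ₀ ∈ Ioo 0 R)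
    (hblow₀ : ∀ M : ℝ, ∀ ε > (0:ℝ), ∃ t, T - ε < t ∧ t < T ∧ M < u t ρ₀ + v t ρ₀) :
    ∃ k > (0:ℝ), ∃ C > (0:ℝ), ∃ τ₀ > (0:ℝ), ∀ t, 0 < t → t < T → T - t ≤ τ₀ →
      ∀ x ∈ Icc (ρ₀ / 4) (ρ₀ / 2), (k * (T - t) ^ (-α) ≤ u t x ∧ u t x ≤ C * (T - t) ^ (-α)) ∧
        (k * (T - t) ^ (-β) ≤ v t x ∧ v t x ≤ C * (T - t) ^ (-β)) := by
  obtain ⟨η, hη, τ₁, hτ₁, H1⟩ := S.lower_or hα hβ hp hq hr hs hr1 hs1 hρ hblow₀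
  obtain ⟨h0, hR⟩ := hρ
  obtain ⟨C, hC, τ₂, hτ₂, H2⟩ := S.upper hα hβ hp hq (b := ρ₀ / 4) (by linarith) (by linarith)
  obtain ⟨τ₃, hτ₃, H3⟩ := S.transfer hq (b := 3 * ρ₀ / 4) (by linarith) (by linarith)
  obtain ⟨τ₄, hτ₄, H4⟩ := S.swap.transfer hp (b := 3 * ρ₀ / 4) (by linarith) (by linarith)
  have hc₁ := S.c10
  have hT := S.T0
  set m := min (η / 2) (min (c₁ * (η / 2) ^ q / 4) (c₁ * (η / 2) ^ p / 4)) with hm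
  have m1 : m ≤ η / 2 := min_le_left _ _
  have m2 : m ≤ c₁ * (η / 2) ^ q / 4 := (min_le_right _ _).trans (min_le_left _ _)
  have m3 : m ≤ c₁ * (η / 2) ^ p / 4 := (min_le_right _ _).trans (min_le_right _ _)
  have m0 : 0 < m := by rw [hm]; positivity
  clear_value m
  set l := min ((2:ℝ) ^ (-α)) (2 ^ (-β)) with hl
  have l0 : 0 < l := by rw [hl]; positivity
  have l1 : l ≤ 2 ^ (-α) := min_le_left _ _
  have l2 : l ≤ 2 ^ (-β) := min_le_right _ _
  clear_value l
  refine ⟨m * l, by positivity, C, hC, min (T / 3) (min (τ₁ / 2) (min τ₂ (min (τ₃ / 2) (τ₄ / 2)))), by positivity,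
    fun t a1 a2 a3 x hx => ?_⟩
  simp only [le_min_iff] at a3
  obtain ⟨b0, b1, b2, b3, b4⟩ := a3
  have hs0 : 0 < T - t := by linarith
  have hup := H2 t a1 a2 b2 x ⟨hx.1, by linarith [hx.2]⟩
  have e : T - (2 * t - T) = 2 * (T - t) := by ring
  have key : ∀ (a w M : ℝ), l ≤ 2 ^ (-a) → m ≤ M → M * (T - (2 * t - T)) ^ (-a) ≤ w →
      m * l * (T - t) ^ (-a) ≤ w := by
    intro a w M k1 k2 k3
    rw [e, Real.mul_rpow (by norm_num) hs0.le] at k3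
    refine le_trans ?_ k3
    have := Real.rpow_pos_of_pos hs0 (-a)
    rw [← mul_assoc]
    have : 0 < M := by linarith
    gcongr
  have hl' : m * l * (T - t) ^ (-α) ≤ u t (49 * (3 * ρ₀ / 4) / 64) ∧
      m * l * (T - t) ^ (-β) ≤ v t (49 * (3 * ρ₀ / 4) / 64) := by
    rcases H1 (2 * t - T) (by linarith) (by linarith) (by linarith) with h | h
    · have := H3 (2 * t - T) η (by linarith) (by linarith) (by linarith) hη.le h t (by linarith) a2
      exact ⟨key _ _ _ l1 m1 this.1, key _ _ _ l2 m2 this.2⟩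
    · have := H4 (2 * t - T) η (by linarith) (by linarith) (by linarith) hη.le h t (by linarith) a2
      exact ⟨key _ _ _ l1 m3 this.2, key _ _ _ l2 m1 this.1⟩
  refine ⟨⟨hl'.1.trans ?_, hup.1.le⟩, hl'.2.trans ?_, hup.2.le⟩
  · exact S.anti ⟨a1, a2⟩ (by linarith [hx.1]) (by linarith [hx.2]) (by linarith)
  · exact S.swap.anti ⟨a1, a2⟩ (by linarith [hx.1]) (by linarith [hx.2]) (by linarith)

end

section
open Topology
variable {N R p q d₁ d₂ c₁ c₂ T : ℝ} {F G u v : ℝ → ℝ → ℝ}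

theorem aux_J_alg {W Y z zx zxx zt wx Fv Fu f d N x c c' c'' σ σ' γ K B P P2 Q : ℝ}
    (hW : W = d * (Y + N / x * zxx - N / x ^ 2 * zx) + (Fu * zx + Fv * wx))
    (hzt : zt = d * (zxx + N / x * zx) + f) (hσ : 0 < σ) (hc : 0 ≤ c) (hγ : 1 < γ) (hd : 0 < d) (hz : 0 < z)
    (hP : 0 < P) (hP2 : 0 < P2) 
    (hK : -c'' - N / x * c' + N / x ^ 2 * c ≤ K * c) (hB : c' ≤ B)
    (hmain : σ * (γ * f - z * Fu + d * z * (K + 2 * γ * B * σ * P)) * P ≤ σ' * Q * Fv) :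
    (W + σ * c * (γ * P * zt)) - d * (Y + σ * (c'' * (P * z) + 2 * c' * (γ * P * zx) +
        c * (γ * ((γ - 1) * P2 * zx ^ 2 + P * zxx))))
      - d * (N / x) * (zxx + σ * (c' * (P * z) + c * (γ * P * zx)))
      + d * (N / x ^ 2) * (zx + σ * c * (P * z))
    ≤ Fv * (wx + σ' * c * Q) + (Fu - 2 * σ * d * γ * c' * P) * (zx + σ * c * (P * z)) := by
  subst hW hzt
  have h1 := mul_le_mul_of_nonneg_left hmain hc
  have h2 := mul_le_mul_of_nonneg_left hK (show 0 ≤ d * σ * P * z by positivity)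
  have h3 : 0 ≤ d * σ * c * γ * (γ - 1) * P2 * zx ^ 2 := by
    have : 0 < γ - 1 := by linarith
    have : 0 < γ := by linarith
    positivity
  have h4 := mul_le_mul_of_nonneg_left hB (show 0 ≤ d * σ * P * z * (2 * γ * c * σ * P) by
    have : 0 < γ := by linarith
    positivity)
  set i := N / x with hi
  set j := N / x ^ 2 with hj
  clear_value i j
  linarith

theorem AuxSys.J_ineq (S : AuxSys N R p q d₁ d₂ c₁ c₂ T F G u v) {t x : ℝ} (ht : t ∈ Ioo 0 T)
    (hx : x ∈ Ioo 0 R) (hz : 0 < u t x) {W Y : ℝ}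
    (hW : HasDerivAt (fun s => deriv (u s) x) W t) (hY : HasDerivAt (deriv (deriv (u t))) Y x)
    (hWY : W = d₁ * (Y + N / x * deriv (deriv (u t)) x - N / x ^ 2 * deriv (u t) x) +
      (deriv (fun a => F a (v t x)) (u t x) * deriv (u t) x +
        deriv (fun b => F (u t x) b) (v t x) * deriv (v t) x))
    {c c' : ℝ → ℝ} {c'' : ℝ} (hc : ∀ y, HasDerivAt c (c' y) y) (hc' : HasDerivAt c' c'' x)
    {σ σ' γ γ' K B : ℝ} (hσ : 0 < σ) (hc0 : 0 ≤ c x) (hγ : 1 < γ)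
    (hK : -c'' - N / x * c' x + N / x ^ 2 * c x ≤ K * c x) (hB : c' x ≤ B)
    (hmain : σ * (γ * F (u t x) (v t x) - u t x * deriv (fun a => F a (v t x)) (u t x) +
      d₁ * u t x * (K + 2 * γ * B * σ * u t x ^ (γ - 1))) * u t x ^ (γ - 1) ≤
      σ' * v t x ^ γ' * deriv (fun b => F (u t x) b) (v t x))
    {J J' : ℝ → ℝ → ℝ} (hJ : J = fun t ρ => deriv (u t) ρ + σ * c ρ * u t ρ ^ γ)
    (hJ' : J' = fun t ρ => deriv (v t) ρ + σ' * c ρ * v t ρ ^ γ') :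
    deriv (fun s => J s x) t - d₁ * deriv (deriv (J t)) x - d₁ * (N / x) * deriv (J t) x
      + d₁ * (N / x ^ 2) * J t x ≤ deriv (fun b => F (u t x) b) (v t x) * J' t x
      + (deriv (fun a => F a (v t x)) (u t x) - 2 * σ * d₁ * γ * deriv c x * u t x ^ (γ - 1)) * J t x := by
  have hpow : u t x ^ γ = u t x ^ (γ - 1) * u t x := by
    rw [Real.rpow_sub_one hz.ne']; field_simp
  have hdt := S.urad.dt t x ⟨ht, hx⟩
  have e1 : deriv (fun s => J s x) t = W + σ * c x * (γ * u t x ^ (γ - 1) *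
      (d₁ * (deriv (deriv (u t)) x + N / x * deriv (u t) x) + F (u t x) (v t x))) := by
    rw [hJ]
    have := hW.add ((hdt.rpow_const (p := γ) (Or.inl hz.ne')).const_mul (σ * c x))
    refine (this.congr_deriv ?_).deriv
    ring
  have e2 : deriv (J t) =ᶠ[𝓝 x] fun y => deriv (deriv (u t)) y +
      σ * (c' y * u t y ^ γ + c y * (γ * u t y ^ (γ - 1) * deriv (u t) y)) := by
    have h1 : ∀ᶠ y in 𝓝 x, 0 < u t y :=
      (S.urad.dx t x ⟨ht, hx⟩).continuousAt.eventually (lt_mem_nhds hz)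
    filter_upwards [h1, isOpen_Ioo.mem_nhds hx] with y hy hyR
    rw [hJ]
    have := (S.urad.dxx t y ⟨ht, hyR⟩).hasDerivAt.add (((hc y).const_mul σ).mul
      ((S.urad.dx t y ⟨ht, hyR⟩).hasDerivAt.rpow_const (p := γ) (Or.inl hy.ne')))
    refine (this.congr_deriv ?_).deriv
    ring
  have e3 : deriv (deriv (J t)) x = Y + σ * (c'' * (u t x ^ (γ - 1) * u t x) +
      2 * c' x * (γ * u t x ^ (γ - 1) * deriv (u t) x) +
        c x * (γ * ((γ - 1) * u t x ^ (γ - 1 - 1) * deriv (u t) x ^ 2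
          + u t x ^ (γ - 1) * deriv (deriv (u t)) x))) := by
    rw [e2.deriv_eq]
    have hu := (S.urad.dx t x ⟨ht, hx⟩).hasDerivAt
    have hd := (S.urad.dxx t x ⟨ht, hx⟩).hasDerivAt
    have a1 := hu.rpow_const (p := γ) (Or.inl hz.ne')
    have a2 := hu.rpow_const (p := γ - 1) (Or.inl hz.ne')
    have := hY.add (((hc'.mul a1).add ((hc x).mul ((a2.const_mul γ).mul hd))).const_mul σ)
    refine (this.congr_deriv ?_).deriv
    rw [hpow]
    simp only [Pi.mul_apply, Pi.add_apply]
    ring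
  rw [e1, e3, e2.self_of_nhds, (hc x).deriv]
  subst hJ hJ'
  simp only [hpow]
  exact aux_J_alg hWY rfl hσ hc0 hγ S.d10 hz (Real.rpow_pos_of_pos hz _) (Real.rpow_pos_of_pos hz _)
    hK hB hmain

end

section
open Topology
variable {N R p q d₁ d₂ c₁ c₂ T : ℝ} {F G u v : ℝ → ℝ → ℝ}

theorem aux_c_deriv {a b k : ℝ} (y : ℝ) :
    HasDerivAt (fun y => Real.sin (a * (y - b) / k) ^ 2)
      (2 * (a / k) * Real.sin (a * (y - b) / k) * Real.cos (a * (y - b) / k)) y := by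
  have h0 : HasDerivAt (fun y => a * (y - b) / k) (a / k) y := by
    refine ((((hasDerivAt_id y).sub_const b).const_mul a).div_const k).congr_deriv ?_
    ring
  refine (h0.sin.pow 2).congr_deriv ?_
  push_cast
  ring

theorem aux_c_deriv2 {a b k : ℝ} (y : ℝ) :
    HasDerivAt (fun y => 2 * (a / k) * Real.sin (a * (y - b) / k) * Real.cos (a * (y - b) / k))
      (2 * (a / k) ^ 2 * (Real.cos (a * (y - b) / k) ^ 2 - Real.sin (a * (y - b) / k) ^ 2)) y := by
  have h0 : HasDerivAt (fun y => a * (y - b) / k) (a / k) y := by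
    refine ((((hasDerivAt_id y).sub_const b).const_mul a).div_const k).congr_deriv ?_
    ring
  refine ((h0.sin.const_mul (2 * (a / k))).mul h0.cos).congr_deriv ?_
  ring

theorem aux_c_K {l s k i j N ρ x : ℝ} (hρ : 0 < ρ) (hx : ρ ≤ x) (hN : 0 ≤ N) (hi : i = N / x) (hj : j = N / x ^ 2) :
    -(2 * l ^ 2 * (k ^ 2 - s ^ 2)) - i * (2 * l * s * k) + j * s ^ 2
      ≤ (2 * l ^ 2 + (N / ρ) ^ 2 / 2 + N / ρ ^ 2) * s ^ 2 := by
  have hi0 : 0 ≤ i := by rw [hi]; exact div_nonneg hN (by linarith)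
  have h1 : i ≤ N / ρ := by rw [hi]; gcongr
  have h2 : j ≤ N / ρ ^ 2 := by rw [hj]; gcongr
  have h3 : i ^ 2 ≤ (N / ρ) ^ 2 := by gcongr
  have h4 := mul_le_mul_of_nonneg_right h2 (sq_nonneg s)
  have h5 := mul_le_mul_of_nonneg_right h3 (sq_nonneg s)
  nlinarith [sq_nonneg (2 * l * k + i * s)]

theorem aux_pow_dom {B m e f : ℝ} (hm : 0 < m) (h : e < f) : ∀ᶠ z : ℝ in atTop, B * z ^ e ≤ m * z ^ f := by
  have h1 := (tendsto_rpow_atTop (sub_pos.2 h)).const_mul_atTop hm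
  filter_upwards [h1.eventually_ge_atTop B, eventually_gt_atTop 0] with z h2 h3
  calc B * z ^ e ≤ (m * z ^ (f - e)) * z ^ e := by gcongr
    _ = m * z ^ f := by rw [mul_assoc, ← Real.rpow_add h3]; ring_nf

theorem aux_main_cond {p q c₁ d K B C₂ μ e γ γ' κ₁ σb : ℝ} (hp : 1 < p) (hc₁ : 0 < c₁)
    (hd : 0 < d) (hC : 0 < C₂) (hμ : 0 < μ) (he : 0 < e) (hκ₁ : 0 < κ₁) (hB : 0 ≤ B)
    (hγ : γ = 1 + e * (q + 1)) (hγ' : γ' = 1 + e * (p + 1)) (h1γ : 1 < γ) (hγμ : γ ≤ 1 + μ / 2)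
    (hγr : γ < p * (q + 1) / (p + 1)) :
    ∃ A' > (0:ℝ), ∀ a b f Fu Fv σ σ' : ℝ, A' ≤ a → 0 < b → a ^ (q + 1) / b ^ (p + 1) ≤ C₂ →
      c₁ * b ^ p ≤ f → (1 + μ) * f ≤ a * Fu + κ₁ * b * Fv → 0 ≤ Fv → 0 < σ → σ ≤ σb →
      σ * (κ₁ * C₂ ^ e) ≤ σ' →
      σ * (γ * f - a * Fu + d * a * (K + 2 * γ * B * σ * a ^ (γ - 1))) * a ^ (γ - 1) ≤ σ' * b ^ γ' * Fv := by
  set r := p * (q + 1) / (p + 1) with hr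
  set m := μ / 4 * (c₁ / C₂ ^ (p / (p + 1))) with hm
  have hm0 : 0 < m := by positivity
  obtain ⟨A', hA'⟩ := (((aux_pow_dom (B := d * K) (e := 0) (f := r - 1) hm0 (by linarith)).and
    (aux_pow_dom (B := d * (2 * γ * B * σb)) (e := γ - 1) (f := r - 1) hm0 (by linarith)))).exists_forall_of_atTop
  refine ⟨max A' 1, by positivity, fun a b f Fu Fv σ σ' ha hb hab hf hst hFv hσ hσb hσ' => ?_⟩
  have ha1 : 1 ≤ a := (le_max_right _ _).trans ha
  have ha0 : 0 < a := by linarith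
  obtain ⟨k1, k2⟩ := hA' a ((le_max_left _ _).trans ha)
  have hP := Real.rpow_pos_of_pos ha0 (γ - 1)
  -- lower bound for f
  have hbp : a ^ (q + 1) ≤ C₂ * b ^ (p + 1) := (div_le_iff₀ (Real.rpow_pos_of_pos hb _)).1 hab
  have hfr : 4 * m * a ^ r ≤ μ * f := by
    have h1 := Real.rpow_le_rpow (by positivity) hbp (show 0 ≤ p / (p + 1) by positivity)
    rw [Real.mul_rpow hC.le (by positivity), ← Real.rpow_mul ha0.le, ← Real.rpow_mul hb.le] at h1
    have e1 : (q + 1) * (p / (p + 1)) = r := by rw [hr]; ring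
    have e2 : (p + 1) * (p / (p + 1)) = p := by field_simp
    rw [e1, e2] at h1
    have hCp : 0 < C₂ ^ (p / (p + 1)) := by positivity
    have : 4 * m * a ^ r ≤ μ * (c₁ * b ^ p) := by
      calc 4 * m * a ^ r = μ * c₁ / C₂ ^ (p / (p + 1)) * a ^ r := by rw [hm]; ring
        _ ≤ μ * c₁ / C₂ ^ (p / (p + 1)) * (C₂ ^ (p / (p + 1)) * b ^ p) := by gcongr
        _ = _ := by field_simp
    exact this.trans (by gcongr)
  have har : a ^ r = a ^ (r - 1) * a := by rw [Real.rpow_sub_one ha0.ne']; field_simp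
  have h2 : d * a * (K + 2 * γ * B * σ * a ^ (γ - 1)) ≤ μ / 2 * f := by
    rw [Real.rpow_zero, mul_one] at k1
    have k3 : d * (2 * γ * B * σ) * a ^ (γ - 1) ≤ d * (2 * γ * B * σb) * a ^ (γ - 1) := by gcongr
    have k4 : d * (K + 2 * γ * B * σ * a ^ (γ - 1)) ≤ 2 * m * a ^ (r - 1) := by linarith
    have k5 := mul_le_mul_of_nonneg_right k4 ha0.le
    rw [har] at hfr
    linarith
  have hf0 : 0 ≤ f := le_trans (by positivity) hf
  have h3 : γ * f - a * Fu + d * a * (K + 2 * γ * B * σ * a ^ (γ - 1)) ≤ κ₁ * b * Fv := by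
    have := mul_le_mul_of_nonneg_right hγμ hf0
    linarith
  -- exponents
  have hpow : a ^ (γ - 1) ≤ C₂ ^ e * b ^ (γ' - 1) := by
    have h1 := Real.rpow_le_rpow (by positivity) hbp he.le
    rw [Real.mul_rpow hC.le (by positivity), ← Real.rpow_mul ha0.le, ← Real.rpow_mul hb.le] at h1
    rw [show γ - 1 = (q + 1) * e by rw [hγ]; ring, show γ' - 1 = (p + 1) * e by rw [hγ']; ring]
    exact h1
  have hbγ : b ^ γ' = b ^ (γ' - 1) * b := by rw [Real.rpow_sub_one hb.ne']; field_simp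
  have hbp' := Real.rpow_pos_of_pos hb (γ' - 1)
  calc _ ≤ σ * (κ₁ * b * Fv) * a ^ (γ - 1) := by gcongr
    _ ≤ σ * (κ₁ * b * Fv) * (C₂ ^ e * b ^ (γ' - 1)) := by gcongr
    _ = (σ * (κ₁ * C₂ ^ e)) * (b ^ (γ' - 1) * b * Fv) := by ring
    _ ≤ σ' * (b ^ (γ' - 1) * b * Fv) := by gcongr
    _ = _ := by rw [hbγ]; ring

end

section
theorem aux_c_B {l : ℝ} (hl : 0 ≤ l) (x : ℝ) : 2 * l * Real.sin x * Real.cos x ≤ 2 * l := by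
  have h3 : Real.sin x * Real.cos x ≤ 1 := by
    nlinarith [sq_nonneg (Real.sin x - Real.cos x), Real.sin_sq_add_cos_sq x]
  rw [mul_assoc]
  nlinarith

set_option maxHeartbeats 4000000 in
theorem aux_final_ineq
    (n : ℕ) (hn : 1 ≤ n) (R : ℝ) (hR : 0 < R)
    (p q δ : ℝ) (hp : 1 < p) (hq : 1 < q) (hδ : 0 < δ)
    (c₁ c₂ : ℝ) (hc₁ : 0 < c₁) (hc₂ : 0 < c₂)
    (T : ℝ) (hT : 0 < T)
    (F G : ℝ → ℝ → ℝ)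
    (hF_C1 : ContDiff ℝ 1 (Function.uncurry F))
    (hG_C1 : ContDiff ℝ 1 (Function.uncurry G))
    (hFv : ∀ a b : ℝ, 0 ≤ a → 0 ≤ b → 0 ≤ deriv (fun y => F a y) b)
    (hGu : ∀ a b : ℝ, 0 ≤ a → 0 ≤ b → 0 ≤ deriv (fun x => G x b) a)
    (hF_low : ∀ a b : ℝ, 0 ≤ a → 0 ≤ b → c₁ * b ^ p ≤ F a b)
    (hF_up : ∀ a b : ℝ, 0 ≤ a → 0 ≤ b →
      F a b ≤ c₂ * (b ^ p + a ^ (p * (q + 1) / (p + 1)) + 1))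
    (hG_low : ∀ a b : ℝ, 0 ≤ a → 0 ≤ b → c₁ * a ^ q ≤ G a b)
    (hG_up : ∀ a b : ℝ, 0 ≤ a → 0 ≤ b →
      G a b ≤ c₂ * (a ^ q + b ^ (q * (p + 1) / (q + 1)) + 1))
    (hstruct : ∀ C₁ > (0:ℝ), ∀ C₂ > (0:ℝ),
      ∃ μ > (0:ℝ), ∃ A > (0:ℝ), ∃ κ₁ > (0:ℝ), ∃ κ₂ > (0:ℝ), κ₁ * κ₂ < 1 ∧
        ∀ a b : ℝ, A ≤ a → A ≤ b →
          C₁ ≤ a ^ (q + 1) / b ^ (p + 1) → a ^ (q + 1) / b ^ (p + 1) ≤ C₂ →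
          (1 + μ) * F a b
              ≤ a * deriv (fun x => F x b) a + κ₁ * b * deriv (fun y => F a y) b ∧
          (1 + μ) * G a b
              ≤ b * deriv (fun y => G a y) b + κ₂ * a * deriv (fun x => G x b) a)
    (u v : ℝ → ℝ → ℝ)
    (hu_nn : ∀ t ∈ Ico (0:ℝ) T, ∀ ρ ∈ Icc (0:ℝ) R, 0 ≤ u t ρ)
    (hv_nn : ∀ t ∈ Ico (0:ℝ) T, ∀ ρ ∈ Icc (0:ℝ) R, 0 ≤ v t ρ)
    (hu_cont : ContinuousOn (Function.uncurry u) (Ico (0:ℝ) T ×ˢ Icc (0:ℝ) R))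
    (hv_cont : ContinuousOn (Function.uncurry v) (Ico (0:ℝ) T ×ˢ Icc (0:ℝ) R))
    (hu_regx : ∀ t ∈ Ioo (0:ℝ) T, ContDiffOn ℝ 2 (u t) (Ioo (0:ℝ) R))
    (hv_regx : ∀ t ∈ Ioo (0:ℝ) T, ContDiffOn ℝ 2 (v t) (Ioo (0:ℝ) R))
    (hu_regt : ∀ ρ ∈ Ioo (0:ℝ) R, ∀ t ∈ Ioo (0:ℝ) T, DifferentiableAt ℝ (fun s => u s ρ) t)
    (hv_regt : ∀ ρ ∈ Ioo (0:ℝ) R, ∀ t ∈ Ioo (0:ℝ) T, DifferentiableAt ℝ (fun s => v s ρ) t)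
    (hu_bc : ∀ t ∈ Ioo (0:ℝ) T, u t R = 0)
    (hv_bc : ∀ t ∈ Ioo (0:ℝ) T, v t R = 0)
    (hu_rho : ∀ t ∈ Ioo (0:ℝ) T, ∀ ρ ∈ Ioo (0:ℝ) R, deriv (u t) ρ ≤ 0)
    (hv_rho : ∀ t ∈ Ioo (0:ℝ) T, ∀ ρ ∈ Ioo (0:ℝ) R, deriv (v t) ρ ≤ 0)
    (hu_pde : ∀ t ∈ Ioo (0:ℝ) T, ∀ ρ ∈ Ioo (0:ℝ) R,
      deriv (fun s => u s ρ) t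
        = δ * (deriv (deriv (u t)) ρ + ((n : ℝ) - 1) / ρ * deriv (u t) ρ)
          + F (u t ρ) (v t ρ))
    (hv_pde : ∀ t ∈ Ioo (0:ℝ) T, ∀ ρ ∈ Ioo (0:ℝ) R,
      deriv (fun s => v s ρ) t
        = deriv (deriv (v t)) ρ + ((n : ℝ) - 1) / ρ * deriv (v t) ρ
          + G (u t ρ) (v t ρ))
    (hblow : ∀ M : ℝ, ∀ ε > (0:ℝ), ∃ t, T - ε < t ∧ t < T ∧ M < u t 0 + v t 0)
    (ρ₀ : ℝ) (hρ₀ : ρ₀ ∈ Ioo (0:ℝ) R)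
    (hblow₀ : ∀ M : ℝ, ∀ ε > (0:ℝ), ∃ t, T - ε < t ∧ t < T ∧ M < u t ρ₀ + v t ρ₀)
    (ρ₁ ρ₂ : ℝ) (hρ₁ : ρ₁ = ρ₀ / 4) (hρ₂ : ρ₂ = ρ₀ / 2)
    (c : ℝ → ℝ) (hc : c = fun ρ => Real.sin (Real.pi * (ρ - ρ₁) / (ρ₂ - ρ₁)) ^ 2) :
    ∃ γ > (1:ℝ), ∃ γ' > (1:ℝ), ∃ κ > (0:ℝ), ∃ T₁ ∈ Ioo (0:ℝ) T,
      ∀ ε : ℝ, 0 < ε → ε ≤ 1 →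
        ∀ J J' : ℝ → ℝ → ℝ,
          J = (fun t ρ => deriv (u t) ρ + ε * c ρ * u t ρ ^ γ) →
          J' = (fun t ρ => deriv (v t) ρ + ε * κ * c ρ * v t ρ ^ γ') →
          ∀ᵐ x ∂(volume : Measure (ℝ × ℝ)),
            x ∈ Ico T₁ T ×ˢ Ioo ρ₁ ρ₂ →
              (deriv (fun s => J s x.2) x.1
                  - δ * deriv (deriv (J x.1)) x.2
                  - δ * (((n : ℝ) - 1) / x.2) * deriv (J x.1) x.2
                  + δ * (((n : ℝ) - 1) / x.2 ^ 2) * J x.1 x.2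
                ≤ deriv (fun y => F (u x.1 x.2) y) (v x.1 x.2) * J' x.1 x.2
                  + (deriv (fun z => F z (v x.1 x.2)) (u x.1 x.2)
                      - 2 * ε * δ * γ * deriv c x.2 * u x.1 x.2 ^ (γ - 1))
                    * J x.1 x.2) ∧
              (deriv (fun s => J' s x.2) x.1
                  - deriv (deriv (J' x.1)) x.2
                  - (((n : ℝ) - 1) / x.2) * deriv (J' x.1) x.2
                  + (((n : ℝ) - 1) / x.2 ^ 2) * J' x.1 x.2
                ≤ deriv (fun z => G z (v x.1 x.2)) (u x.1 x.2) * J x.1 x.2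
                  + (deriv (fun y => G (u x.1 x.2) y) (v x.1 x.2)
                      - 2 * ε * γ' * κ * deriv c x.2 * v x.1 x.2 ^ (γ' - 1))
                    * J' x.1 x.2) := by
  have S : AuxSys ((n:ℝ) - 1) R p q δ 1 c₁ c₂ T F G u v := by
    have hΩ : ∀ z : ℝ → ℝ → ℝ, (∀ t ∈ Ioo (0:ℝ) T, ContDiffOn ℝ 2 (z t) (Ioo (0:ℝ) R)) →
        ∀ t x, (t, x) ∈ Ioo (0:ℝ) T ×ˢ Ioo (0:ℝ) R → DifferentiableAt ℝ (z t) x ∧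
          DifferentiableAt ℝ (deriv (z t)) x := by
      intro z hz t x hx
      have h1 := (hz t hx.1).contDiffAt (isOpen_Ioo.mem_nhds hx.2)
      refine ⟨h1.differentiableAt (by norm_num), ?_⟩
      have h2 : ContDiffOn ℝ 1 (deriv (z t)) (Ioo (0:ℝ) R) :=
        ((contDiffOn_succ_iff_deriv_of_isOpen (n := 1) isOpen_Ioo).1 (by rw [one_add_one_eq_two]; exact hz t hx.1)).2.2
      exact (h2.contDiffAt (isOpen_Ioo.mem_nhds hx.2)).differentiableAt (by norm_num)
    have hsub : Ioo (0:ℝ) T ×ˢ Ioo (0:ℝ) R ⊆ Ico (0:ℝ) T ×ˢ Icc (0:ℝ) R :=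
      prod_mono Ioo_subset_Ico_self Ioo_subset_Icc_self
    exact
    { N0 := by
        have : (1:ℝ) ≤ n := by exact_mod_cast hn
        linarith
      R0 := hR, p1 := hp, q1 := hq, d10 := hδ, d20 := one_pos, c10 := hc₁, c20 := hc₂, T0 := hT
      FC := hF_C1, GC := hG_C1, Flow := hF_low, Glow := hG_low, Fup := hF_up, Gup := hG_up
      unn := hu_nn, vnn := hv_nn, ucont := hu_cont, vcont := hv_cont, ubc := hu_bc, vbc := hv_bc
      uneg := hu_rho, vneg := hv_rho
      urad := ⟨hu_cont.mono hsub, fun t x h => (hΩ u hu_regx t x h).1, fun t x h => (hΩ u hu_regx t x h).2,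
        fun t x h => (hu_regt x h.2 t h.1).hasDerivAt.congr_deriv (hu_pde t h.1 x h.2)⟩
      vrad := ⟨hv_cont.mono hsub, fun t x h => (hΩ v hv_regx t x h).1, fun t x h => (hΩ v hv_regx t x h).2,
        fun t x h => (hv_regt x h.2 t h.1).hasDerivAt.congr_deriv (by rw [one_mul]; exact hv_pde t h.1 x h.2)⟩ }
  have hpq : 0 < p * q - 1 := by nlinarith
  have hpqn : p * q - 1 ≠ 0 := hpq.ne'
  obtain ⟨α, hαd⟩ : ∃ α, α = (p + 1) / (p * q - 1) := ⟨_, rfl⟩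
  obtain ⟨β, hβd⟩ : ∃ β, β = (q + 1) / (p * q - 1) := ⟨_, rfl⟩
  have hα : 0 < α := by rw [hαd]; positivity
  have hβ : 0 < β := by rw [hβd]; positivity
  have hp1 : β * p = α + 1 := by rw [hαd, hβd, div_mul_eq_mul_div, div_add_one hpqn]; congr 1; ring
  have hq1 : α * q = β + 1 := by rw [hαd, hβd, div_mul_eq_mul_div, div_add_one hpqn]; congr 1; ring
  have hαβ : α * (q + 1) = β * (p + 1) := by rw [hαd, hβd]; field_simp
  have hp0 : 0 < p + 1 := by linarith
  have hq0 : 0 < q + 1 := by linarith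
  have hr : α * (p * (q + 1) / (p + 1)) = α + 1 := by
    
    rw [← hp1, show α * (p * (q + 1) / (p + 1)) = α * (q + 1) * p / (p + 1) by ring, hαβ]
    field_simp
  have hs : β * (q * (p + 1) / (q + 1)) = β + 1 := by
    
    rw [← hq1, show β * (q * (p + 1) / (q + 1)) = β * (p + 1) * q / (q + 1) by ring, ← hαβ]
    field_simp
  have hr1 : 1 < p * (q + 1) / (p + 1) := by
    rw [lt_div_iff₀ hp0]; nlinarith
  have hs1 : 1 < q * (p + 1) / (q + 1) := by
    rw [lt_div_iff₀ hq0]; nlinarith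
  obtain ⟨k, hk, C, hC, τ₀, hτ₀, H⟩ := S.two_sided hα hβ hp1 hq1 hr hs hr1 hs1 hρ₀ hblow₀
  rw [← hρ₁, ← hρ₂] at H
  obtain ⟨C₁, hC₁⟩ : ∃ C₁, C₁ = k ^ (q + 1) / C ^ (p + 1) := ⟨_, rfl⟩
  obtain ⟨C₂, hC₂⟩ : ∃ C₂, C₂ = C ^ (q + 1) / k ^ (p + 1) := ⟨_, rfl⟩
  have hC₁0 : 0 < C₁ := by rw [hC₁]; positivity
  have hC₂0 : 0 < C₂ := by rw [hC₂]; positivity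
  have hratio : ∀ s a b : ℝ, 0 < s → k * s ^ (-α) ≤ a → a ≤ C * s ^ (-α) → k * s ^ (-β) ≤ b →
      b ≤ C * s ^ (-β) → C₁ ≤ a ^ (q + 1) / b ^ (p + 1) ∧ a ^ (q + 1) / b ^ (p + 1) ≤ C₂ := by
    intro s a b h0 h1 h2 h3 h4
    have sa := Real.rpow_pos_of_pos h0 (-α)
    have sb := Real.rpow_pos_of_pos h0 (-β)
    have a0 : 0 < a := lt_of_lt_of_le (by positivity) h1
    have b0 : 0 < b := lt_of_lt_of_le (by positivity) h3
    obtain ⟨D, hD⟩ : ∃ D, D = s ^ (-(α * (q + 1))) := ⟨_, rfl⟩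
    have hD0 : 0 < D := by rw [hD]; exact Real.rpow_pos_of_pos h0 _
    have eA : ∀ m : ℝ, 0 < m → (m * s ^ (-α)) ^ (q + 1) = m ^ (q + 1) * D := by
      intro m hm
      rw [Real.mul_rpow hm.le sa.le, ← Real.rpow_mul h0.le, hD]; ring_nf
    have eB : ∀ m : ℝ, 0 < m → (m * s ^ (-β)) ^ (p + 1) = m ^ (p + 1) * D := by
      intro m hm
      rw [Real.mul_rpow hm.le sb.le, ← Real.rpow_mul h0.le, hD, hαβ]; ring_nf
    have i1 := Real.rpow_le_rpow (by positivity) h1 hq0.le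
    have i2 := Real.rpow_le_rpow (by positivity) h2 hq0.le
    have i3 := Real.rpow_le_rpow (by positivity) h3 hp0.le
    have i4 := Real.rpow_le_rpow (by positivity) h4 hp0.le
    rw [eA _ hk] at i1
    rw [eA _ hC] at i2
    rw [eB _ hk] at i3
    rw [eB _ hC] at i4
    have b1 := Real.rpow_pos_of_pos b0 (p + 1)
    have a1 := Real.rpow_pos_of_pos a0 (q + 1)
    have k1 := Real.rpow_pos_of_pos hk (p + 1)
    have k2 := Real.rpow_pos_of_pos hk (q + 1)
    have k3 := Real.rpow_pos_of_pos hC (p + 1)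
    have k4 := Real.rpow_pos_of_pos hC (q + 1)
    constructor
    · calc C₁ = (k ^ (q + 1) * D) / (C ^ (p + 1) * D) := by rw [hC₁]; field_simp
        _ ≤ _ := by gcongr
    · calc _ ≤ (C ^ (q + 1) * D) / (k ^ (p + 1) * D) := by gcongr
        _ = _ := by rw [hC₂]; field_simp
  obtain ⟨μ, hμ, A, hA, κ₁, hκ₁, κ₂, hκ₂, hκκ, HS⟩ := hstruct C₁ hC₁0 C₂ hC₂0
  obtain ⟨κ, hκd⟩ : ∃ κ, κ = (κ₁ + 1 / κ₂) / 2 := ⟨_, rfl⟩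
  have hκlt : κ₁ < 1 / κ₂ := by rw [lt_div_iff₀ hκ₂]; exact hκκ
  have hκ1 : κ₁ < κ := by linarith
  have hκ2 : κ * κ₂ < 1 := by
    rw [← lt_div_iff₀ hκ₂]; linarith
  have hκ0 : 0 < κ := by linarith
  have hpowT : ∀ m D : ℝ, 0 < D → Tendsto (fun e : ℝ => m * D ^ e) (nhdsWithin 0 (Ioi 0)) (nhds m) := by
    intro m D hD
    have : ContinuousAt (fun e : ℝ => m * D ^ e) 0 :=
      (Real.continuousAt_const_rpow hD.ne').const_mul m
    have h2 := this.tendsto.mono_left (nhdsWithin_le_nhds (s := Ioi (0:ℝ)))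
    simpa using h2
  have hlinT : ∀ m D : ℝ, 0 < D → ∀ᶠ e : ℝ in nhdsWithin 0 (Ioi 0), e * m < D := by
    intro m D hD
    have : Continuous fun e : ℝ => e * m := by fun_prop
    have h2 := (this.tendsto 0).mono_left (nhdsWithin_le_nhds (s := Ioi (0:ℝ)))
    rw [zero_mul] at h2
    exact h2.eventually (gt_mem_nhds hD)
  obtain ⟨e, e1, e2, e3, e4, e5, e6, e7⟩ := (((hpowT κ₁ C₂ hC₂0).eventually (gt_mem_nhds hκ1)).and
    (((hpowT (κ * κ₂) (1 / C₁) (by positivity)).eventually (gt_mem_nhds hκ2)).and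
    ((hlinT (q + 1) (μ / 2) (by positivity)).and ((hlinT (p + 1) (μ / 2) (by positivity)).and
    ((hlinT (q + 1) (p * (q + 1) / (p + 1) - 1) (by linarith)).and
    ((hlinT (p + 1) (q * (p + 1) / (q + 1) - 1) (by linarith)).and
    (show ∀ᶠ e : ℝ in nhdsWithin 0 (Ioi 0), 0 < e from self_mem_nhdsWithin))))))).exists
  have g1 : 0 < e * (q + 1) := by positivity
  have g2 : 0 < e * (p + 1) := by positivity
  have hρ0 := hρ₀.1
  have hρR := hρ₀.2
  have hρ10 : 0 < ρ₁ := by linarith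
  obtain ⟨l, hl⟩ : ∃ l, l = Real.pi / (ρ₂ - ρ₁) := ⟨_, rfl⟩
  have hl0 : 0 < l := by rw [hl]; exact div_pos Real.pi_pos (by linarith)
  obtain ⟨K, hK⟩ : ∃ K, K = 2 * l ^ 2 + (((n:ℝ) - 1) / ρ₁) ^ 2 / 2 + ((n:ℝ) - 1) / ρ₁ ^ 2 := ⟨_, rfl⟩
  obtain ⟨A₁, hA₁, M1⟩ := aux_main_cond (p := p) (q := q) (c₁ := c₁) (d := δ) (K := K) (B := 2 * l) (C₂ := C₂)
    (μ := μ) (e := e) (γ := 1 + e * (q + 1)) (γ' := 1 + e * (p + 1)) (κ₁ := κ₁) (σb := 1)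
    hp hc₁ hδ hC₂0 hμ e7 hκ₁ (by positivity) rfl rfl (by linarith) (by linarith) (by linarith)
  obtain ⟨A₂, hA₂, M2⟩ := aux_main_cond (p := q) (q := p) (c₁ := c₁) (d := 1) (K := K) (B := 2 * l) (C₂ := 1 / C₁)
    (μ := μ) (e := e) (γ := 1 + e * (p + 1)) (γ' := 1 + e * (q + 1)) (κ₁ := κ₂) (σb := κ)
    hq hc₁ one_pos (by positivity) hμ e7 hκ₂ (by positivity) rfl rfl (by linarith) (by linarith) (by linarith)
  obtain ⟨A₃, hA₃⟩ : ∃ A₃, A₃ = max A (max A₁ A₂) := ⟨_, rfl⟩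
  have hev : ∀ᶠ s : ℝ in nhdsWithin 0 (Ioi 0), A₃ * s ^ α ≤ k ∧ A₃ * s ^ β ≤ k ∧ s ≤ τ₀ :=
    (aux_small_pow hk hα).and ((aux_small_pow hk hβ).and
      (by filter_upwards [Ioc_mem_nhdsGT hτ₀] with s h using h.2))
  obtain ⟨s₁, hs₁, hs₁'⟩ := (mem_nhdsGT_iff_exists_Ioc_subset (a := (0:ℝ))).1 hev
  have hs₁ : 0 < s₁ := hs₁
  have hlarge : ∀ s a w : ℝ, 0 < s → A₃ * s ^ a ≤ k → k * s ^ (-a) ≤ w → A₃ ≤ w := by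
    intro s a w h0 h1 h2
    refine le_trans ?_ h2
    rw [Real.rpow_neg h0.le, ← div_eq_mul_inv, le_div_iff₀ (Real.rpow_pos_of_pos h0 a)]
    exact h1
  refine ⟨1 + e * (q + 1), by linarith, 1 + e * (p + 1), by linarith, κ, hκ0, T - min s₁ (T / 2),
    ⟨by linarith [min_le_right s₁ (T / 2)], by linarith [show 0 < min s₁ (T / 2) by positivity]⟩, ?_⟩
  intro ε hε hε1 J J' hJ hJ'
  filter_upwards [S.reg, S.swap.reg] with x hx1 hx2 hx
  obtain ⟨t, y⟩ := x
  obtain ⟨⟨ht1, ht2⟩, hy1, hy2⟩ := hx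
  simp only at ht1 ht2 hy1 hy2 hx1 hx2 ⊢
  have hm1 := min_le_left s₁ (T / 2)
  have hm2 := min_le_right s₁ (T / 2)
  have hmem : (t, y) ∈ Ioo 0 T ×ˢ Ioo 0 R := ⟨⟨by linarith, ht2⟩, by linarith, by linarith⟩
  obtain ⟨W, Y, hW, hY, hWY⟩ := hx1 hmem
  obtain ⟨W', Y', hW', hY', hWY'⟩ := hx2 hmem
  have hT0 : 0 < T - t := by linarith
  obtain ⟨q1, q2, q3⟩ := hs₁' (show T - t ∈ Ioc 0 s₁ from ⟨hT0, by linarith⟩)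
  obtain ⟨⟨u1, u2⟩, v1, v2⟩ := H t hmem.1.1 ht2 q3 y ⟨hy1.le, hy2.le⟩
  obtain ⟨r1, r2⟩ := hratio _ _ _ hT0 u1 u2 v1 v2
  have Lu := hlarge _ _ _ hT0 q1 u1
  have Lv := hlarge _ _ _ hT0 q2 v1
  rw [hA₃, max_le_iff, max_le_iff] at Lu Lv
  have u0 : 0 < u t y := lt_of_lt_of_le hA Lu.1
  have v0 : 0 < v t y := lt_of_lt_of_le hA Lv.1
  obtain ⟨st1, st2⟩ := HS _ _ Lu.1 Lv.1 r1 r2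
  have r3 : v t y ^ (p + 1) / u t y ^ (q + 1) ≤ 1 / C₁ := by
    rw [← inv_div, one_div]
    exact inv_anti₀ hC₁0 r1
  have m1 := M1 _ _ _ _ _ ε (ε * κ) Lu.2.1 v0 r2 (hF_low _ _ u0.le v0.le) st1 (hFv _ _ u0.le v0.le) hε hε1
    (by gcongr)
  have m2 := M2 _ _ _ _ _ (ε * κ) ε Lv.2.2 u0 r3 (hG_low _ _ u0.le v0.le) st2 (hGu _ _ u0.le v0.le)
    (by positivity) (mul_le_of_le_one_left hκ0.le hε1)
    (by
      have h9 := mul_le_mul_of_nonneg_left e2.le hε.le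
      rw [mul_one] at h9
      refine le_trans (le_of_eq ?_) h9
      ring)
  have hN := S.N0
  have hcd : ∀ z, HasDerivAt c (2 * l * Real.sin (Real.pi * (z - ρ₁) / (ρ₂ - ρ₁)) *
      Real.cos (Real.pi * (z - ρ₁) / (ρ₂ - ρ₁))) z := by
    intro z
    rw [hc, hl]
    exact aux_c_deriv z
  have hcd2 := aux_c_deriv2 (a := Real.pi) (b := ρ₁) (k := ρ₂ - ρ₁) y
  rw [← hl] at hcd2
  have hcx : c y = Real.sin (Real.pi * (y - ρ₁) / (ρ₂ - ρ₁)) ^ 2 := by rw [hc]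
  have hc0 : 0 ≤ c y := by rw [hcx]; positivity
  have hKK := aux_c_K (l := l) (s := Real.sin (Real.pi * (y - ρ₁) / (ρ₂ - ρ₁)))
    (k := Real.cos (Real.pi * (y - ρ₁) / (ρ₂ - ρ₁))) hρ10 hy1.le hN rfl rfl
  rw [← hK, ← hcx] at hKK
  have hBB : 2 * l * Real.sin (Real.pi * (y - ρ₁) / (ρ₂ - ρ₁)) *
      Real.cos (Real.pi * (y - ρ₁) / (ρ₂ - ρ₁)) ≤ 2 * l := by
    exact aux_c_B hl0.le _
  rw [← hcx] at hcd2
  constructor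
  · exact S.J_ineq hmem.1 hmem.2 u0 hW hY hWY hcd hcd2 hε hc0 (by linarith) hKK hBB m1 hJ hJ'
  · have := S.swap.J_ineq hmem.1 hmem.2 v0 hW' hY' hWY' hcd hcd2 (show 0 < ε * κ by positivity) hc0
      (by linarith) hKK hBB m2 hJ' hJ
    simp only [one_mul, mul_one] at this
    linarith

end

/-- Differential inequalities for the auxiliary functions
`J = u_ρ + ε c(ρ) u^γ` and `J̄ = v_ρ + ε κ c(ρ) v^γ̄`, with
`c(ρ) = sin²(π(ρ-ρ₁)/(ρ₂-ρ₁))`, `ρ₁ = ρ₀/4`, `ρ₂ = ρ₀/2`, near a nonzero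
blow-up point `ρ₀` of a radially decreasing solution of the general system. -/
theorem auxiliary_function_inequalities
    (n : ℕ) (hn : 1 ≤ n) (R : ℝ) (hR : 0 < R)
    (p q δ : ℝ) (hp : 1 < p) (hq : 1 < q) (hδ : 0 < δ)
    (c₁ c₂ : ℝ) (hc₁ : 0 < c₁) (hc₂ : 0 < c₂)
    (T : ℝ) (hT : 0 < T)
    (F G : ℝ → ℝ → ℝ)
    (hF_C1 : ContDiff ℝ 1 (Function.uncurry F))
    (hG_C1 : ContDiff ℝ 1 (Function.uncurry G))
    (hFv : ∀ a b : ℝ, 0 ≤ a → 0 ≤ b → 0 ≤ deriv (fun y => F a y) b)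
    (hGu : ∀ a b : ℝ, 0 ≤ a → 0 ≤ b → 0 ≤ deriv (fun x => G x b) a)
    (hF_low : ∀ a b : ℝ, 0 ≤ a → 0 ≤ b → c₁ * b ^ p ≤ F a b)
    (hF_up : ∀ a b : ℝ, 0 ≤ a → 0 ≤ b →
      F a b ≤ c₂ * (b ^ p + a ^ (p * (q + 1) / (p + 1)) + 1))
    (hG_low : ∀ a b : ℝ, 0 ≤ a → 0 ≤ b → c₁ * a ^ q ≤ G a b)
    (hG_up : ∀ a b : ℝ, 0 ≤ a → 0 ≤ b →
      G a b ≤ c₂ * (a ^ q + b ^ (q * (p + 1) / (q + 1)) + 1))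
    (hstruct : ∀ C₁ > (0:ℝ), ∀ C₂ > (0:ℝ),
      ∃ μ > (0:ℝ), ∃ A > (0:ℝ), ∃ κ₁ > (0:ℝ), ∃ κ₂ > (0:ℝ), κ₁ * κ₂ < 1 ∧
        ∀ a b : ℝ, A ≤ a → A ≤ b →
          C₁ ≤ a ^ (q + 1) / b ^ (p + 1) → a ^ (q + 1) / b ^ (p + 1) ≤ C₂ →
          (1 + μ) * F a b
              ≤ a * deriv (fun x => F x b) a + κ₁ * b * deriv (fun y => F a y) b ∧
          (1 + μ) * G a b
              ≤ b * deriv (fun y => G a y) b + κ₂ * a * deriv (fun x => G x b) a)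
    (u v : ℝ → ℝ → ℝ)
    (hu_nn : ∀ t ∈ Ico (0:ℝ) T, ∀ ρ ∈ Icc (0:ℝ) R, 0 ≤ u t ρ)
    (hv_nn : ∀ t ∈ Ico (0:ℝ) T, ∀ ρ ∈ Icc (0:ℝ) R, 0 ≤ v t ρ)
    (hu_cont : ContinuousOn (Function.uncurry u) (Ico (0:ℝ) T ×ˢ Icc (0:ℝ) R))
    (hv_cont : ContinuousOn (Function.uncurry v) (Ico (0:ℝ) T ×ˢ Icc (0:ℝ) R))
    (hu_regx : ∀ t ∈ Ioo (0:ℝ) T, ContDiffOn ℝ 2 (u t) (Ioo (0:ℝ) R))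
    (hv_regx : ∀ t ∈ Ioo (0:ℝ) T, ContDiffOn ℝ 2 (v t) (Ioo (0:ℝ) R))
    (hu_regt : ∀ ρ ∈ Ioo (0:ℝ) R, ∀ t ∈ Ioo (0:ℝ) T, DifferentiableAt ℝ (fun s => u s ρ) t)
    (hv_regt : ∀ ρ ∈ Ioo (0:ℝ) R, ∀ t ∈ Ioo (0:ℝ) T, DifferentiableAt ℝ (fun s => v s ρ) t)
    (hu_bc : ∀ t ∈ Ioo (0:ℝ) T, u t R = 0)
    (hv_bc : ∀ t ∈ Ioo (0:ℝ) T, v t R = 0)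
    (hu_rho : ∀ t ∈ Ioo (0:ℝ) T, ∀ ρ ∈ Ioo (0:ℝ) R, deriv (u t) ρ ≤ 0)
    (hv_rho : ∀ t ∈ Ioo (0:ℝ) T, ∀ ρ ∈ Ioo (0:ℝ) R, deriv (v t) ρ ≤ 0)
    (hu_pde : ∀ t ∈ Ioo (0:ℝ) T, ∀ ρ ∈ Ioo (0:ℝ) R,
      deriv (fun s => u s ρ) t
        = δ * (deriv (deriv (u t)) ρ + ((n : ℝ) - 1) / ρ * deriv (u t) ρ)
          + F (u t ρ) (v t ρ))
    (hv_pde : ∀ t ∈ Ioo (0:ℝ) T, ∀ ρ ∈ Ioo (0:ℝ) R,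
      deriv (fun s => v s ρ) t
        = deriv (deriv (v t)) ρ + ((n : ℝ) - 1) / ρ * deriv (v t) ρ
          + G (u t ρ) (v t ρ))
    (hblow : ∀ M : ℝ, ∀ ε > (0:ℝ), ∃ t, T - ε < t ∧ t < T ∧ M < u t 0 + v t 0)
    (ρ₀ : ℝ) (hρ₀ : ρ₀ ∈ Ioo (0:ℝ) R)
    (hblow₀ : ∀ M : ℝ, ∀ ε > (0:ℝ), ∃ t, T - ε < t ∧ t < T ∧ M < u t ρ₀ + v t ρ₀)
    (ρ₁ ρ₂ : ℝ) (hρ₁ : ρ₁ = ρ₀ / 4) (hρ₂ : ρ₂ = ρ₀ / 2)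
    (c : ℝ → ℝ) (hc : c = fun ρ => Real.sin (Real.pi * (ρ - ρ₁) / (ρ₂ - ρ₁)) ^ 2) :
    ∃ γ > (1:ℝ), ∃ γ' > (1:ℝ), ∃ κ > (0:ℝ), ∃ T₁ ∈ Ioo (0:ℝ) T,
      ∀ ε : ℝ, 0 < ε → ε ≤ 1 →
        ∀ J J' : ℝ → ℝ → ℝ,
          J = (fun t ρ => deriv (u t) ρ + ε * c ρ * u t ρ ^ γ) →
          J' = (fun t ρ => deriv (v t) ρ + ε * κ * c ρ * v t ρ ^ γ') →
          ∀ᵐ x ∂(volume : Measure (ℝ × ℝ)),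
            x ∈ Ico T₁ T ×ˢ Ioo ρ₁ ρ₂ →
              (deriv (fun s => J s x.2) x.1
                  - δ * deriv (deriv (J x.1)) x.2
                  - δ * (((n : ℝ) - 1) / x.2) * deriv (J x.1) x.2
                  + δ * (((n : ℝ) - 1) / x.2 ^ 2) * J x.1 x.2
                ≤ deriv (fun y => F (u x.1 x.2) y) (v x.1 x.2) * J' x.1 x.2
                  + (deriv (fun z => F z (v x.1 x.2)) (u x.1 x.2)
                      - 2 * ε * δ * γ * deriv c x.2 * u x.1 x.2 ^ (γ - 1))
                    * J x.1 x.2) ∧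
              (deriv (fun s => J' s x.2) x.1
                  - deriv (deriv (J' x.1)) x.2
                  - (((n : ℝ) - 1) / x.2) * deriv (J' x.1) x.2
                  + (((n : ℝ) - 1) / x.2 ^ 2) * J' x.1 x.2
                ≤ deriv (fun z => G z (v x.1 x.2)) (u x.1 x.2) * J x.1 x.2
                  + (deriv (fun y => G (u x.1 x.2) y) (v x.1 x.2)
                      - 2 * ε * γ' * κ * deriv c x.2 * v x.1 x.2 ^ (γ' - 1))
                    * J' x.1 x.2) := by
  exact aux_final_ineq n hn R hR p q δ hp hq hδ c₁ c₂ hc₁ hc₂ T hT F G hF_C1 hG_C1 hFv hGu hF_low hF_up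
    hG_low hG_up hstruct u v hu_nn hv_nn hu_cont hv_cont hu_regx hv_regx hu_regt hv_regt hu_bc hv_bc
    hu_rho hv_rho hu_pde hv_pde hblow ρ₀ hρ₀ hblow₀ ρ₁ ρ₂ hρ₁ hρ₂ c hc
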